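/- Let ḡ(x,w) = ∏_{i=1}^{r}(x−α_i w)^{n_i} and f̄(y,w) = ∏_{j=1}^{s}(y−β_j w)^{m_j} be homogeneous polynomials of the same degree d, with α₁,…,α_r pairwise distinct complex numbers, β₁,…,β_s pairwise distinct complex numbers, and all n_i, m_j positive. Let B̄ ⊂ ℙ²(ℂ) be the projective plane curve with equation ḡ(x,w) = f̄(y,w) (in homogeneous coordinates [x:y:w]), and assume that every singular point of B̄ is contained in the union of lines {ḡ(x,w) = 0}. Let n = gcd(n₁,…,n_r) and m = gcd(m₁,…,m_s) (so m divides d). Then the fundamental group of ℙ²(ℂ) ∖ B̄ is isomorphic to the quotient of G_{m,n} by the normal closure of the element (g₁·g₂⋯g_m)^{d/m}; equivalently, to the group presented by generators g₁,…,g_m with the relators of G_{m,n} together with the extra relator (g₁⋯g_m)^{d/m}. -/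

import Mathlib

set_option linter.all false
set_option linter.deprecated false

/-- The quotient topology on the complex projective plane `ℙ²(ℂ)`,
i.e. on the projectivization of `ℂ³`. -/
instance : TopologicalSpace (Projectivization ℂ (Fin 3 → ℂ)) :=
  inferInstanceAs (TopologicalSpace (Quotient (projectivizationSetoid ℂ (Fin 3 → ℂ))))

namespace JC

open Set

/-- A continuous path (parametrised by `[0,1] ⊂ ℝ`) inside the set `S`. -/
structure IsP {E : Type*} [TopologicalSpace E] (S : Set E) (γ : ℝ → E) : Prop where
  cont : ContinuousOn γ (Icc 0 1)
  mem : ∀ s ∈ Icc (0 : ℝ) 1, γ s ∈ S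

/-- A continuous square inside the set `S`. -/
structure IsSq {E : Type*} [TopologicalSpace E] (S : Set E) (K : ℝ → ℝ → E) : Prop where
  cont : ContinuousOn (fun p : ℝ × ℝ => K p.1 p.2) (Icc 0 1 ×ˢ Icc 0 1)
  mem : ∀ s ∈ Icc (0 : ℝ) 1, ∀ t ∈ Icc (0 : ℝ) 1, K s t ∈ S

/-- A holonomy: an assignment of group elements to paths in `S`, compatible with squares. -/
structure Hol {E : Type*} [TopologicalSpace E] (S : Set E) (H : Type*) [Group H] where
  h : (ℝ → E) → H
  const : ∀ a ∈ S, h (fun _ => a) = 1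
  sq : ∀ K : ℝ → ℝ → E, IsSq S K →
    h (fun s => K s 0) * h (fun t => K 1 t) = h (fun t => K 0 t) * h (fun s => K s 1)

section
variable {E : Type*} [TopologicalSpace E] {S : Set E} {H : Type*} [Group H]

lemma zero_mem_I : (0 : ℝ) ∈ Icc (0 : ℝ) 1 := ⟨le_refl _, zero_le_one⟩
lemma one_mem_I : (1 : ℝ) ∈ Icc (0 : ℝ) 1 := ⟨zero_le_one, le_refl _⟩

lemma IsSq.mk' {K : ℝ → ℝ → E} (hc : Continuous (fun p : ℝ × ℝ => K p.1 p.2))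
    (hm : ∀ s ∈ Icc (0 : ℝ) 1, ∀ t ∈ Icc (0 : ℝ) 1, K s t ∈ S) : IsSq S K :=
  ⟨hc.continuousOn, hm⟩

lemma IsP.mono {S' : Set E} {γ : ℝ → E} (h : IsP S γ) (hs : S ⊆ S') : IsP S' γ :=
  ⟨h.cont, fun s m => hs (h.mem s m)⟩

lemma IsP.congr {γ δ : ℝ → E} (h : IsP S γ) (he : ∀ s ∈ Icc (0 : ℝ) 1, γ s = δ s) : IsP S δ :=
  ⟨h.cont.congr fun s hs => (he s hs).symm, fun s hs => he s hs ▸ h.mem s hs⟩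

lemma Hol.congr (h : Hol S H) {γ δ : ℝ → E} (hγ : IsP S γ)
    (he : ∀ s ∈ Icc (0 : ℝ) 1, γ s = δ s) : h.h γ = h.h δ := by
  classical
  have key := h.sq (fun s t => if s ∈ Icc (0 : ℝ) 1 ∨ t = 0 then γ s else δ s) ⟨?_, ?_⟩
  · have e1 : (fun s : ℝ => if s ∈ Icc (0 : ℝ) 1 ∨ (0 : ℝ) = 0 then γ s else δ s) = γ := by
      funext s; simp
    have e2 : (fun t : ℝ => if (1 : ℝ) ∈ Icc (0 : ℝ) 1 ∨ t = 0 then γ 1 else δ 1)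
        = fun _ => γ 1 := by
      funext s; simp
    have e3 : (fun t : ℝ => if (0 : ℝ) ∈ Icc (0 : ℝ) 1 ∨ t = 0 then γ 0 else δ 0)
        = fun _ => γ 0 := by
      funext s; simp
    have e4 : (fun s : ℝ => if s ∈ Icc (0 : ℝ) 1 ∨ (1 : ℝ) = 0 then γ s else δ s) = δ := by
      funext s
      by_cases hs : s ∈ Icc (0 : ℝ) 1
      · simp only [hs, true_or, if_true]; exact he s hs
      · simp only [hs, false_or, one_ne_zero, if_false]
    rw [e1, e2, e3, e4] at key
    rw [h.const _ (hγ.mem 1 one_mem_I), h.const _ (hγ.mem 0 zero_mem_I), mul_one, one_mul] at key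
    exact key
  · refine (hγ.cont.comp continuousOn_fst fun p hp => hp.1).congr fun p hp => ?_
    simp only [hp.1, true_or, if_true, Function.comp]
  · intro s hs t _
    simp only [hs, true_or, if_true]; exact hγ.mem s hs

/-- Concatenation of subpaths of one path. -/
lemma Hol.sub (h : Hol S H) {γ : ℝ → E} {T : Set ℝ} (hT : Convex ℝ T) (hc : ContinuousOn γ T)
    (hm : ∀ s ∈ T, γ s ∈ S) {a b c : ℝ} (ha : a ∈ T) (hb : b ∈ T) (hcT : c ∈ T) :
    h.h (fun s => γ (a + s * (b - a))) * h.h (fun s => γ (b + s * (c - b))) =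
      h.h (fun s => γ (a + s * (c - a))) := by
  have hin : ∀ s ∈ Icc (0 : ℝ) 1, ∀ t ∈ Icc (0 : ℝ) 1, a + s * (b - a) + s * t * (c - b) ∈ T := by
    intro s hs t ht
    have h1 : (1 - t) * b + t * c ∈ T :=
      hT hb hcT (by linarith [ht.2]) ht.1 (by ring)
    have h2 := hT ha h1 (a := 1 - s) (b := s) (by linarith [hs.2]) hs.1 (by ring)
    have : a + s * (b - a) + s * t * (c - b) = (1 - s) • a + s • ((1 - t) * b + t * c) := by
      simp only [smul_eq_mul]; ring
    rw [this]; exact h2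
  have key := h.sq (fun s t => γ (a + s * (b - a) + s * t * (c - b))) ⟨?_, ?_⟩
  · have e3 : (fun t : ℝ => γ (a + 0 * (b - a) + 0 * t * (c - b))) = fun _ => γ a := by
      funext t; congr 1; ring
    rw [e3, h.const _ (hm a ha)] at key
    convert key using 1
    · congr 1
      · congr 1; funext s; congr 1; ring
      · congr 1; funext s; congr 1; ring
    · rw [one_mul]; congr 1; funext s; congr 1; ring
  · refine hc.comp (by fun_prop) ?_
    intro p hp
    exact hin p.1 hp.1 p.2 hp.2
  · intro s hs t ht
    exact hm _ (hin s hs t ht)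

lemma convex_I : Convex ℝ (Icc (0 : ℝ) 1) := convex_Icc 0 1

lemma IsP.sub {γ : ℝ → E} {T : Set ℝ} (hT : Convex ℝ T) (hc : ContinuousOn γ T)
    (hm : ∀ s ∈ T, γ s ∈ S) {a b : ℝ} (ha : a ∈ T) (hb : b ∈ T) :
    IsP S (fun s => γ (a + s * (b - a))) := by
  have hin : ∀ s ∈ Icc (0 : ℝ) 1, a + s * (b - a) ∈ T := by
    intro s hs
    have h2 := hT ha hb (a := 1 - s) (b := s) (by linarith [hs.2]) hs.1 (by ring)
    have : a + s * (b - a) = (1 - s) • a + s • b := by simp only [smul_eq_mul]; ring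
    rw [this]; exact h2
  exact ⟨hc.comp (by fun_prop) hin, fun s hs => hm _ (hin s hs)⟩

lemma IsP.rev {γ : ℝ → E} (hγ : IsP S γ) : IsP S (fun s => γ (1 - s)) := by
  have := IsP.sub convex_I hγ.cont hγ.mem one_mem_I zero_mem_I
  refine this.congr fun s _ => ?_
  congr 1; ring

lemma Hol.rev (h : Hol S H) {γ : ℝ → E} (hγ : IsP S γ) :
    h.h (fun s => γ (1 - s)) = (h.h γ)⁻¹ := by
  have := h.sub convex_I hγ.cont hγ.mem zero_mem_I one_mem_I zero_mem_I
  have e1 : (fun s : ℝ => γ (0 + s * (1 - 0))) = γ := by funext s; congr 1; ring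
  have e2 : (fun s : ℝ => γ (1 + s * (0 - 1))) = fun s => γ (1 - s) := by
    funext s; congr 1; ring
  have e3 : (fun s : ℝ => γ (0 + s * (0 - 0))) = fun _ => γ 0 := by funext s; congr 1; ring
  rw [e1, e2, e3, h.const _ (hγ.mem 0 zero_mem_I)] at this
  exact eq_inv_of_mul_eq_one_right this

/-- Concatenation. -/
noncomputable def jn (γ δ : ℝ → E) : ℝ → E := fun s => if s ≤ 1 / 2 then γ (2 * s) else δ (2 * s - 1)

lemma jn_zero (γ δ : ℝ → E) : jn γ δ 0 = γ 0 := by simp [jn]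
lemma jn_one (γ δ : ℝ → E) : jn γ δ 1 = δ 1 := by
  have : ¬ ((1 : ℝ) ≤ 1 / 2) := by norm_num
  simp only [jn, this, if_false]; norm_num

lemma IsP.jn {γ δ : ℝ → E} (hγ : IsP S γ) (hδ : IsP S δ) (he : γ 1 = δ 0) : IsP S (jn γ δ) := by
  constructor
  · unfold JC.jn
    refine ContinuousOn.if' ?_ ?_ ?_ ?_
    · rintro a ⟨ha, hf⟩
      have : a = 1 / 2 := by
        have := frontier_Iic (a := (1 / 2 : ℝ))
        change a ∈ frontier (Iic (1 / 2 : ℝ)) at hf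
        rw [this] at hf; exact hf
      subst this
      have h1 : ContinuousOn (fun s : ℝ => γ (2 * s)) (Icc (0 : ℝ) 1 ∩ {a | a ≤ 1 / 2}) := by
        refine hγ.cont.comp (by fun_prop) ?_
        rintro s ⟨hs, hs2⟩
        simp only [mem_setOf_eq] at hs2
        exact ⟨by linarith [hs.1], by linarith⟩
      have := h1 (1 / 2) ⟨ha, by simp⟩
      simpa using this.tendsto
    · rintro a ⟨ha, hf⟩
      have : a = 1 / 2 := by
        have := frontier_Iic (a := (1 / 2 : ℝ))
        change a ∈ frontier (Iic (1 / 2 : ℝ)) at hf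
        rw [this] at hf; exact hf
      subst this
      have h1 : ContinuousOn (fun s : ℝ => δ (2 * s - 1)) (Icc (0 : ℝ) 1 ∩ {a | 1 / 2 ≤ a}) := by
        refine hδ.cont.comp (by fun_prop) ?_
        rintro s ⟨hs, hs2⟩
        simp only [mem_setOf_eq] at hs2
        exact ⟨by linarith, by linarith [hs.2]⟩
      have := (h1 (1 / 2) ⟨ha, by simp⟩).tendsto
      simp only [le_refl, if_true]
      have e : γ (2 * (1 / 2)) = δ (2 * (1 / 2) - 1) := by norm_num [he]
      rw [e]
      refine this.mono_left (nhdsWithin_mono _ ?_)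
      rintro s ⟨hs, hs2⟩
      simp only [mem_setOf_eq, not_le] at hs2
      exact ⟨hs, hs2.le⟩
    · refine hγ.cont.comp (by fun_prop) ?_
      rintro s ⟨hs, hs2⟩
      simp only [mem_setOf_eq] at hs2
      exact ⟨by linarith [hs.1], by linarith⟩
    · refine hδ.cont.comp (by fun_prop) ?_
      rintro s ⟨hs, hs2⟩
      simp only [mem_setOf_eq, not_le] at hs2
      exact ⟨by linarith, by linarith [hs.2]⟩
  · intro s hs
    unfold JC.jn
    split_ifs with h
    · exact hγ.mem _ ⟨by linarith [hs.1], by linarith⟩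
    · exact hδ.mem _ ⟨by linarith, by linarith [hs.2]⟩

lemma Hol.jn (h : Hol S H) {γ δ : ℝ → E} (hγ : IsP S γ) (hδ : IsP S δ) (he : γ 1 = δ 0) :
    h.h (jn γ δ) = h.h γ * h.h δ := by
  have hj := hγ.jn hδ he
  have half : (1 / 2 : ℝ) ∈ Icc (0 : ℝ) 1 := ⟨by norm_num, by norm_num⟩
  have := h.sub convex_I hj.cont hj.mem zero_mem_I half one_mem_I
  have e1 : h.h (fun s : ℝ => JC.jn γ δ (0 + s * (1 - 0))) = h.h (JC.jn γ δ) := by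
    congr 1; funext s; congr 1; ring
  have e2 : h.h γ = h.h (fun s : ℝ => JC.jn γ δ (0 + s * (1 / 2 - 0))) := by
    refine h.congr hγ fun s hs => ?_
    have : (0 + s * (1 / 2 - 0) : ℝ) ≤ 1 / 2 := by linarith [hs.2]
    simp only [JC.jn, this, if_true]; congr 1; ring
  have e3 : h.h δ = h.h (fun s : ℝ => JC.jn γ δ (1 / 2 + s * (1 - 1 / 2))) := by
    refine h.congr hδ fun s hs => ?_
    rcases eq_or_lt_of_le hs.1 with h0 | h0
    · rw [← h0]; simp [JC.jn, he]
    · have : ¬ (1 / 2 + s * (1 - 1 / 2) : ℝ) ≤ 1 / 2 := by linarith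
      simp only [JC.jn, this, if_false]; congr 1; ring
  rw [← e1, ← this, e2, e3]

lemma IsP.const {a : E} (ha : a ∈ S) : IsP S (fun _ => a) :=
  ⟨continuousOn_const, fun _ _ => ha⟩

lemma IsSq.left {K : ℝ → ℝ → E} (hK : IsSq S K) {s : ℝ} (hs : s ∈ Icc (0 : ℝ) 1) :
    IsP S (fun t => K s t) :=
  ⟨hK.cont.comp (f := fun t : ℝ => (s, t)) (by fun_prop) fun t ht => ⟨hs, ht⟩,
    fun t ht => hK.mem s hs t ht⟩

lemma IsSq.bot {K : ℝ → ℝ → E} (hK : IsSq S K) {t : ℝ} (ht : t ∈ Icc (0 : ℝ) 1) :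
    IsP S (fun s => K s t) :=
  ⟨hK.cont.comp (f := fun s : ℝ => (s, t)) (by fun_prop) fun s hs => ⟨hs, ht⟩,
    fun s hs => hK.mem s hs t ht⟩

/-- Pull back a holonomy along a map. -/
def Hol.comap (h : Hol S H) {E' : Type*} [TopologicalSpace E'] {S' : Set E'} (f : E' → E)
    (hf : ContinuousOn f S') (hm : MapsTo f S' S) : Hol S' H where
  h γ := h.h (fun s => f (γ s))
  const a ha := h.const _ (hm ha)
  sq K hK := h.sq (fun s t => f (K s t))
    ⟨hf.comp hK.cont fun p hp => hK.mem _ hp.1 _ hp.2, fun s hs t ht => hm (hK.mem s hs t ht)⟩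

/-- Gauge change. -/
def Hol.gauge (h : Hol S H) (u : E → H) : Hol S H where
  h γ := u (γ 0) * h.h γ * (u (γ 1))⁻¹
  const a ha := by rw [h.const a ha]; group
  sq K hK := by
    have := h.sq K hK
    calc u (K 0 0) * h.h (fun s => K s 0) * (u (K 1 0))⁻¹ *
        (u (K 1 0) * h.h (fun t => K 1 t) * (u (K 1 1))⁻¹)
        = u (K 0 0) * (h.h (fun s => K s 0) * h.h (fun t => K 1 t)) * (u (K 1 1))⁻¹ := by group
      _ = _ := by rw [this]; group

end

section
variable {E : Type*} [AddCommGroup E] [Module ℝ E] [TopologicalSpace E] [IsTopologicalAddGroup E]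
  [ContinuousSMul ℝ E] {S : Set E} {H : Type*} [Group H]

lemma Hol.cone (h : Hol S H) (c : E) {γ : ℝ → E} (hγ : ContinuousOn γ (Icc 0 1))
    (hm : ∀ s ∈ Icc (0 : ℝ) 1, ∀ t ∈ Icc (0 : ℝ) 1, c + t • (γ s - c) ∈ S) :
    h.h (fun t => c + t • (γ 0 - c)) * h.h γ = h.h (fun t => c + t • (γ 1 - c)) := by
  have key := h.sq (fun s t => c + t • (γ s - c)) ⟨?_, hm⟩
  · simp only [zero_smul, add_zero, one_smul, add_sub_cancel] at key
    have hc : c ∈ S := by have := hm 0 zero_mem_I 0 zero_mem_I; simpa using this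
    rw [h.const _ hc, one_mul] at key
    exact key.symm
  · have : ContinuousOn (fun p : ℝ × ℝ => γ p.1) (Icc 0 1 ×ˢ Icc 0 1) :=
      hγ.comp continuousOn_fst fun p hp => hp.1
    exact continuousOn_const.add (continuousOn_snd.smul (this.sub continuousOn_const))

/-- Make a holonomy trivial on a convex set. -/
lemma Hol.exists_gauge (h : Hol S H) {Ω : Set E} (hΩ : Convex ℝ Ω) (hΩS : Ω ⊆ S) {c : E}
    (hc : c ∈ Ω) : ∃ u : E → H, u c = 1 ∧ (∀ a ∉ Ω, u a = 1) ∧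
      ∀ γ, IsP Ω γ → (h.gauge u).h γ = 1 := by
  classical
  refine ⟨fun a => if a ∈ Ω then h.h (fun t => c + t • (a - c)) else 1, ?_, ?_, ?_⟩
  · simp only [hc, if_true, sub_self, smul_zero, add_zero]
    exact h.const _ (hΩS hc)
  · intro a ha; simp [ha]
  · intro γ hγ
    have := h.cone c hγ.cont (fun s hs t ht => hΩS ?_)
    · simp only [Hol.gauge, hγ.mem 0 zero_mem_I, hγ.mem 1 one_mem_I, if_true]
      rw [this]; group
    · have h2 := hΩ hc (hγ.mem s hs) (a := 1 - t) (b := t) (by linarith [ht.2]) ht.1 (by ring)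
      convert h2 using 1
      module

end
end JC

namespace JC
open Set CategoryTheory

section
variable {X : Type*} [TopologicalSpace X]

/-- The bundled path of a function. -/
def toPath (γ : ℝ → X) (hγ : ContinuousOn γ (Icc 0 1)) : Path (γ 0) (γ 1) where
  toFun t := γ t
  continuous_toFun := by
    exact continuousOn_iff_continuous_restrict.mp hγ
  source' := by simp
  target' := by simp

lemma sq_homotopic {K : ℝ → ℝ → X} (hK : IsSq univ K) :
    ((toPath (fun s => K s 0) (hK.bot zero_mem_I).cont).trans
      (toPath (fun t => K 1 t) (hK.left one_mem_I).cont)).Homotopic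
    ((toPath (fun t => K 0 t) (hK.left zero_mem_I).cont).trans
      (toPath (fun s => K s 1) (hK.bot one_mem_I).cont)) := by
  let Q : Set (ℝ × ℝ) := Icc 0 1 ×ˢ Icc 0 1
  let f : C(Q, X) := ⟨fun p => K p.1.1 p.1.2, continuousOn_iff_continuous_restrict.mp hK.cont⟩
  have hQ : Convex ℝ Q := (convex_Icc 0 1).prod (convex_Icc 0 1)
  haveI : ContractibleSpace Q := hQ.contractibleSpace ⟨(0, 0), zero_mem_I, zero_mem_I⟩
  haveI : SimplyConnectedSpace Q := SimplyConnectedSpace.ofContractible _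
  let q00 : Q := ⟨(0, 0), zero_mem_I, zero_mem_I⟩
  let q10 : Q := ⟨(1, 0), one_mem_I, zero_mem_I⟩
  let q01 : Q := ⟨(0, 1), zero_mem_I, one_mem_I⟩
  let q11 : Q := ⟨(1, 1), one_mem_I, one_mem_I⟩
  let p1 : Path q00 q10 :=
    ⟨⟨fun s => ⟨(s, 0), s.2, zero_mem_I⟩, by fun_prop⟩, rfl, rfl⟩
  let p2 : Path q10 q11 :=
    ⟨⟨fun s => ⟨(1, s), one_mem_I, s.2⟩, by fun_prop⟩, rfl, rfl⟩
  let p3 : Path q00 q01 :=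
    ⟨⟨fun s => ⟨(0, s), zero_mem_I, s.2⟩, by fun_prop⟩, rfl, rfl⟩
  let p4 : Path q01 q11 :=
    ⟨⟨fun s => ⟨(s, 1), s.2, one_mem_I⟩, by fun_prop⟩, rfl, rfl⟩
  have h := SimplyConnectedSpace.paths_homotopic (p1.trans p2) (p3.trans p4)
  have h2 := h.map f
  rw [Path.map_trans, Path.map_trans] at h2
  exact h2

variable [PathConnectedSpace X] (x0 : X)

open Classical in
/-- chosen paths -/
noncomputable def cpath (a : X) : Path x0 a :=
  if h : a = x0 then (Path.refl x0).cast rfl h else PathConnectedSpace.somePath x0 a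

lemma cpath_self : cpath x0 x0 = Path.refl x0 := by simp [cpath]

/-- chosen arrows in the fundamental groupoid -/
noncomputable def carr (a : X) : FundamentalGroupoid.mk x0 ⟶ FundamentalGroupoid.mk a :=
  Path.Homotopic.Quotient.mk (cpath x0 a)

/-- the arrow of a path -/
noncomputable def arr {a b : X} (p : Path a b) : FundamentalGroupoid.mk a ⟶ FundamentalGroupoid.mk b :=
  Path.Homotopic.Quotient.mk p

lemma carr_self : carr x0 x0 = 𝟙 _ := by
  unfold carr; rw [cpath_self]; rfl

noncomputable def vtx {a b : X} (p : Path a b) : FundamentalGroup X x0 :=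
  carr x0 b ≫ Groupoid.inv (arr p) ≫ Groupoid.inv (carr x0 a)

lemma arr_trans {a b c : X} (p : Path a b) (q : Path b c) : arr (p.trans q) = arr p ≫ arr q := rfl

lemma vtx_trans {a b c : X} (p : Path a b) (q : Path b c) :
    vtx x0 (p.trans q) = vtx x0 p * vtx x0 q := by
  rw [End.mul_def]
  unfold vtx
  rw [arr_trans]
  simp [Category.assoc]

open Classical in
/-- The canonical holonomy with values in the fundamental group (path order). -/
noncomputable def canHol : Hol (univ : Set X) (FundamentalGroup X x0) where
  h γ := if hγ : ContinuousOn γ (Icc 0 1) then vtx x0 (toPath γ hγ) else 1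
  const a _ := by
    have : ContinuousOn (fun _ : ℝ => a) (Icc 0 1) := continuousOn_const
    rw [dif_pos this]
    have e : arr (toPath (fun _ : ℝ => a) this) = 𝟙 _ := rfl
    unfold vtx
    rw [e]; simp
  sq K hK := by
    rw [dif_pos (hK.bot zero_mem_I).cont, dif_pos (hK.left one_mem_I).cont,
      dif_pos (hK.left zero_mem_I).cont, dif_pos (hK.bot one_mem_I).cont]
    rw [← vtx_trans, ← vtx_trans]
    have h := Path.Homotopic.Quotient.eq.mpr (sq_homotopic hK)
    unfold vtx
    have h' : arr ((toPath (fun s => K s 0) (hK.bot zero_mem_I).cont).trans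
      (toPath (fun t => K 1 t) (hK.left one_mem_I).cont)) = arr
      ((toPath (fun t => K 0 t) (hK.left zero_mem_I).cont).trans
      (toPath (fun s => K s 1) (hK.bot one_mem_I).cont)) := h
    rw [h']

lemma canHol_eq {a b : X} (p : Path a b) {γ : ℝ → X} (he : ∀ t : unitInterval, γ t = p t) :
    (canHol x0).h γ = vtx x0 p := by
  have h0 : γ 0 = a := by have := he 0; simpa using this
  have h1 : γ 1 = b := by have := he 1; simpa using this
  subst h0 h1
  have hc : ContinuousOn γ (Icc 0 1) := by
    rw [continuousOn_iff_continuous_restrict]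
    have : (Icc (0:ℝ) 1).domRestrict γ = p := by funext t; exact he t
    rw [this]; exact p.continuous
  have e : (canHol x0).h γ = vtx x0 (toPath γ hc) := dif_pos hc
  rw [e]
  congr 1
  ext t; exact he t

lemma vtx_loop (p : Path x0 x0) :
    vtx x0 p = (FundamentalGroup.fromPath (Path.Homotopic.Quotient.mk p))⁻¹ := by
  unfold vtx
  rw [carr_self, Groupoid.inv_eq_inv (𝟙 _), IsIso.inv_id, Category.comp_id, Category.id_comp]
  rfl

lemma vtx_surj (g : FundamentalGroup X x0) : ∃ p : Path x0 x0, vtx x0 p = g := by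
  obtain ⟨p, hp⟩ := Path.Homotopic.Quotient.mk_surjective (FundamentalGroup.toPath (g⁻¹))
  refine ⟨p, ?_⟩
  rw [vtx_loop, hp]
  exact inv_inv g

lemma vtx_eq_one {p : Path x0 x0} (h : vtx x0 p = 1) : p.Homotopic (Path.refl x0) := by
  rw [vtx_loop, inv_eq_one] at h
  exact Path.Homotopic.Quotient.eq.mp h

end
end JC

namespace JC
open Set Polynomial Topology Filter

/-- no multiple roots -/
def Simple (q : ℂ[X]) : Prop := ∀ x, q.eval x = 0 → q.derivative.eval x ≠ 0

lemma simple_iff_nodup {q : ℂ[X]} (hq : q ≠ 0) : Simple q ↔ q.roots.Nodup := by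
  rw [Multiset.nodup_iff_count_le_one]
  constructor
  · intro h a
    by_contra hlt
    push Not at hlt
    rw [count_roots, one_lt_rootMultiplicity_iff_isRoot hq] at hlt
    exact h a hlt.1 hlt.2
  · intro h x hx hx'
    have := (one_lt_rootMultiplicity_iff_isRoot hq (t := x)).mpr ⟨hx, hx'⟩
    rw [← count_roots] at this
    exact absurd (h x) (by omega)

lemma root_near {q : ℂ[X]} (hm : q.Monic) {d : ℕ} (hd : q.natDegree = d) {x : ℂ} {ε : ℝ}
    (hε : 0 < ε) (h : ‖q.eval x‖ < ε ^ d) : ∃ r, q.eval r = 0 ∧ ‖x - r‖ < ε := by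
  by_contra hcon
  push Not at hcon
  have hs : q.Splits := IsAlgClosed.splits q
  have e := hs.eval_eq_prod_roots_of_monic hm x
  have hcard : q.roots.card = d := by rw [← hd]; exact (splits_iff_card_roots.mp hs)
  have key : ∀ s : Multiset ℂ, (∀ r ∈ s, ε ≤ ‖x - r‖) →
      ε ^ s.card ≤ ‖(s.map (fun r => x - r)).prod‖ := by
    intro s
    induction s using Multiset.induction_on with
    | empty => intro _; simp
    | cons a s ih =>
      intro hs
      rw [Multiset.map_cons, Multiset.prod_cons, norm_mul, Multiset.card_cons, pow_succ']
      exact mul_le_mul (hs a (Multiset.mem_cons_self a s))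
        (ih fun r hr => hs r (Multiset.mem_cons_of_mem hr)) (by positivity) (norm_nonneg _)
  have := key q.roots (fun r hr => hcon r ((mem_roots'.mp hr).2))
  rw [hcard] at this
  have e2 : ‖q.eval x‖ = ‖(q.roots.map (fun r => x - r)).prod‖ := by rw [e]
  linarith

/-- The bump function. -/
noncomputable def bump (ε : ℝ) (a x : ℂ) : ℝ := max 0 (1 - ‖x - a‖ / ε)

lemma bump_lip {ε : ℝ} (hε : 0 < ε) (a x y : ℂ) : |bump ε a x - bump ε a y| ≤ ‖x - y‖ / ε := by
  unfold bump
  have h1 : |max 0 (1 - ‖x - a‖ / ε) - max 0 (1 - ‖y - a‖ / ε)| ≤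
      |(1 - ‖x - a‖ / ε) - (1 - ‖y - a‖ / ε)| := by
    rw [max_comm 0, max_comm 0]; exact abs_max_sub_max_le_abs _ _ _
  refine h1.trans ?_
  have : (1 - ‖x - a‖ / ε) - (1 - ‖y - a‖ / ε) = (‖y - a‖ - ‖x - a‖) / ε := by ring
  rw [this, abs_div, abs_of_pos hε]
  gcongr
  have := abs_norm_sub_norm_le (y - a) (x - a)
  rw [show y - a - (x - a) = -(x - y) by ring, norm_neg] at this
  exact this

lemma bump_cont (ε : ℝ) (a : ℂ) : Continuous (bump ε a) := by
  unfold bump; fun_prop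

lemma bump_self {ε : ℝ} (a : ℂ) : bump ε a a = 1 := by simp [bump]

lemma bump_far {ε : ℝ} (hε : 0 < ε) {a x : ℂ} (h : ε ≤ ‖x - a‖) : bump ε a x = 0 := by
  unfold bump
  rw [max_eq_left]
  have : 1 ≤ ‖x - a‖ / ε := by rw [le_div_iff₀ hε]; linarith
  linarith

/-- perturbation of identity -/
lemma perturb_homeo {p : ℂ → ℂ} (hp : ∀ x y, ‖p x - p y‖ ≤ (1/2 : ℝ) * ‖x - y‖) :
    ∃ Φ : ℂ → ℂ, Continuous Φ ∧ (∀ x, Φ x + p (Φ x) = x) ∧ ∀ x, Φ (x + p x) = x := by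
  have hA : ApproximatesLinearOn (fun x => x + p x)
      ((ContinuousLinearEquiv.refl ℂ ℂ : ℂ ≃L[ℂ] ℂ) : ℂ →L[ℂ] ℂ) univ (1/2) := by
    intro x _ y _
    simp only [ContinuousLinearEquiv.coe_coe, ContinuousLinearEquiv.coe_refl', id]
    have := hp x y
    rw [show x + p x - (y + p y) - (x - y) = p x - p y by ring]
    simpa using this
  have hN : Subsingleton ℂ ∨ (1/2 : NNReal) <
      ‖(((ContinuousLinearEquiv.refl ℂ ℂ : ℂ ≃L[ℂ] ℂ).symm : ℂ ≃L[ℂ] ℂ) : ℂ →L[ℂ] ℂ)‖₊⁻¹ := by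
    right
    have : ‖(((ContinuousLinearEquiv.refl ℂ ℂ : ℂ ≃L[ℂ] ℂ).symm : ℂ ≃L[ℂ] ℂ) : ℂ →L[ℂ] ℂ)‖₊ = 1 := by
      have : (((ContinuousLinearEquiv.refl ℂ ℂ : ℂ ≃L[ℂ] ℂ).symm : ℂ ≃L[ℂ] ℂ) : ℂ →L[ℂ] ℂ)
        = ContinuousLinearMap.id ℂ ℂ := rfl
      rw [this]; exact ContinuousLinearMap.nnnorm_id
    rw [this]
    rw [inv_one]
    exact NNReal.half_lt_self one_ne_zero
  let e := hA.toHomeomorph _ hN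
  have he : ∀ x, e x = x + p x := fun x => rfl
  exact ⟨e.symm, e.symm.continuous, fun x => by rw [← he]; exact e.apply_symm_apply x,
    fun x => by rw [← he]; exact e.symm_apply_apply x⟩

theorem local_iso {Λ : Type*} [TopologicalSpace Λ] (q : Λ → ℂ[X]) {d : ℕ} (hd : 0 < d)
    (hm : ∀ l, (q l).Monic) (hdeg : ∀ l, (q l).natDegree = d)
    (hc : ∀ x, Continuous fun l => (q l).eval x) (l0 : Λ) (hsimp : Simple (q l0))
    (N : ℂ) (hN : (q l0).eval N ≠ 0) :
    ∃ U : Set Λ, IsOpen U ∧ l0 ∈ U ∧ ∃ Θ Φ : Λ → ℂ → ℂ,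
      ContinuousOn (fun p : Λ × ℂ => Θ p.1 p.2) (U ×ˢ univ) ∧
      ∀ l ∈ U, Continuous (Φ l) ∧ (∀ x, Θ l (Φ l x) = x) ∧ (∀ x, Φ l (Θ l x) = x) ∧
        Θ l N = N ∧ (∀ x, (q l).eval (Θ l x) = 0 ↔ (q l0).eval x = 0) ∧ Simple (q l) := by
  classical
  have hne : ∀ l, q l ≠ 0 := fun l => (hm l).ne_zero
  set A : Finset ℂ := (q l0).roots.toFinset with hA
  have memA : ∀ a, a ∈ A ↔ (q l0).eval a = 0 := by
    intro a; rw [hA, Multiset.mem_toFinset, mem_roots (hne l0)]; rfl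
  have rcard : ∀ l, (q l).roots.card = d := fun l => by
    rw [← hdeg l]; exact (splits_iff_card_roots.mp (IsAlgClosed.splits (q l)))
  have hcard : A.card = d := by
    rw [hA, Multiset.toFinset_card_of_nodup ((simple_iff_nodup (hne l0)).mp hsimp), rcard]
  have hNA : N ∉ A := fun h => hN ((memA N).mp h)
  -- separation
  obtain ⟨ε, hε, hsep⟩ : ∃ ε : ℝ, 0 < ε ∧ ∀ a ∈ insert N A, ∀ b ∈ insert N A, a ≠ b →
      2 * ε ≤ ‖a - b‖ := by
    have hnt : ((insert N A : Finset ℂ) : Set ℂ).Nontrivial := by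
      obtain ⟨a, ha⟩ := Finset.card_pos.mp (hcard ▸ hd)
      refine ⟨N, by simp, a, by simp [ha], fun h => hNA (h ▸ ha)⟩
    refine ⟨((insert N A : Finset ℂ) : Set ℂ).infsep / 2, ?_, ?_⟩
    · exact half_pos ((Set.Finite.infsep_pos_iff_nontrivial (Finset.finite_toSet _)).mpr hnt)
    · intro a ha b hb hab
      rw [← dist_eq_norm]
      have := Set.infsep_le_dist_of_mem (s := ((insert N A : Finset ℂ) : Set ℂ)) ha hb hab
      linarith
  have hsepA : ∀ a ∈ A, ∀ b ∈ A, a ≠ b → 2 * ε ≤ ‖a - b‖ := fun a ha b hb =>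
    hsep a (Finset.mem_insert_of_mem ha) b (Finset.mem_insert_of_mem hb)
  set η : ℝ := ε / (2 * (d + 1)) with hη
  have hd1 : (0 : ℝ) < 2 * (d + 1) := by positivity
  have ηpos : 0 < η := by positivity
  have ηle : η ≤ ε := by
    rw [hη, div_le_iff₀ hd1]; nlinarith [(Nat.cast_nonneg d : (0 : ℝ) ≤ d)]
  let U : Set Λ := {l | ∀ a ∈ A, ‖(q l).eval a‖ < η ^ d}
  have hU : IsOpen U := by
    have : U = ⋂ a ∈ A, {l | ‖(q l).eval a‖ < η ^ d} := by ext; simp [U]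
    rw [this]
    exact isOpen_biInter_finset fun a _ => isOpen_lt (hc a).norm continuous_const
  have hl0 : l0 ∈ U := by
    intro a ha
    rw [(memA a).mp ha, norm_zero]; positivity
  have hex : ∀ l ∈ U, ∀ a ∈ A, ∃ r, (q l).eval r = 0 ∧ ‖a - r‖ < η := fun l hl a ha =>
    root_near (hm l) (hdeg l) ηpos (hl a ha)
  let ξ : Λ → ℂ → ℂ := fun l a => if h : l ∈ U ∧ a ∈ A then (hex l h.1 a h.2).choose else a
  have hξ : ∀ l ∈ U, ∀ a ∈ A, (q l).eval (ξ l a) = 0 ∧ ‖a - ξ l a‖ < η := by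
    intro l hl a ha
    simp only [ξ, dif_pos (And.intro hl ha)]
    exact (hex l hl a ha).choose_spec
  have uniq : ∀ a ∈ A, ∀ b ∈ A, ∀ r, ‖a - r‖ < η → ‖b - r‖ < η → a = b := by
    intro a ha b hb r h1 h2
    by_contra hab
    have := hsepA a ha b hb hab
    have h3 : ‖a - b‖ ≤ ‖a - r‖ + ‖b - r‖ := by
      have := norm_sub_le (a - r) (b - r)
      rwa [show a - r - (b - r) = a - b by ring] at this
    linarith
  have himg : ∀ l ∈ U, A.image (ξ l) = (q l).roots.toFinset ∧ (q l).roots.Nodup := by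
    intro l hl
    have hsub : A.image (ξ l) ⊆ (q l).roots.toFinset := by
      intro r hr
      obtain ⟨a, ha, rfl⟩ := Finset.mem_image.mp hr
      rw [Multiset.mem_toFinset, mem_roots (hne l)]
      exact (hξ l hl a ha).1
    have hc1 : (A.image (ξ l)).card = d := by
      rw [Finset.card_image_of_injOn, hcard]
      intro a ha b hb hab
      refine uniq a ha b hb (ξ l a) (hξ l hl a ha).2 ?_

      rw [hab]; exact (hξ l hl b hb).2
    have hc2 : (q l).roots.toFinset.card ≤ d := by
      rw [← rcard l]; exact Multiset.toFinset_card_le _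
    have heq := Finset.eq_of_subset_of_card_le hsub (by rw [hc1]; exact hc2)
    refine ⟨heq, ?_⟩
    rw [← Multiset.toFinset_card_eq_card_iff_nodup, ← heq, hc1, rcard]
  have hroot : ∀ l ∈ U, ∀ r, (q l).eval r = 0 → ∃ a ∈ A, ξ l a = r := by
    intro l hl r hr
    have : r ∈ (q l).roots.toFinset := by
      rw [Multiset.mem_toFinset, mem_roots (hne l)]; exact hr
    rw [← (himg l hl).1] at this
    exact Finset.mem_image.mp this
  have hξc : ∀ a ∈ A, ContinuousOn (fun l => ξ l a) U := by
    intro a ha l1 hl1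
    rw [ContinuousWithinAt, Metric.tendsto_nhds]
    intro κ0 hκ0
    obtain ⟨h1, h2⟩ := hξ l1 hl1 a ha
    set κ := min κ0 (η - ‖a - ξ l1 a‖) with hκ
    have κpos : 0 < κ := lt_min hκ0 (by linarith)
    have hev : ∀ᶠ l in 𝓝[U] l1, ‖(q l).eval (ξ l1 a)‖ < κ ^ d := by
      have : ContinuousAt (fun l => ‖(q l).eval (ξ l1 a)‖) l1 := (hc _).norm.continuousAt
      refine (this.continuousWithinAt.tendsto).eventually_lt_const ?_
      simp only [h1, norm_zero]; positivity
    filter_upwards [hev, self_mem_nhdsWithin] with l hl hlU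
    obtain ⟨r, hr, hr2⟩ := root_near (hm l) (hdeg l) κpos hl
    obtain ⟨b, hb, rfl⟩ := hroot l hlU r hr
    have hab : a = b := by
      refine uniq a ha b hb (ξ l b) ?_ (hξ l hlU b hb).2
      have h3 : ‖a - ξ l b‖ ≤ ‖a - ξ l1 a‖ + ‖ξ l1 a - ξ l b‖ := by
        have := norm_add_le (a - ξ l1 a) (ξ l1 a - ξ l b)
        rwa [show a - ξ l1 a + (ξ l1 a - ξ l b) = a - ξ l b by ring] at this
      have := min_le_right κ0 (η - ‖a - ξ l1 a‖)
      rw [← hκ] at this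
      linarith
    subst hab
    rw [dist_comm, dist_eq_norm]
    exact lt_of_lt_of_le hr2 (min_le_left _ _)
  let P : Λ → ℂ → ℂ := fun l x => ∑ a ∈ A, (bump ε a x : ℂ) * (ξ l a - a)
  have hP : ∀ l ∈ U, ∀ x y, ‖P l x - P l y‖ ≤ (1/2 : ℝ) * ‖x - y‖ := by
    intro l hl x y
    have e1 : P l x - P l y = ∑ a ∈ A, (((bump ε a x - bump ε a y : ℝ) : ℂ)) * (ξ l a - a) := by
      simp only [P]
      rw [← Finset.sum_sub_distrib]
      refine Finset.sum_congr rfl fun a _ => ?_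
      push_cast; ring
    rw [e1]
    refine (norm_sum_le _ _).trans ?_
    have : ∀ a ∈ A, ‖(((bump ε a x - bump ε a y : ℝ) : ℂ)) * (ξ l a - a)‖ ≤ ‖x - y‖ / ε * η := by
      intro a ha
      rw [norm_mul, Complex.norm_real, Real.norm_eq_abs]
      refine mul_le_mul (bump_lip hε a x y) ?_ (norm_nonneg _) (by positivity)
      rw [norm_sub_rev]; exact (hξ l hl a ha).2.le
    refine (Finset.sum_le_sum this).trans ?_
    rw [Finset.sum_const, hcard, nsmul_eq_mul, hη]
    have hd0 : (0 : ℝ) ≤ d := Nat.cast_nonneg d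
    have : (d : ℝ) * (‖x - y‖ / ε * (ε / (2 * (d + 1)))) = ‖x - y‖ * (d / (2 * (d + 1))) := by
      field_simp
    rw [this]
    have h2 : (d : ℝ) / (2 * (d + 1)) ≤ 1 / 2 := by
      rw [div_le_div_iff₀ (by positivity) (by norm_num)]; linarith
    nlinarith [norm_nonneg (x - y)]
  have hPa : ∀ l, ∀ a ∈ A, a + P l a = ξ l a := by
    intro l a ha
    have : P l a = ξ l a - a := by
      simp only [P]
      rw [Finset.sum_eq_single a]
      · rw [bump_self]; simp
      · intro b hb hba
        rw [bump_far hε]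
        · simp
        · have := hsepA b hb a ha hba
          rw [norm_sub_rev]; linarith
      · intro h; exact absurd ha h
    rw [this]; ring
  have hPN : ∀ l, P l N = 0 := by
    intro l
    refine Finset.sum_eq_zero fun a ha => ?_
    rw [bump_far hε]
    · simp
    · have := hsep N (by simp) a (Finset.mem_insert_of_mem ha) (fun h => hNA (h ▸ ha))
      linarith
  have hinv : ∀ l, ∃ Φ : ℂ → ℂ, l ∈ U → Continuous Φ ∧ (∀ x, Φ x + P l (Φ x) = x) ∧
      ∀ x, Φ (x + P l x) = x := by
    intro l
    by_cases hl : l ∈ U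
    · obtain ⟨Φ, h⟩ := perturb_homeo (hP l hl)
      exact ⟨Φ, fun _ => h⟩
    · exact ⟨id, fun h => absurd h hl⟩
  choose Φ hΦ using hinv
  refine ⟨U, hU, hl0, fun l x => x + P l x, Φ, ?_, ?_⟩
  · refine ContinuousOn.add continuousOn_snd ?_
    refine continuousOn_finset_sum _ fun a ha => ?_
    refine ContinuousOn.mul ?_ (ContinuousOn.sub ?_ continuousOn_const)
    · exact (Complex.continuous_ofReal.comp ((bump_cont ε a).comp continuous_snd)).continuousOn
    · exact (hξc a ha).comp continuousOn_fst fun p hp => hp.1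
  · intro l hl
    obtain ⟨h1, h2, h3⟩ := hΦ l hl
    refine ⟨h1, h2, h3, by simp only [hPN, add_zero], fun x => ⟨fun h => ?_, fun h => ?_⟩,
      (simple_iff_nodup (hne l)).mpr (himg l hl).2⟩
    · obtain ⟨a, ha, hax⟩ := hroot l hl _ h
      rw [← hPa l a ha] at hax
      have := congrArg (Φ l) hax
      rw [h3, h3] at this
      rw [← this]; exact (memA a).mp ha
    · have ha := (memA x).mpr h
      simp only [hPa l x ha]
      exact (hξ l hl x ha).1

end JC

namespace JC
open Set Polynomial Topology Filter

/-- Quotienting a finite branched map by a clopen equivalence relation gives a covering. -/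
theorem clopen_covering {Y B : Type*} [TopologicalSpace Y] [TopologicalSpace B] [T2Space B]
    (f : Y → B) (hfc : Continuous f) (hfo : IsOpenMap f) (hfcl : IsClosedMap f)
    (hfin : ∀ b, (f ⁻¹' {b}).Finite) (E : Setoid Y) (hEf : ∀ y y', E.r y y' → f y = f y')
    (hopen : ∀ y y', E.r y y' → ∀ᶠ p in 𝓝 (y, y'), f p.1 = f p.2 → E.r p.1 p.2)
    (hclosed : ∀ y y', f y = f y' → ¬ E.r y y' →
      ∀ᶠ p in 𝓝 (y, y'), f p.1 = f p.2 → ¬ E.r p.1 p.2) :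
    IsCoveringMap (Quotient.lift f hEf : Quotient E → B) := by
  set π : Y → Quotient E := Quotient.mk E
  set F : Quotient E → B := Quotient.lift f hEf
  have hF : ∀ y, F (π y) = f y := fun y => rfl
  have hπc : Continuous π := continuous_quotient_mk'
  have hFc : Continuous F := hfc.quotient_lift hEf
  have hEq : ∀ y y', π y = π y' ↔ E.r y y' := fun y y' => Quotient.eq
  have hπo : IsOpenMap π := by
    intro U hU
    rw [← isQuotientMap_quotient_mk'.isOpen_preimage, isOpen_iff_mem_nhds]
    rintro y' ⟨y, hy, hyy⟩
    have h1 := hopen y y' ((hEq _ _).mp hyy)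
    rw [nhds_prod_eq, eventually_prod_iff] at h1
    obtain ⟨pa, ha, pb, hb, hab⟩ := h1
    have h2 : f '' ({z | pa z} ∩ U) ∈ 𝓝 (f y) :=
      hfo.image_mem_nhds (inter_mem ha (hU.mem_nhds hy))
    rw [hEf y y' ((hEq _ _).mp hyy)] at h2
    filter_upwards [hb, hfc.continuousAt h2] with z hz hz2
    obtain ⟨w, ⟨hw1, hw2⟩, hw3⟩ := hz2
    exact ⟨w, hw2, (hEq _ _).mpr (hab hw1 hz hw3)⟩
  have hFo : IsOpenMap F := by
    intro U hU
    have : F '' U = f '' (π ⁻¹' U) := by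
      ext b; constructor
      · rintro ⟨q, hq, rfl⟩
        obtain ⟨y, rfl⟩ := Quotient.exists_rep q
        exact ⟨y, hq, rfl⟩
      · rintro ⟨y, hy, rfl⟩; exact ⟨π y, hy, rfl⟩
    rw [this]; exact hfo _ (hU.preimage hπc)
  have hFcl : IsClosedMap F := by
    intro U hU
    have : F '' U = f '' (π ⁻¹' U) := by
      ext b; constructor
      · rintro ⟨q, hq, rfl⟩
        obtain ⟨y, rfl⟩ := Quotient.exists_rep q
        exact ⟨y, hq, rfl⟩
      · rintro ⟨y, hy, rfl⟩; exact ⟨π y, hy, rfl⟩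
    rw [this]; exact hfcl _ (hU.preimage hπc)
  have hFfin : ∀ b, (F ⁻¹' {b}).Finite := by
    intro b
    refine ((hfin b).image π).subset ?_
    rintro q hq
    obtain ⟨y, rfl⟩ := Quotient.exists_rep q
    exact ⟨y, hq, rfl⟩
  haveI : T2Space (Quotient E) := by
    refine ⟨?_⟩
    intro q q' hqq
    obtain ⟨y, rfl⟩ := Quotient.exists_rep q
    obtain ⟨y', rfl⟩ := Quotient.exists_rep q'
    by_cases hf : f y = f y'
    · have h1 := hclosed y y' hf (fun h => hqq ((hEq _ _).mpr h))
      rw [nhds_prod_eq, eventually_prod_iff] at h1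
      obtain ⟨pa, ha, pb, hb, hab⟩ := h1
      obtain ⟨U, hU1, hU2, hU3⟩ := mem_nhds_iff.mp ha
      obtain ⟨V, hV1, hV2, hV3⟩ := mem_nhds_iff.mp hb
      refine ⟨π '' U, π '' V, hπo _ hU2, hπo _ hV2, ⟨y, hU3, rfl⟩, ⟨y', hV3, rfl⟩, ?_⟩
      rw [Set.disjoint_left]
      rintro _ ⟨z, hz, rfl⟩ ⟨z', hz', hzz⟩
      have hr := (hEq _ _).mp hzz.symm
      exact hab (hU1 hz) (hV1 hz') (hEf _ _ hr) hr
    · obtain ⟨U, V, hU, hV, h1, h2, h3⟩ := t2_separation hf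
      exact ⟨F ⁻¹' U, F ⁻¹' V, hU.preimage hFc, hV.preimage hFc, h1, h2, h3.preimage F⟩
  have hloc : IsLocalHomeomorph F := by
    refine IsLocalHomeomorph.mk F ?_
    intro q
    obtain ⟨y, rfl⟩ := Quotient.exists_rep q
    have h1 := hopen y y (E.refl y)
    rw [nhds_prod_eq, eventually_prod_iff] at h1
    obtain ⟨pa, ha, pb, hb, hab⟩ := h1
    obtain ⟨U, hU1, hU2, hU3⟩ := mem_nhds_iff.mp (inter_mem ha hb)
    have hinj : InjOn F (π '' U) := by
      rintro _ ⟨z, hz, rfl⟩ _ ⟨z', hz', rfl⟩ h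
      exact (hEq _ _).mpr (hab (hU1 hz).1 (hU1 hz').2 h)
    haveI : Nonempty (Quotient E) := ⟨π y⟩
    refine ⟨OpenPartialHomeomorph.ofContinuousOpen (hinj.toPartialEquiv F (π '' U))
      hFc.continuousOn hFo (hπo _ hU2), ⟨y, hU3, rfl⟩, fun _ _ => rfl⟩
  rw [isCoveringMap_iff_isCoveringMapOn_univ]
  exact hFcl.isCoveringMapOn_of_isLocalHomeomorphOn (fun b _ => hFfin b)
    (by simpa using hloc.isLocalHomeomorphOn)

/-- Lifting along a covering of paths whose projection factors through a convex set. -/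
theorem covering_loop {Q B : Type*} [TopologicalSpace Q] [TopologicalSpace B] {F : Q → B}
    (hF : IsCoveringMap F) {C : Set ℂ} (hC : Convex ℝ C) (e : C → B) (he : Continuous e)
    (τ : unitInterval → C) (hτ : Continuous τ) (h01 : τ 0 = τ 1)
    (η : unitInterval → Q) (hη : Continuous η) (hl : ∀ s, F (η s) = e (τ s)) : η 0 = η 1 := by
  haveI : ContractibleSpace C := hC.contractibleSpace ⟨_, (τ 0).2⟩
  haveI : LocallyPathConnectedSpace C := hC.locallyPathConnectedSpace
  obtain ⟨σ, ⟨h1, h2⟩, -⟩ := hF.existsUnique_continuousMap_lifts ⟨e, he⟩ (τ 0) (η 0) (hl 0)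
  have := hF.eq_of_comp_eq (g₁ := η) (g₂ := σ ∘ τ) hη (σ.continuous.comp hτ)
    (by
      funext s
      have := congrFun h2 (τ s)
      simp only [Function.comp_apply] at this ⊢
      rw [hl, this]; rfl) 0 (by simp [h1])
  rw [congrFun this 1, congrFun this 0]
  simp [h01]

end JC

namespace JC
open Set Polynomial Topology Filter

/-- complement of the affine curve `g x = f y` -/
def S2 (f g : ℂ[X]) : Set (ℂ × ℂ) := {p | g.eval p.1 ≠ f.eval p.2}

section star
variable {H : Type*} [Group H] {f g : ℂ[X]}

def Agree (h : Hol (S2 f g) H) (N z z' : ℂ) : Prop :=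
  ∀ γ : ℝ → ℂ, γ 0 = N → γ 1 = N → IsP {x | g.eval x ≠ f.eval z} γ →
    h.h (fun s => (γ s, z)) = h.h (fun s => (γ s, z'))

lemma Agree.symm {h : Hol (S2 f g) H} {N z z' : ℂ} (hz : f.eval z = f.eval z')
    (a : Agree h N z z') : Agree h N z' z := fun γ h0 h1 hγ =>
  (a γ h0 h1 (by rw [hz]; exact hγ)).symm

lemma Agree.trans {h : Hol (S2 f g) H} {N z z' z'' : ℂ} (hz : f.eval z = f.eval z')
    (a : Agree h N z z') (b : Agree h N z' z'') : Agree h N z z'' := fun γ h0 h1 hγ =>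
  (a γ h0 h1 hγ).trans (b γ h0 h1 (by rw [← hz]; exact hγ))

lemma agree_transport (hg : g.Monic) (hd : 0 < g.natDegree) (h : Hol (S2 f g) H) (N : ℂ) (T : ℝ)
    (hgN : T ≤ ‖g.eval N‖)
    (hN : ∀ ζ : ℝ → ℂ, IsP {y | ‖f.eval y‖ < T} ζ → h.h (fun s => (N, ζ s)) = 1)
    (t0 : ℂ) (ht0 : ‖t0‖ < T) (hs : Simple (g - C t0)) :
    ∃ U : Set ℂ, IsOpen U ∧ t0 ∈ U ∧ (∀ l ∈ U, Simple (g - C l)) ∧ ∃ Θ Φ : ℂ → ℂ → ℂ,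
      (∀ l ∈ U, Continuous (Φ l) ∧ Continuous (Θ l) ∧ (∀ x, Θ l (Φ l x) = x) ∧
        Θ l N = N ∧ Φ l N = N ∧ (∀ x, g.eval (Θ l x) = l ↔ g.eval x = t0) ∧
        (∀ x, g.eval (Φ l x) = t0 ↔ g.eval x = l)) ∧
      ∀ y, f.eval y = t0 → ∀ᶠ z in 𝓝 y, f.eval z ∈ U ∧
        ∀ γ : ℝ → ℂ, γ 0 = N → γ 1 = N → IsP {x | g.eval x ≠ t0} γ →
          h.h (fun s => (Θ (f.eval z) (γ s), z)) = h.h (fun s => (γ s, y)) := by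
  have hdc : ∀ t : ℂ, (C t).degree < g.degree := fun t =>
    lt_of_le_of_lt degree_C_le (natDegree_pos_iff_degree_pos.mp hd)
  obtain ⟨U, hU, hU0, Θ, Φ, hΘ, hl⟩ := local_iso (fun t : ℂ => g - C t) hd
    (fun t => hg.sub_of_left (hdc t))
    (fun t => by
      rw [sub_eq_add_neg, ← C_neg]; exact natDegree_add_C) (fun x => by
      simp only [eval_sub, eval_C]; fun_prop) t0 hs N (by
      simp only [eval_sub, eval_C]
      intro h0
      have : g.eval N = t0 := by linear_combination h0
      rw [this] at hgN; linarith)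
  have hΘl : ∀ l ∈ U, Continuous (Θ l) := fun l hl' => by
    have : ContinuousOn (fun x : ℂ => Θ l x) univ :=
      hΘ.comp (f := fun x : ℂ => (l, x)) (by fun_prop) (fun x _ => ⟨hl', mem_univ _⟩)
    exact continuousOn_univ.mp this
  have hz : ∀ l ∈ U, ∀ x, g.eval (Θ l x) = l ↔ g.eval x = t0 := fun l hl' x => by
    have := (hl l hl').2.2.2.2.1 x
    simpa [sub_eq_zero] using this
  refine ⟨U, hU, hU0, fun l hl' => (hl l hl').2.2.2.2.2, fun l x => Θ l (Φ t0 x),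
    fun l x => Θ t0 (Φ l x), fun l hl' => ⟨(hΘl t0 hU0).comp (hl l hl').1,
      (hΘl l hl').comp (hl t0 hU0).1, ?_, ?_, ?_, ?_, ?_⟩, ?_⟩
  · intro x; beta_reduce; rw [(hl t0 hU0).2.2.1, (hl l hl').2.1]
  · have : Φ t0 N = N := by
      conv_lhs => rw [← (hl t0 hU0).2.2.2.1, (hl t0 hU0).2.2.1]
    beta_reduce; rw [this, (hl l hl').2.2.2.1]
  · have : Φ l N = N := by
      conv_lhs => rw [← (hl l hl').2.2.2.1, (hl l hl').2.2.1]
    beta_reduce; rw [this, (hl t0 hU0).2.2.2.1]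
  · intro x
    rw [hz l hl', ← hz t0 hU0, (hl t0 hU0).2.1]
  · intro x
    rw [hz t0 hU0, ← hz l hl', (hl l hl').2.1]
  · intro y hy
    have hfc : Continuous fun z => f.eval z := f.continuous
    have hV : {z | f.eval z ∈ U ∧ ‖f.eval z‖ < T} ∈ 𝓝 y := by
      refine ((hU.preimage hfc).inter (isOpen_lt hfc.norm continuous_const)).mem_nhds ?_
      simp only [mem_inter_iff, mem_preimage, mem_setOf_eq, hy]; exact ⟨hU0, ht0⟩
    obtain ⟨ε, hε, hball⟩ := Metric.mem_nhds_iff.mp hV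
    filter_upwards [Metric.ball_mem_nhds y hε] with z hz'
    refine ⟨(hball hz').1, ?_⟩
    intro γ h0 h1 hγ
    have hseg : ∀ u ∈ Icc (0:ℝ) 1, y + (u:ℂ) * (z - y) ∈ Metric.ball y ε := by
      intro u hu
      rw [Metric.mem_ball, dist_eq_norm] at hz' ⊢
      rw [add_sub_cancel_left, norm_mul, Complex.norm_real, Real.norm_of_nonneg hu.1]
      nlinarith [hu.2, norm_nonneg (z - y), hu.1]
    have hPt : ∀ u ∈ Icc (0:ℝ) 1, f.eval (y + (u:ℂ) * (z - y)) ∈ U ∧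
      ‖f.eval (y + (u:ℂ) * (z - y))‖ < T := fun u hu => hball (hseg u hu)
    have key := h.sq (fun s u => (Θ (f.eval (y + (u:ℂ) * (z - y))) (Φ t0 (γ s)),
      y + (u:ℂ) * (z - y))) ⟨?_, ?_⟩
    · simp only [h0, h1] at key
      have hΦN : Φ t0 N = N := by
        conv_lhs => rw [← (hl t0 hU0).2.2.2.1, (hl t0 hU0).2.2.1]
      have hside : h.h (fun u : ℝ => (Θ (f.eval (y + (u:ℂ) * (z - y))) (Φ t0 N),
          y + (u:ℂ) * (z - y))) = 1 := by
        have hp : IsP {y | ‖f.eval y‖ < T} (fun u : ℝ => y + (u:ℂ) * (z - y)) :=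
          ⟨by fun_prop, fun u hu => (hPt u hu).2⟩
        rw [← hN _ hp]
        symm
        refine h.congr ⟨by fun_prop, ?_⟩ ?_
        · intro u hu
          simp only [S2, mem_setOf_eq]
          intro h0
          have := (hPt u hu).2
          rw [← h0] at this; linarith
        · intro u hu
          simp only [hΦN, (hl _ (hPt u hu).1).2.2.2.1]
      rw [hside, mul_one, one_mul] at key
      simp only [Complex.ofReal_zero, zero_mul, add_zero, hy, Complex.ofReal_one, one_mul,
        add_sub_cancel, (hl t0 hU0).2.1] at key
      exact key.symm
    · refine ContinuousOn.prodMk ?_ (by fun_prop)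
      refine hΘ.comp (f := fun p : ℝ × ℝ => (f.eval (y + (p.2:ℂ) * (z - y)), Φ t0 (γ p.1))) ?_ ?_
      · refine ContinuousOn.prodMk ?_ ?_
        · exact (hfc.comp (by fun_prop)).continuousOn
        · exact (hl t0 hU0).1.comp_continuousOn
            (hγ.cont.comp (by fun_prop) (fun p hp => hp.1))
      · intro p hp
        exact ⟨(hPt _ hp.2).1, mem_univ _⟩
    · intro s hs' u hu
      simp only [S2, mem_setOf_eq]
      intro hh
      have := (hz _ (hPt u hu).1 _).mp hh
      rw [← hz t0 hU0, (hl t0 hU0).2.1] at this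
      exact hγ.mem s hs' this

lemma agree_lc (hg : g.Monic) (hd : 0 < g.natDegree) (h : Hol (S2 f g) H) (N : ℂ) (T : ℝ)
    (hgN : T ≤ ‖g.eval N‖)
    (hN : ∀ ζ : ℝ → ℂ, IsP {y | ‖f.eval y‖ < T} ζ → h.h (fun s => (N, ζ s)) = 1)
    (y y' : ℂ) (hyy : f.eval y = f.eval y') (ht0 : ‖f.eval y‖ < T)
    (hs : Simple (g - C (f.eval y))) :
    ∀ᶠ p in 𝓝 (y, y'), f.eval p.1 = f.eval p.2 →
      Simple (g - C (f.eval p.1)) ∧ (Agree h N p.1 p.2 ↔ Agree h N y y') := by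
  obtain ⟨U, hU, hU0, hsim, Θ, Φ, hl, ht⟩ := agree_transport hg hd h N T hgN hN _ ht0 hs
  rw [nhds_prod_eq]
  filter_upwards [(ht y rfl).prod_mk (ht y' hyy.symm)] with ⟨z, z'⟩ ⟨⟨h1, h2⟩, ⟨h3, h4⟩⟩ hzz
  simp only at h1 h2 h3 h4 hzz
  refine ⟨hsim _ h1, ?_⟩
  obtain ⟨a1, a2, a3, a4, a5, a6, a7⟩ := hl _ h1
  constructor
  · intro hA γ g0 g1 hγ
    rw [← h2 γ g0 g1 hγ, ← h4 γ g0 g1 hγ, ← hzz]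
    refine hA _ (by simp only [g0, a4]) (by simp only [g1, a4]) ⟨a2.comp_continuousOn hγ.cont, ?_⟩
    intro s hs' h0
    exact hγ.mem s hs' ((a6 _).mp h0)
  · intro hA γ g0 g1 hγ
    have hP : IsP {x | g.eval x ≠ f.eval y} (fun s => Φ (f.eval z) (γ s)) :=
      ⟨a1.comp_continuousOn hγ.cont, fun s hs' h0 => hγ.mem s hs' ((a7 _).mp h0)⟩
    have e1 := h2 (fun s => Φ (f.eval z) (γ s)) (by simp only [g0, a5]) (by simp only [g1, a5]) hP
    have e2 := h4 (fun s => Φ (f.eval z) (γ s)) (by simp only [g0, a5]) (by simp only [g1, a5]) hP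
    rw [← hzz] at e2
    simp only [a3] at e1 e2
    rw [e1, e2]
    exact hA _ (by simp only [g0, a5]) (by simp only [g1, a5]) hP

end star
end JC

namespace JC
open Set Polynomial Topology Filter

lemma finite_nonsimple {g : ℂ[X]} (hd : 0 < g.natDegree) : {t : ℂ | ¬ Simple (g - C t)}.Finite := by
  have hne : derivative g ≠ 0 := fun h => by
    have := natDegree_eq_zero_of_derivative_eq_zero h; omega
  refine ((derivative g).roots.toFinset.finite_toSet.image (fun x => g.eval x)).subset ?_
  intro t ht
  simp only [Simple, mem_setOf_eq] at ht
  push Not at ht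
  obtain ⟨x, hx, hx'⟩ := ht
  refine ⟨x, ?_, ?_⟩
  · simp only [Finset.mem_coe, Multiset.mem_toFinset, mem_roots hne]
    simpa using hx'
  · simp at hx; linear_combination hx

lemma punctured_preconn (t0 : ℂ) {ε : ℝ} (hε : 0 < ε) :
    IsPreconnected {t : ℂ | ‖t - t0‖ < ε ∧ t ≠ t0} := by
  have : {t : ℂ | ‖t - t0‖ < ε ∧ t ≠ t0} =
      (fun τ => t0 + Complex.exp τ) '' {τ : ℂ | τ.re < Real.log ε} := by
    ext t; constructor
    · rintro ⟨h1, h2⟩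
      have hne : t - t0 ≠ 0 := sub_ne_zero.mpr h2
      refine ⟨Complex.log (t - t0), ?_, ?_⟩
      · simp only [mem_setOf_eq, Complex.log_re]
        exact Real.log_lt_log (norm_pos_iff.mpr hne) h1
      · simp [Complex.exp_log hne]
    · rintro ⟨τ, h1, rfl⟩
      simp only [mem_setOf_eq, add_sub_cancel_left, Complex.norm_exp, ne_eq, add_eq_left,
        Complex.exp_ne_zero, not_false_iff, and_true] at h1 ⊢
      rwa [← Real.lt_log_iff_exp_lt hε]
  rw [this]
  exact ((convex_halfSpace_re_lt _).isPreconnected).image _ (by fun_prop)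

lemma exists_local_homeo {f : ℂ[X]} {y : ℂ} (hy : f.derivative.eval y ≠ 0) :
    ∃ e : OpenPartialHomeomorph ℂ ℂ, y ∈ e.source ∧ ∀ x, e x = f.eval x := by
  have h1 : HasStrictFDerivAt (fun x => f.eval x)
      ((ContinuousLinearEquiv.unitsEquivAut ℂ (.mk0 _ hy) : ℂ ≃L[ℂ] ℂ) : ℂ →L[ℂ] ℂ) y :=
    f.hasStrictDerivAt y
  exact ⟨h1.toOpenPartialHomeomorph _, h1.mem_toOpenPartialHomeomorph_source, fun x => rfl⟩

lemma poly_open {f : ℂ[X]} (hd : 0 < f.natDegree) : IsOpenMap (fun x => f.eval x) := by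
  have ha : AnalyticOnNhd ℂ (fun x => f.eval x) univ := fun x _ =>
    (f.differentiable.analyticAt x)
  rcases ha.is_constant_or_isOpenMap with ⟨w, hw⟩ | h
  · exfalso
    have : f = C w := Polynomial.funext (fun x => by simpa using hw x)
    rw [this, natDegree_C] at hd; omega
  · exact h

section star
variable {H : Type*} [Group H] {f g : ℂ[X]}

lemma branch_lc (hg : g.Monic) (hd : 0 < g.natDegree) (h : Hol (S2 f g) H) (N : ℂ) (T : ℝ)
    (hgN : T ≤ ‖g.eval N‖)
    (hN : ∀ ζ : ℝ → ℂ, IsP {y | ‖f.eval y‖ < T} ζ → h.h (fun s => (N, ζ s)) = 1)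
    (y y' : ℂ) (hyy : f.eval y = f.eval y') (ht0 : ‖f.eval y‖ < T)
    (h1 : f.derivative.eval y ≠ 0) (h2 : f.derivative.eval y' ≠ 0) :
    ∃ W ∈ 𝓝 (y, y'),
      (∀ p ∈ W, f.eval p.1 = f.eval p.2 → f.eval p.1 = f.eval y → p = (y, y')) ∧
      (∀ p ∈ W, f.eval p.1 = f.eval p.2 → f.eval p.1 ≠ f.eval y →
        Simple (g - C (f.eval p.1))) ∧
      (∀ p ∈ W, ∀ p' ∈ W, f.eval p.1 = f.eval p.2 → f.eval p'.1 = f.eval p'.2 →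
        f.eval p.1 ≠ f.eval y → f.eval p'.1 ≠ f.eval y → Agree h N p.1 p.2 → Agree h N p'.1 p'.2)
       := by
  obtain ⟨e, he, hef⟩ := exists_local_homeo h1
  obtain ⟨e', he', hef'⟩ := exists_local_homeo h2
  set t0 := f.eval y with ht
  have hnb : ∀ᶠ t in 𝓝 t0, t ∈ e.target ∧ t ∈ e'.target ∧ ‖t‖ < T ∧ (t ≠ t0 → Simple (g - C t)) := by
    have n1 : ∀ᶠ t in 𝓝 t0, t ∈ e.target :=
      e.open_target.mem_nhds (by rw [ht, ← hef]; exact e.map_source he)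
    have n2 : ∀ᶠ t in 𝓝 t0, t ∈ e'.target :=
      e'.open_target.mem_nhds (by rw [hyy, ← hef']; exact e'.map_source he')
    have n3 : ∀ᶠ t in 𝓝 t0, ‖t‖ < T :=
      (isOpen_lt continuous_norm continuous_const).mem_nhds ht0
    refine n1.and (n2.and (n3.and ?_))
    have hfin := (finite_nonsimple hd).subset (diff_subset (s := {t : ℂ | ¬ Simple (g - C t)}) (t := {t0}))
    have := hfin.isClosed.isOpen_compl.mem_nhds (x := t0) (by simp)
    filter_upwards [this] with t htt hne
    by_contra hcon
    exact htt ⟨hcon, hne⟩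
  obtain ⟨ε, hε, hball⟩ := Metric.eventually_nhds_iff.mp hnb
  have hpre := punctured_preconn t0 hε
  have hP : ∀ t ∈ {t : ℂ | ‖t - t0‖ < ε ∧ t ≠ t0}, ∀ t' ∈ {t : ℂ | ‖t - t0‖ < ε ∧ t ≠ t0},
      (Agree h N (e.symm t) (e'.symm t) ↔ Agree h N (e.symm t') (e'.symm t')) := by
    intro t htt t' ht'
    refine hpre.induction₂ (fun t t' => (Agree h N (e.symm t) (e'.symm t) ↔
      Agree h N (e.symm t') (e'.symm t'))) ?_ ?_ ?_ htt ht'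
    · intro t ⟨k1, k2⟩
      obtain ⟨b1, b2, b3, b4⟩ := hball (y := t) (by rwa [dist_eq_norm])
      have c1 : f.eval (e.symm t) = t := by rw [← hef, e.right_inv b1]
      have c2 : f.eval (e'.symm t) = t := by rw [← hef', e'.right_inv b2]
      have := agree_lc hg hd h N T hgN hN (e.symm t) (e'.symm t) (c1.trans c2.symm)
        (by rwa [c1]) (by rw [c1]; exact b4 k2)
      have hcont : Tendsto (fun t => (e.symm t, e'.symm t)) (𝓝 t) (𝓝 (e.symm t, e'.symm t)) :=
        (e.symm.continuousAt b1).prodMk_nhds (e'.symm.continuousAt b2)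
      refine nhdsWithin_le_nhds ?_
      filter_upwards [hcont.eventually this, e.open_target.mem_nhds b1, e'.open_target.mem_nhds b2]
        with t' q1 q2 q3
      exact (q1 (by
        show f.eval (e.symm t') = f.eval (e'.symm t')
        rw [← hef, ← hef', e.right_inv q2, e'.right_inv q3])).2.symm
    · intro a b c _ _ _ h1 h2; exact h1.trans h2
    · intro a b _ _ h1; exact h1.symm
  refine ⟨{p | p.1 ∈ e.source ∧ p.2 ∈ e'.source ∧ ‖f.eval p.1 - t0‖ < ε}, ?_, ?_, ?_, ?_⟩
  · refine IsOpen.mem_nhds ?_ ⟨he, he', by simpa [← ht] using hε⟩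
    exact (e.open_source.preimage continuous_fst).inter
      ((e'.open_source.preimage continuous_snd).inter
        (isOpen_lt (((f.continuous.comp continuous_fst).sub continuous_const).norm)
          continuous_const))
  · rintro ⟨z, z'⟩ ⟨m1, m2, m3⟩ hz hzt
    have a1 : z = y := e.injOn m1 he (by rw [hef, hef]; exact hzt)
    have a2 : z' = y' := e'.injOn m2 he' (by rw [hef', hef', ← hyy, ← hzt]; exact hz.symm)
    rw [a1, a2]
  · rintro ⟨z, z'⟩ ⟨m1, m2, m3⟩ hz hzt
    exact (hball (by rwa [dist_eq_norm])).2.2.2 hzt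
  · rintro ⟨z, z'⟩ ⟨m1, m2, m3⟩ ⟨w, w'⟩ ⟨n1, n2, n3⟩ hz hw hzt hwt
    have := (hP (f.eval z) ⟨m3, hzt⟩ (f.eval w) ⟨n3, hwt⟩).mp
    simp only at hz hw
    have e1 : e.symm (f.eval z) = z := by rw [← hef, e.left_inv m1]
    have e2 : e'.symm (f.eval z) = z' := by rw [hz, ← hef', e'.left_inv m2]
    have e3 : e.symm (f.eval w) = w := by rw [← hef, e.left_inv n1]
    have e4 : e'.symm (f.eval w) = w' := by rw [hw, ← hef', e'.left_inv n2]
    rw [e1, e2, e3, e4] at this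
    exact this

theorem star (hfd : 0 < f.natDegree) (hg : g.Monic) (hd : 0 < g.natDegree)
    (h : Hol (S2 f g) H) (N : ℂ) (T : ℝ)
    (hgN : T ≤ ‖g.eval N‖)
    (hN : ∀ ζ : ℝ → ℂ, IsP {y | ‖f.eval y‖ < T} ζ → h.h (fun s => (N, ζ s)) = 1)
    (hcrit : ∀ x y, g.eval x = f.eval y → g.derivative.eval x = 0 → f.derivative.eval y = 0 →
      f.eval y = 0)
    (η τ : ℝ → ℂ) (hη : ContinuousOn η (Icc 0 1)) (hτ : ContinuousOn τ (Icc 0 1))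
    (hexp : ∀ s ∈ Icc (0:ℝ) 1, Complex.exp (τ s) = f.eval (η s))
    (hT : ∀ s ∈ Icc (0:ℝ) 1, ‖f.eval (η s)‖ < T) (h01 : τ 0 = τ 1)
    (hsimp : Simple (g - C (f.eval (η 0)))) : Agree h N (η 0) (η 1) := by
  have hTpos : 0 < T := lt_of_le_of_lt (norm_nonneg _) (hT 0 zero_mem_I)
  set B : Set ℂ := {t | t ≠ 0 ∧ ‖t‖ < T} with hB
  set fe : ℂ → ℂ := fun x => f.eval x with hfe
  have hfc : Continuous fe := f.continuous
  have hfo : IsOpenMap fe := poly_open hfd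
  set f' : fe ⁻¹' B → B := B.restrictPreimage fe with hf'
  have hval : ∀ y : fe ⁻¹' B, ((f' y : B) : ℂ) = f.eval (y : ℂ) := fun y => rfl
  have hfeq : ∀ y y' : fe ⁻¹' B, f' y = f' y' ↔ f.eval (y : ℂ) = f.eval (y' : ℂ) := fun y y' => by
    rw [Subtype.ext_iff]; rfl
  set R : ℂ → ℂ → Prop := fun y y' => f.eval y = f.eval y' ∧
    ∀ᶠ p in 𝓝 (y, y'), f.eval p.1 = f.eval p.2 → Simple (g - C (f.eval p.1)) →
      Agree h N p.1 p.2 with hR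
  have hRsymm : ∀ y y', R y y' → R y' y := by
    rintro y y' ⟨h1, h2⟩
    refine ⟨h1.symm, ?_⟩
    have := (continuous_swap.tendsto (y', y)).eventually h2
    filter_upwards [this] with p hp h3 h4
    exact (hp h3.symm (by simp only [Prod.fst_swap]; rw [← h3]; exact h4)).symm h3.symm
  have hRtrans : ∀ y y' y'', R y y' → R y' y'' → R y y'' := by
    rintro y y' y'' ⟨h1, h2⟩ ⟨h3, h4⟩
    refine ⟨h1.trans h3, ?_⟩
    rw [nhds_prod_eq, eventually_prod_iff] at h2 h4
    obtain ⟨pa, ha, pb, hb, hab⟩ := h2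
    obtain ⟨pa', ha', pb', hb', hab'⟩ := h4
    have h5 : fe '' {z | pb z ∧ pa' z} ∈ 𝓝 (fe y) := by
      rw [show fe y = fe y' from h1]; exact hfo.image_mem_nhds (inter_mem hb ha')
    rw [nhds_prod_eq]
    filter_upwards [(ha.and (hfc.continuousAt h5)).prod_mk hb'] with ⟨z, z''⟩ ⟨⟨k1, k2⟩, k3⟩ k4 k5
    obtain ⟨z', ⟨q1, q2⟩, q3⟩ := k2
    simp only at k1 k3 k4 k5
    have q3 : f.eval z' = f.eval z := q3
    exact (hab k1 q1 q3.symm k5).trans q3.symm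
      (hab' q2 k3 (q3.trans k4) (by simp only [q3]; exact k5))
  have hRself : ∀ y y', R y y' → Simple (g - C (f.eval y)) → Agree h N y y' := by
    rintro y y' ⟨h1, h2⟩ h3
    exact h2.self_of_nhds h1 h3
  have hder0 : ∀ y : ℂ, f.eval y ≠ 0 → ¬ Simple (g - C (f.eval y)) →
      ∀ z : ℂ, f.eval z = f.eval (y : ℂ) → f.derivative.eval z ≠ 0 := by
    intro y hy0 hsim z hz hz'
    simp only [Simple] at hsim
    push Not at hsim
    obtain ⟨x, hx, hx'⟩ := hsim
    simp at hx hx'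
    exact hy0 (by
      have := hcrit x z (by rw [hz]; linear_combination hx) hx' hz'
      rw [hz] at this; exact this)
  have hRrefl : ∀ y : ℂ, fe y ∈ B → R y y := by
    intro y hy
    refine ⟨rfl, ?_⟩
    by_cases hsim : Simple (g - C (f.eval (y : ℂ)))
    · filter_upwards [agree_lc hg hd h N T hgN hN y y rfl hy.2 hsim] with p hp h1 h2
      exact (hp h1).2.mpr (fun γ _ _ _ => rfl)
    · obtain ⟨e, he, hef⟩ := exists_local_homeo (hder0 y hy.1 hsim y rfl)
      filter_upwards [prod_mem_nhds (e.open_source.mem_nhds he) (e.open_source.mem_nhds he)]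
        with p hp h1 h2
      have : p.1 = p.2 := e.injOn hp.1 hp.2 (by rw [hef, hef, h1])
      rw [this]; exact (fun γ _ _ _ => rfl)
  let E : Setoid (fe ⁻¹' B) :=
    { r := fun y y' => R y y'
      iseqv := ⟨fun y => hRrefl y y.2, fun {a b} => hRsymm _ _, fun {a b c} => hRtrans _ _ _⟩ }
  have hEf : ∀ y y', E.r y y' → f' y = f' y' := fun y y' hr => (hfeq y y').mpr hr.1
  have hcont2 : Continuous (fun p : (fe ⁻¹' B) × (fe ⁻¹' B) => ((p.1 : ℂ), (p.2 : ℂ))) := by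
    fun_prop
  have hcov := clopen_covering f' (hfc.restrictPreimage) (hfo.restrictPreimage B)
    ((f.isProperMap_eval (natDegree_pos_iff_degree_pos.mp hfd)).isClosedMap.restrictPreimage B)
    (by
      intro b
      have hne : f - C (b : ℂ) ≠ 0 := fun h0 => by
        rw [sub_eq_zero] at h0; rw [h0, natDegree_C] at hfd; omega
      refine Finite.of_finite_image (f := Subtype.val) ?_ Subtype.val_injective.injOn
      refine ((f - C (b : ℂ)).roots.toFinset.finite_toSet).subset ?_
      rintro _ ⟨y, hy, rfl⟩
      have : f.eval (y : ℂ) = b := by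
        have : f' y = b := hy
        rw [← this]; rfl
      simp [hne, this]) E hEf
    (by
      rintro y y' ⟨h1, h2⟩
      have := (hcont2.tendsto (y, y')).eventually (eventually_eventually_nhds.mpr h2)
      filter_upwards [this] with p hp hpf
      exact ⟨(hfeq _ _).mp hpf, hp⟩)
    (by
      intro y y' hyy hnot
      have hyy := (hfeq _ _).mp hyy
      have hyB : fe y ∈ B := y.2
      suffices hs : ∀ᶠ p in 𝓝 ((y : ℂ), (y' : ℂ)), f.eval p.1 = f.eval p.2 → ¬ R p.1 p.2 by
        have := (hcont2.tendsto (y, y')).eventually hs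
        filter_upwards [this] with p hp hpf
        exact hp ((hfeq _ _).mp hpf)
      by_cases hsim : Simple (g - C (f.eval (y : ℂ)))
      · have hlc := agree_lc hg hd h N T hgN hN y y' hyy hyB.2 hsim
        have hA : ¬ Agree h N y y' := by
          intro hA
          refine hnot ⟨hyy, ?_⟩
          filter_upwards [hlc] with p hp h1 h2
          exact (hp h1).2.mpr hA
        filter_upwards [hlc] with p hp h1 h2
        exact hA ((hp h1).2.mp (hRself _ _ h2 (hp h1).1))
      · have hder := hder0 y hyB.1 hsim
        obtain ⟨W, hW, w1, w2, w3⟩ := branch_lc hg hd h N T hgN hN y y' hyy hyB.2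
          (hder y rfl) (hder y' hyy.symm)
        filter_upwards [hW] with p hp hpf hpR
        by_cases hpt : f.eval p.1 = f.eval (y : ℂ)
        · have := w1 p hp hpf hpt
          rw [this] at hpR
          exact hnot hpR
        · have hA := hRself _ _ hpR (w2 p hp hpf hpt)
          refine hnot ⟨hyy, ?_⟩
          filter_upwards [hW] with p' hp' hpf' hs'
          by_cases hpt' : f.eval p'.1 = f.eval (y : ℂ)
          · rw [hpt'] at hs'; exact absurd hs' hsim
          · exact w3 p hp p' hp' hpf hpf' hpt hpt' hA)
  have hmem : ∀ s : unitInterval, fe (η s) ∈ B := fun s => by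
    refine ⟨?_, hT s s.2⟩
    show f.eval (η s) ≠ 0
    rw [← hexp s s.2]; exact Complex.exp_ne_zero _
  have hCc : Convex ℝ {z : ℂ | z.re < Real.log T} := convex_halfSpace_re_lt _
  have hτm : ∀ s : unitInterval, (τ s).re < Real.log T := fun s => by
    rw [Real.lt_log_iff_exp_lt hTpos, ← Complex.norm_exp, hexp s s.2]; exact hT s s.2
  have hfinal := covering_loop hcov hCc
    (fun z => (⟨Complex.exp z, Complex.exp_ne_zero _, by
      rw [Complex.norm_exp, ← Real.lt_log_iff_exp_lt hTpos]; exact z.2⟩ : B)) (by fun_prop)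
    (fun s => ⟨τ s, hτm s⟩) (by
      refine Continuous.subtype_mk ?_ _
      exact (continuousOn_iff_continuous_restrict.mp hτ)) (by simpa using h01)
    (fun s => (Quotient.mk E ⟨η s, hmem s⟩))
    (by
      refine continuous_quotient_mk'.comp ?_
      refine Continuous.subtype_mk ?_ _
      exact (continuousOn_iff_continuous_restrict.mp hη))
    (by
      intro s
      apply Subtype.ext
      exact (hexp s s.2).symm)
  have hr : R (η (0 : unitInterval)) (η (1 : unitInterval)) := Quotient.exact hfinal
  have hr' : R (η 0) (η 1) := hr
  exact hRself _ _ hr' hsimp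

end star
end JC

namespace JC
open Set Topology Filter

/-- The data of a join type curve. -/
structure Dat where
  r : ℕ
  s : ℕ
  d : ℕ
  hd : 0 < d
  α : Fin r → ℂ
  β : Fin s → ℂ
  hα : Function.Injective α
  hβ : Function.Injective β
  e : Fin r → ℕ
  μ : Fin s → ℕ
  he : ∀ i, 0 < e i
  hμ : ∀ j, 0 < μ j
  hdg : ∑ i, e i = d
  hdf : ∑ j, μ j = d

/-- `∏ (x - αᵢ w) ^ eᵢ` -/
def gp {r : ℕ} (α : Fin r → ℂ) (e : Fin r → ℕ) (x w : ℂ) : ℂ := ∏ i, (x - α i * w) ^ e i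

/-- the same as a polynomial in `x` -/
noncomputable def GP {r : ℕ} (α : Fin r → ℂ) (e : Fin r → ℕ) (w : ℂ) : Polynomial ℂ :=
  ∏ i, (Polynomial.X - Polynomial.C (α i * w)) ^ e i

section gp
variable {r : ℕ} (α : Fin r → ℂ) (e : Fin r → ℕ)

@[simp] lemma GP_eval (w x : ℂ) : (GP α e w).eval x = gp α e x w := by
  simp [GP, gp, Polynomial.eval_prod]

lemma GP_monic (w : ℂ) : (GP α e w).Monic :=
  Polynomial.monic_prod_of_monic _ _ fun i _ => (Polynomial.monic_X_sub_C _).pow _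

lemma GP_natDegree (w : ℂ) : (GP α e w).natDegree = ∑ i, e i := by
  rw [GP, Polynomial.natDegree_prod_of_monic _ _ fun i _ => (Polynomial.monic_X_sub_C _).pow _]
  refine Finset.sum_congr rfl fun i _ => ?_
  rw [Polynomial.natDegree_pow, Polynomial.natDegree_X_sub_C, mul_one]

lemma gp_zero (x : ℂ) : gp α e x 0 = x ^ (∑ i, e i) := by
  simp [gp, Finset.prod_pow_eq_pow_sum]

lemma gp_cont : Continuous fun p : ℂ × ℂ => gp α e p.1 p.2 := by
  unfold gp; fun_prop

lemma gp_smul (t x w : ℂ) : gp α e (t * x) (t * w) = t ^ (∑ i, e i) * gp α e x w := by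
  unfold gp
  rw [← Finset.prod_pow_eq_pow_sum, ← Finset.prod_mul_distrib]
  refine Finset.prod_congr rfl fun i _ => ?_
  rw [← mul_pow]; ring

lemma gp_upper {A : ℝ} (hA : ∀ i, ‖α i‖ ≤ A) (x w : ℂ) :
    ‖gp α e x w‖ ≤ (‖x‖ + A * ‖w‖) ^ (∑ i, e i) := by
  unfold gp
  rw [norm_prod, ← Finset.prod_pow_eq_pow_sum]
  refine Finset.prod_le_prod (fun i _ => norm_nonneg _) fun i _ => ?_
  rw [norm_pow]
  refine pow_le_pow_left₀ (norm_nonneg _) ?_ _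
  refine (norm_sub_le _ _).trans ?_
  rw [norm_mul]
  have := mul_le_mul_of_nonneg_right (hA i) (norm_nonneg w)
  linarith

lemma gp_lower {A : ℝ} (hA : ∀ i, ‖α i‖ ≤ A) (x w : ℂ) (h : 0 ≤ ‖x‖ - A * ‖w‖) :
    (‖x‖ - A * ‖w‖) ^ (∑ i, e i) ≤ ‖gp α e x w‖ := by
  unfold gp
  rw [norm_prod, ← Finset.prod_pow_eq_pow_sum]
  refine Finset.prod_le_prod (fun i _ => by positivity) fun i _ => ?_
  rw [norm_pow]
  refine pow_le_pow_left₀ h ?_ _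
  refine le_trans ?_ (norm_sub_norm_le _ _)
  rw [norm_mul]
  have := mul_le_mul_of_nonneg_right (hA i) (norm_nonneg w)
  linarith
end gp

namespace Dat
variable (D : Dat)

def swap : Dat := ⟨D.s, D.r, D.d, D.hd, D.β, D.α, D.hβ, D.hα, D.μ, D.e, D.hμ, D.he, D.hdf, D.hdg⟩

/-- singularity hypothesis away from the line at infinity -/
def Crit : Prop := ∀ x y w : ℂ, w ≠ 0 → gp D.α D.e x w = gp D.β D.μ y w →
  (GP D.α D.e w).derivative.eval x = 0 → (GP D.β D.μ w).derivative.eval y = 0 →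
  gp D.α D.e x w = 0

lemma Crit.swap {D : Dat} (h : D.Crit) : D.swap.Crit := fun x y w hw h1 h2 h3 => by
  have := h y x w hw h1.symm h3 h2
  exact h1.trans this

/-- complement of the cone over the curve -/
def S : Set (ℂ × ℂ × ℂ) := {z | gp D.α D.e z.1 z.2.2 ≠ gp D.β D.μ z.2.1 z.2.2}

lemma S_open : IsOpen D.S := by
  have h1 : Continuous fun z : ℂ × ℂ × ℂ => gp D.α D.e z.1 z.2.2 :=
    (gp_cont D.α D.e).comp (f := fun z : ℂ × ℂ × ℂ => (z.1, z.2.2)) (by fun_prop)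
  have h2 : Continuous fun z : ℂ × ℂ × ℂ => gp D.β D.μ z.2.1 z.2.2 :=
    (gp_cont D.β D.μ).comp (f := fun z : ℂ × ℂ × ℂ => (z.2.1, z.2.2)) (by fun_prop)
  exact isOpen_ne_fun h1 h2

noncomputable def A : ℝ := ∑ i, ‖D.α i‖ + ∑ j, ‖D.β j‖

lemma A_nonneg : 0 ≤ D.A := by unfold A; positivity

lemma hAα (i) : ‖D.α i‖ ≤ D.A := by
  have h1 := Finset.single_le_sum (f := fun i => ‖D.α i‖) (fun i _ => norm_nonneg _)
    (Finset.mem_univ i)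
  have h2 : 0 ≤ ∑ j, ‖D.β j‖ := by positivity
  unfold A; linarith

lemma hAβ (i) : ‖D.β i‖ ≤ D.A := by
  have h1 := Finset.single_le_sum (f := fun i => ‖D.β i‖) (fun i _ => norm_nonneg _)
    (Finset.mem_univ i)
  have h2 : 0 ≤ ∑ j, ‖D.α j‖ := by positivity
  unfold A; linarith

lemma gp_lt {x y w : ℂ} (h : ‖y‖ + 2 * D.A * ‖w‖ < ‖x‖) :
    ‖gp D.β D.μ y w‖ < ‖gp D.α D.e x w‖ := by
  have hA := D.A_nonneg
  have hw : 0 ≤ D.A * ‖w‖ := by positivity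
  have h0 : 0 ≤ ‖y‖ := norm_nonneg y
  refine lt_of_le_of_lt (gp_upper D.β D.μ D.hAβ y w)
    (lt_of_lt_of_le ?_ (gp_lower D.α D.e D.hAα x w (by linarith)))
  rw [D.hdg, D.hdf]
  exact pow_lt_pow_left₀ (by linarith) (by positivity) D.hd.ne'

lemma mem_S_of_big {x y w : ℂ} (h : ‖y‖ + 2 * D.A * ‖w‖ < ‖x‖) : (x, y, w) ∈ D.S := by
  intro h0
  have := D.gp_lt h
  simp only at h0
  rw [h0] at this; exact lt_irrefl _ this

lemma mem_S_inf {x y : ℂ} : (x, y, (0 : ℂ)) ∈ D.S ↔ x ^ D.d ≠ y ^ D.d := by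
  simp only [S, mem_setOf_eq, gp_zero, D.hdg, D.hdf]

noncomputable def c : ℝ := 1 + 2 * D.A

lemma c_ge : 1 ≤ D.c := by have := D.A_nonneg; unfold c; linarith

/-- A convex region in which `x` dominates. -/
def Om : Set (ℂ × ℂ × ℂ) := {z | D.c * (‖z.2.1‖ + ‖z.2.2‖) < z.1.re}

lemma Om_sub : D.Om ⊆ D.S := by
  rintro ⟨x, y, w⟩ h
  refine D.mem_S_of_big ?_
  simp only [Om, mem_setOf_eq] at h
  have h1 := Complex.re_le_norm x
  have := D.A_nonneg
  unfold c at h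
  nlinarith [norm_nonneg y, norm_nonneg w, mul_nonneg this (norm_nonneg y)]

lemma Om_convex : Convex ℝ D.Om := by
  rintro ⟨x, y, w⟩ h ⟨x', y', w'⟩ h' a b ha hb hab
  simp only [Om, mem_setOf_eq, Prod.smul_mk, Prod.mk_add_mk] at h h' ⊢
  have h1 : ‖a • y + b • y'‖ ≤ a * ‖y‖ + b * ‖y'‖ := (norm_add_le _ _).trans (by
    rw [norm_smul, norm_smul, Real.norm_of_nonneg ha, Real.norm_of_nonneg hb])
  have h2 : ‖a • w + b • w'‖ ≤ a * ‖w‖ + b * ‖w'‖ := (norm_add_le _ _).trans (by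
    rw [norm_smul, norm_smul, Real.norm_of_nonneg ha, Real.norm_of_nonneg hb])
  have h3 : (a • x + b • x').re = a * x.re + b * x'.re := by simp
  rw [h3]
  have hc : 0 < D.c := lt_of_lt_of_le one_pos D.c_ge
  calc D.c * (‖a • y + b • y'‖ + ‖a • w + b • w'‖)
      ≤ D.c * ((a * ‖y‖ + b * ‖y'‖) + (a * ‖w‖ + b * ‖w'‖)) := by gcongr
    _ = a * (D.c * (‖y‖ + ‖w‖)) + b * (D.c * (‖y'‖ + ‖w'‖)) := by ring
    _ < a * x.re + b * x'.re := by
        rcases ha.eq_or_lt with h0 | h0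
        · have : b = 1 := by linarith
          subst this; rw [← h0]; linarith
        · nlinarith

lemma star_mem_Om : ((1 : ℂ), (0 : ℂ), (0 : ℂ)) ∈ D.Om := by simp [Om]

/-- The standard path from `(1,0,0)` to `(0,1,0)` with phase `θ`. -/
noncomputable def P (θ : ℝ) (a : ℝ) : ℂ × ℂ × ℂ :=
  (((1 - a : ℝ) : ℂ) * Complex.exp (((-θ * a : ℝ) : ℂ) * Complex.I),
    (a : ℂ) * Complex.exp (((θ * (1 - a) : ℝ) : ℂ) * Complex.I), 0)

noncomputable def th (j : ℤ) : ℝ := (2 * j + 1) * Real.pi / D.d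

end Dat

lemma polar_ne {d : ℕ} (hd : 0 < d) {ρ₁ ρ₂ φ₁ φ₂ : ℝ} (h1 : 0 ≤ ρ₁) (h2 : 0 ≤ ρ₂)
    (h : ρ₁ ≠ ρ₂ ∨ (0 < ρ₂ ∧ Complex.exp ((d * (φ₂ - φ₁) : ℝ) * Complex.I) ≠ 1)) :
    ((ρ₁ : ℂ) * Complex.exp ((φ₁ : ℂ) * Complex.I)) ^ d ≠
      ((ρ₂ : ℂ) * Complex.exp ((φ₂ : ℂ) * Complex.I)) ^ d := by
  intro he
  have hn := congrArg norm he
  rw [norm_pow, norm_pow, norm_mul, norm_mul, Complex.norm_exp_ofReal_mul_I,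
    Complex.norm_exp_ofReal_mul_I, mul_one, mul_one, Complex.norm_real, Complex.norm_real,
    Real.norm_of_nonneg h1, Real.norm_of_nonneg h2] at hn
  have hr : ρ₁ = ρ₂ := (pow_left_inj₀ h1 h2 hd.ne').mp hn
  rcases h with h | ⟨h, h'⟩
  · exact h hr
  · apply h'
    rw [hr, mul_pow, mul_pow] at he
    have hne : ((ρ₂ : ℂ)) ^ d ≠ 0 := pow_ne_zero _ (by exact_mod_cast h.ne')
    have h3 := mul_left_cancel₀ hne he
    rw [← Complex.exp_nat_mul, ← Complex.exp_nat_mul] at h3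
    have : ((d * (φ₂ - φ₁) : ℝ) : ℂ) * Complex.I = d * (φ₂ * Complex.I) - d * (φ₁ * Complex.I) := by
      push_cast; ring
    rw [this, Complex.exp_sub, ← h3, div_self (Complex.exp_ne_zero _)]

namespace Dat
variable (D : Dat)

lemma th_good (j : ℤ) : Complex.exp ((D.d * D.th j : ℝ) * Complex.I) ≠ 1 := by
  have hd : (D.d : ℝ) ≠ 0 := by exact_mod_cast D.hd.ne'
  have : (D.d * D.th j : ℝ) = (2 * j + 1) * Real.pi := by unfold th; field_simp
  rw [this]
  have h2 : (((2 * j + 1) * Real.pi : ℝ) : ℂ) * Complex.I =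
      Real.pi * Complex.I + j * (2 * Real.pi * Complex.I) := by push_cast; ring
  rw [h2, Complex.exp_add, Complex.exp_int_mul_two_pi_mul_I, Complex.exp_pi_mul_I]
  norm_num

lemma P_isP {θ : ℝ} (h : Complex.exp ((D.d * θ : ℝ) * Complex.I) ≠ 1) : IsP D.S (P θ) := by
  refine ⟨by unfold P; fun_prop, ?_⟩
  intro a ha
  refine D.mem_S_inf.mpr ?_
  refine polar_ne D.hd (by linarith [ha.2]) ha.1 ?_
  by_cases hh : a = 1 / 2
  · right; subst hh; constructor
    · norm_num
    · convert h using 4; ring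
  · left; intro h0; apply hh; linarith

/-- fibre path at infinity -/
noncomputable def Qx (N : ℝ) (θ : ℝ) (s : ℝ) : ℂ :=
  ((N * min 1 (4 / 3 * (1 - s)) : ℝ) : ℂ) *
    Complex.exp (((-θ * min 1 (4 * s) : ℝ) : ℂ) * Complex.I)

lemma Qx_cont (N θ : ℝ) : Continuous (Qx N θ) := by unfold Qx; fun_prop
lemma Qx_zero (N θ : ℝ) : Qx N θ 0 = N := by
  simp [Qx, min_eq_left (by norm_num : (1:ℝ) ≤ 4 / 3)]
lemma Qx_one (N θ : ℝ) : Qx N θ 1 = 0 := by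
  simp [Qx]

/-- unit-circle point -/
noncomputable def cis (η : ℝ) : ℂ := Complex.exp ((η : ℂ) * Complex.I)

lemma HQ {H : Type*} [Group H] (h : Hol D.S H) (hOm : ∀ γ, IsP D.Om γ → h.h γ = 1)
    {N : ℝ} (hN : D.c < N) (θ' η : ℝ)
    (hθ : Complex.exp ((D.d * (θ' + η) : ℝ) * Complex.I) ≠ 1) :
    h.h (P (θ' + η)) * h.h (fun u => (0, cis (u * η), 0)) =
      h.h (fun s => (Qx N θ' s, cis η, 0)) := by
  have hN1 : 1 < N := lt_of_le_of_lt D.c_ge hN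
  set θ := θ' + η with hθd
  have key := h.sq (fun s u =>
    ((((1 - u) * (1 - s) + u * (N * min 1 (4 / 3 * (1 - s))) : ℝ) : ℂ) *
      Complex.exp ((((1 - u) * (-θ * s) + u * (-θ' * min 1 (4 * s)) : ℝ) : ℂ) * Complex.I),
     (((1 - u) * s + u : ℝ) : ℂ) *
      Complex.exp ((((1 - u) * (θ * (1 - s)) + u * η : ℝ) : ℂ) * Complex.I), 0)) ?_
  · have hside : h.h (fun u : ℝ =>
      ((((1 - u) * (1 - 0) + u * (N * min 1 (4 / 3 * (1 - 0))) : ℝ) : ℂ) *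
      Complex.exp ((((1 - u) * (-θ * 0) + u * (-θ' * min 1 (4 * 0)) : ℝ) : ℂ) * Complex.I),
     (((1 - u) * 0 + u : ℝ) : ℂ) *
      Complex.exp ((((1 - u) * (θ * (1 - 0)) + u * η : ℝ) : ℂ) * Complex.I), (0:ℂ))) = 1 := by
      refine hOm _ ⟨by fun_prop, ?_⟩
      intro u hu
      have e1 : (1 - u) * (-θ * 0) + u * (-θ' * min 1 (4 * 0)) = 0 := by
        rw [min_eq_right (by norm_num : (4:ℝ) * 0 ≤ 1)]; ring
      have e2 : (1 - u) * (1 - 0) + u * (N * min 1 (4 / 3 * (1 - 0))) = 1 - u + u * N := by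
        rw [min_eq_left (by norm_num : (1:ℝ) ≤ 4 / 3 * (1 - 0))]; ring
      simp only [Om, mem_setOf_eq, e1, e2, norm_mul, Complex.norm_exp_ofReal_mul_I, norm_zero,
        add_zero, mul_one, Complex.norm_real, Complex.ofReal_zero, zero_mul, Complex.exp_zero,
        Complex.ofReal_re]
      rw [mul_zero, zero_add, Real.norm_of_nonneg hu.1]
      rcases hu.1.eq_or_lt with h0 | h0
      · rw [← h0]; norm_num
      · nlinarith [hu.2]
    rw [hside, one_mul] at key
    convert key using 2
    · congr 1; funext a; simp [P]
    · congr 1; funext u; simp [cis]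
    · congr 1; funext a; simp [Qx, cis]
  · refine IsSq.mk' (by fun_prop) ?_
    intro s hs u hu
    refine D.mem_S_inf.mpr ?_
    have hm0 : 0 ≤ min 1 (4 / 3 * (1 - s)) := le_min zero_le_one (by linarith [hs.2])
    have hρ1 : 0 ≤ (1 - u) * (1 - s) + u * (N * min 1 (4 / 3 * (1 - s))) := by
      have : 0 ≤ N * min 1 (4 / 3 * (1 - s)) := mul_nonneg (by linarith) hm0
      have := mul_nonneg hu.1 this
      nlinarith [hs.2, hu.2, mul_nonneg (sub_nonneg.mpr hu.2) (sub_nonneg.mpr hs.2)]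
    have hρ2 : 0 ≤ (1 - u) * s + u := by
      nlinarith [hu.1, mul_nonneg (sub_nonneg.mpr hu.2) hs.1]
    refine polar_ne D.hd hρ1 hρ2 ?_
    rcases le_total s (1/4) with h4 | h4
    · left
      rw [min_eq_left (by linarith : (1:ℝ) ≤ 4 / 3 * (1 - s))]
      apply ne_of_gt
      rcases hu.1.eq_or_lt with h0 | h0
      · rw [← h0]; linarith
      · nlinarith [hu.2, mul_nonneg (sub_nonneg.mpr hu.2) (by linarith : 0 ≤ 1 - 2 * s)]
    · right
      constructor
      · rcases hu.1.eq_or_lt with h0 | h0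
        · rw [← h0]; linarith
        · nlinarith [mul_nonneg (sub_nonneg.mpr hu.2) hs.1]
      · rw [min_eq_left (by linarith : (1:ℝ) ≤ 4 * s)]
        convert hθ using 4
        rw [hθd]; ring

end Dat
end JC

namespace JC
open Set Topology Filter

/-- There is a path from `y` to `y'` along which a logarithm of `f` changes by `c`. -/
def Ac (f : ℂ → ℂ) (y y' c : ℂ) : Prop := ∃ η τ : ℝ → ℂ, ContinuousOn η (Icc 0 1) ∧
  ContinuousOn τ (Icc 0 1) ∧ (∀ s ∈ Icc (0:ℝ) 1, Complex.exp (τ s) = f (η s)) ∧ η 0 = y ∧ η 1 = y' ∧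
  τ 1 - τ 0 = c

lemma Ac.refl {f : ℂ → ℂ} {y : ℂ} (h : f y ≠ 0) : Ac f y y 0 :=
  ⟨fun _ => y, fun _ => Complex.log (f y), continuousOn_const, continuousOn_const,
    fun s _ => Complex.exp_log h, rfl, rfl, sub_self _⟩

lemma maps_rev : MapsTo (fun s : ℝ => 1 - s) (Icc 0 1) (Icc 0 1) := fun s hs =>
  ⟨by linarith [hs.2], by linarith [hs.1]⟩

lemma Ac.symm {f : ℂ → ℂ} {y y' c : ℂ} (h : Ac f y y' c) : Ac f y' y (-c) := by
  obtain ⟨η, τ, h1, h2, h3, h4, h5, h6⟩ := h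
  refine ⟨fun s => η (1 - s), fun s => τ (1 - s), h1.comp (by fun_prop) maps_rev,
    h2.comp (by fun_prop) maps_rev, fun s hs => h3 _ (maps_rev hs), by simpa using h5,
    by simpa using h4, ?_⟩
  rw [← h6]; norm_num

lemma Ac.trans {f : ℂ → ℂ} {y y' y'' c c' : ℂ} (h : Ac f y y' c) (h' : Ac f y' y'' c') :
    Ac f y y'' (c + c') := by
  obtain ⟨η, τ, h1, h2, h3, h4, h5, h6⟩ := h
  obtain ⟨η', τ', h1', h2', h3', h4', h5', h6'⟩ := h'
  have hP : IsP (univ : Set ℂ) η := ⟨h1, fun _ _ => trivial⟩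
  have hP' : IsP (univ : Set ℂ) η' := ⟨h1', fun _ _ => trivial⟩
  have hQ : IsP (univ : Set ℂ) τ := ⟨h2, fun _ _ => trivial⟩
  have hQ' : IsP (univ : Set ℂ) (fun s => τ' s + (τ 1 - τ' 0)) :=
    ⟨h2'.add continuousOn_const, fun _ _ => trivial⟩
  have hk : Complex.exp (τ 1 - τ' 0) = 1 := by
    rw [Complex.exp_sub, h3 1 one_mem_I, h3' 0 zero_mem_I, h5, h4', div_self]
    rw [← h4', ← h3' 0 zero_mem_I]; exact Complex.exp_ne_zero _
  refine ⟨jn η η', jn τ (fun s => τ' s + (τ 1 - τ' 0)), (hP.jn hP' (by rw [h5, h4'])).cont,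
    (hQ.jn hQ' (by simp)).cont, ?_, by rw [jn_zero, h4], by rw [jn_one, h5'], ?_⟩
  · intro s hs
    unfold jn
    split_ifs with h
    · exact h3 _ ⟨by linarith [hs.1], by linarith⟩
    · rw [Complex.exp_add, hk, mul_one]
      push Not at h
      exact h3' _ ⟨by linarith, by linarith [hs.2]⟩
  · rw [jn_zero, jn_one, ← h6, ← h6']; ring

lemma Ac.pow {f v : ℂ → ℂ} {m : ℕ} (hf : ∀ y, f y = v y ^ m) {y y' c : ℂ} (h : Ac v y y' c) :
    Ac f y y' (m * c) := by
  obtain ⟨η, τ, h1, h2, h3, h4, h5, h6⟩ := h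
  refine ⟨η, fun s => m * τ s, h1, continuousOn_const.mul h2, fun s hs => ?_, h4, h5, ?_⟩
  · rw [Complex.exp_nat_mul, h3 s hs, hf]
  · rw [← h6]; ring

lemma exists_Ac {f : ℂ → ℂ} (hf : Continuous f) {y y' : ℂ} (hj : JoinedIn {x | f x ≠ 0} y y') :
    ∃ c, Ac f y y' c := by
  obtain ⟨γ, hγ⟩ := hj
  let g : C(unitInterval, {z : ℂ // z ≠ 0}) := ⟨fun t => ⟨f (γ t), hγ t⟩, by fun_prop⟩
  have cov := Complex.isCoveringMap_exp
  obtain ⟨Γ, hΓ⟩ := cov.exists_path_lifts g (Complex.log (f (γ 0)))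
    (by apply Subtype.ext; simp only [g]; exact (Complex.exp_log (hγ 0)).symm)
  have hΓ1 : ∀ t, Complex.exp (Γ t) = f (γ t) := fun t => by
    have := congrFun hΓ.1 t
    exact congrArg Subtype.val this
  refine ⟨Γ 1 - Γ 0, fun s => γ.extend s, fun s => Γ (projIcc 0 1 zero_le_one s), ?_, ?_, ?_, ?_, ?_, ?_⟩
  · exact γ.continuous_extend.continuousOn
  · exact (Γ.continuous.comp continuous_projIcc).continuousOn
  · intro s hs
    rw [hΓ1]; rfl
  · simp
  · simp
  · simp

lemma Ac_lasso {f q : ℂ → ℂ} (hf : Continuous f) (hq : Continuous q) {b : ℂ} {k : ℕ}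
    (hfq : ∀ y, f y = (y - b) ^ k * q y) (hqb : q b ≠ 0)
    (hc : IsPathConnected {x | f x ≠ 0}) {y : ℂ} (hy : f y ≠ 0) :
    Ac f y y (2 * Real.pi * Complex.I * k) := by
  have h1 : ∀ᶠ x in 𝓝 b, q x / q b ∈ Complex.slitPlane := by
    have : Tendsto (fun x => q x / q b) (𝓝 b) (𝓝 1) := by
      have := (hq.tendsto b).div_const (q b)
      rwa [div_self hqb] at this
    exact this.eventually (Complex.isOpen_slitPlane.mem_nhds Complex.one_mem_slitPlane)
  obtain ⟨ε, hε, hb⟩ := Metric.eventually_nhds_iff.mp h1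
  set ρ := ε / 2 with hρ
  have hρ0 : 0 < ρ := by positivity
  let η : ℝ → ℂ := fun s => b + ρ * Complex.exp (2 * Real.pi * Complex.I * s)
  have hη : Continuous η := by fun_prop
  have hs : ∀ s, q (η s) / q b ∈ Complex.slitPlane := fun s => hb (by
    have e : (2 * Real.pi * Complex.I * s : ℂ) = ((2 * Real.pi * s : ℝ) : ℂ) * Complex.I := by
      push_cast; ring
    simp only [η, dist_self_add_left, norm_mul, e, Complex.norm_exp_ofReal_mul_I, Complex.norm_real]
    rw [Real.norm_of_nonneg hρ0.le]; linarith)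
  have h01 : η 1 = η 0 := by simp [η]
  have hρc : (ρ : ℂ) ≠ 0 := by exact_mod_cast hρ0.ne'
  have key : Ac f (η 0) (η 0) (2 * Real.pi * Complex.I * k) := by
    refine ⟨η, fun s => k * (Complex.log ρ + 2 * Real.pi * Complex.I * s) +
      (Complex.log (q (η s) / q b) + Complex.log (q b)), hη.continuousOn, ?_, ?_, rfl, h01, ?_⟩
    · apply Continuous.continuousOn
      have : Continuous fun s => Complex.log (q (η s) / q b) :=
        Continuous.clog ((hq.comp hη).div_const _) hs
      fun_prop
    · intro s _
      have hne := Complex.slitPlane_ne_zero (hs s)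
      rw [Complex.exp_add, Complex.exp_add, Complex.exp_log hne, Complex.exp_log hqb,
        div_mul_cancel₀ _ hqb, Complex.exp_nat_mul, Complex.exp_add, Complex.exp_log hρc, hfq]
      simp [η]
    · simp only [h01]; push_cast; ring
  have hne : f (η 0) ≠ 0 := by
    obtain ⟨_, _, _, _, h, h', _⟩ := key
    rw [← h', ← h 0 zero_mem_I]; exact Complex.exp_ne_zero _
  obtain ⟨c, hc⟩ := exists_Ac hf (hc.joinedIn _ hy _ hne)
  have := (hc.trans key).trans hc.symm
  convert this using 1; ring

lemma Ac_gcd {ι : Type*} [Fintype ι] {f : ℂ → ℂ} {y : ℂ} (hy : f y ≠ 0) (μ : ι → ℕ)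
    (h : ∀ i, Ac f y y (2 * Real.pi * Complex.I * μ i)) (k : ℤ) :
    Ac f y y (2 * Real.pi * Complex.I * ((Finset.univ.gcd μ : ℕ) * k)) := by
  let Z : AddSubgroup ℤ :=
    { carrier := {k | Ac f y y (2 * Real.pi * Complex.I * k)}
      add_mem' := fun {a b} ha hb => by
        have := Ac.trans ha hb
        simp only [mem_setOf_eq]; convert this using 1; push_cast; ring
      zero_mem' := by simpa using Ac.refl hy
      neg_mem' := fun {a} ha => by
        have := Ac.symm ha
        simp only [mem_setOf_eq]; convert this using 1; push_cast; ring }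
  obtain ⟨a, ha⟩ := Int.subgroup_cyclic Z
  have hdvd : (a.natAbs) ∣ Finset.univ.gcd μ := Finset.dvd_gcd fun i _ => by
    have : ((μ i : ℕ) : ℤ) ∈ Z := by
      show Ac f y y _
      have := h i; exact_mod_cast this
    rw [ha, AddSubgroup.mem_closure_singleton] at this
    obtain ⟨t, ht⟩ := this
    have : a ∣ (μ i : ℤ) := ⟨t, by rw [← ht]; simp [mul_comm]⟩
    exact Int.natAbs_dvd_natAbs.mpr this |>.trans (by simp)
  have hmem : ((Finset.univ.gcd μ : ℕ) : ℤ) * k ∈ Z := by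
    rw [ha, AddSubgroup.mem_closure_singleton]
    have : a ∣ ((Finset.univ.gcd μ : ℕ) : ℤ) := Int.dvd_natCast.mpr hdvd
    obtain ⟨t, ht⟩ := this
    exact ⟨t * k, by rw [ht]; simp; ring⟩
  have : Ac f y y _ := hmem
  exact_mod_cast this

/-- the reduced product -/
noncomputable def vp {s : ℕ} (β : Fin s → ℂ) (μ : Fin s → ℕ) (y w : ℂ) : ℂ :=
  gp β (fun j => μ j / Finset.univ.gcd μ) y w

lemma vp_pow {s : ℕ} (β : Fin s → ℂ) (μ : Fin s → ℕ) (y w : ℂ) :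
    gp β μ y w = vp β μ y w ^ Finset.univ.gcd μ := by
  unfold vp gp
  rw [← Finset.prod_pow]
  refine Finset.prod_congr rfl fun j hj => ?_
  rw [← pow_mul, Nat.div_mul_cancel (Finset.gcd_dvd hj)]

lemma gp_pc {s : ℕ} (β : Fin s → ℂ) (μ : Fin s → ℕ) (w : ℂ) :
    IsPathConnected {y | gp β μ y w ≠ 0} := by
  have hfin : {y | gp β μ y w = 0}.Finite := by
    have := (GP β μ w).roots.toFinset.finite_toSet
    refine this.subset fun y hy => ?_
    simp only [Finset.mem_coe, Multiset.mem_toFinset]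
    rw [Polynomial.mem_roots (GP_monic β μ w).ne_zero, Polynomial.IsRoot, GP_eval]
    exact hy
  exact hfin.countable.isPathConnected_compl_of_one_lt_rank (by simp)

lemma Ac_main {s : ℕ} (β : Fin s → ℂ) (hβ : Function.Injective β) (μ : Fin s → ℕ)
    (hm : 0 < Finset.univ.gcd μ) {w : ℂ} (hw : w ≠ 0) {y1 y2 : ℂ} (h1 : vp β μ y1 w ≠ 0)
    (h12 : vp β μ y1 w = vp β μ y2 w) : Ac (fun y => gp β μ y w) y1 y2 0 := by
  have hcont : Continuous fun y => gp β μ y w := by unfold gp; fun_prop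
  have hvcont : Continuous fun y => vp β μ y w := by unfold vp gp; fun_prop
  obtain ⟨c, hc⟩ := exists_Ac hvcont ((gp_pc β (fun j => μ j / Finset.univ.gcd μ) w).joinedIn
    y1 h1 y2 (by have := h1; rw [h12] at this; exact this))
  have hc1 : Complex.exp c = 1 := by
    obtain ⟨η, τ, -, -, h3, h4, h5, h6⟩ := hc
    rw [← h6, Complex.exp_sub, h3 _ one_mem_I, h3 _ zero_mem_I, h4, h5]
    simp only
    rw [h12, div_self]
    rwa [← h12]
  obtain ⟨k, hk⟩ := Complex.exp_eq_one_iff.mp hc1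
  have hf := hc.pow (f := fun y => gp β μ y w) (m := Finset.univ.gcd μ) (fun y => vp_pow β μ y w)
  have h0 : gp β μ y1 w ≠ 0 := by rw [vp_pow]; exact pow_ne_zero _ h1
  have hl : ∀ j, Ac (fun y => gp β μ y w) y1 y1 (2 * Real.pi * Complex.I * μ j) := fun j => by
    refine Ac_lasso (q := fun y => ∏ i ∈ Finset.univ.erase j, (y - β i * w) ^ μ i) (b := β j * w)
      hcont (by fun_prop) (fun y => ?_) ?_ (gp_pc β μ w) h0
    · rw [gp, ← Finset.mul_prod_erase _ _ (Finset.mem_univ j)]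
    · rw [Finset.prod_ne_zero_iff]
      intro i hi
      refine pow_ne_zero _ ?_
      rw [← sub_mul]
      refine mul_ne_zero (sub_ne_zero.mpr fun h => ?_) hw
      exact Finset.ne_of_mem_erase hi (hβ h.symm)
  have := (Ac_gcd (f := fun y => gp β μ y w) h0 μ hl (-k)).trans hf
  convert this using 1
  rw [hk]; push_cast; ring

end JC

namespace JC
open Set Topology Filter

lemma jn_map {E F : Type*} (f : E → F) (γ δ : ℝ → E) :
    (fun s => f (jn γ δ s)) = jn (fun s => f (γ s)) (fun s => f (δ s)) := by
  funext s; unfold jn; split_ifs <;> rfl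

namespace Dat
variable (D : Dat) {H : Type*} [Group H] (h : Hol D.S H)

/-- fibre of the complement over `(y,w)` -/
def Fb (l : ℂ × ℂ) : Set ℂ := {x | (x, l) ∈ D.S}

variable {D}

lemma IsP_fib {l : ℂ × ℂ} {γ : ℝ → ℂ} (hγ : IsP (D.Fb l) γ) : IsP D.S (fun s => (γ s, l)) :=
  ⟨hγ.cont.prodMk continuousOn_const, hγ.mem⟩

variable (hOm : ∀ γ, IsP D.Om γ → h.h γ = 1)
include hOm

lemma persist {γ : ℝ → ℂ} {l0 : ℂ × ℂ} (hγ : IsP (D.Fb l0) γ) (h0 : (γ 0, l0) ∈ D.Om)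
    (h1 : (γ 1, l0) ∈ D.Om) :
    ∀ᶠ l in 𝓝 l0, IsP (D.Fb l) γ ∧ h.h (fun s => (γ s, l)) = h.h (fun s => (γ s, l0)) := by
  have hK : IsCompact (γ '' Icc 0 1) := isCompact_Icc.image_of_continuousOn hγ.cont
  obtain ⟨U, V, hU, hV, hKU, hlV, hUV⟩ := generalized_tube_lemma hK (isCompact_singleton (x := l0))
    D.S_open (by
      rintro ⟨x, l⟩ ⟨⟨s, hs, rfl⟩, hl⟩
      rw [mem_singleton_iff] at hl; subst hl
      exact hγ.mem s hs)
  have hOo : IsOpen D.Om := by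
    unfold Om
    exact isOpen_lt (by fun_prop) (Complex.continuous_re.comp continuous_fst)
  have n1 : {l | (γ 0, l) ∈ D.Om} ∈ 𝓝 l0 :=
    (hOo.preimage (f := fun l : ℂ × ℂ => (γ 0, l)) (by fun_prop)).mem_nhds h0
  have n2 : {l | (γ 1, l) ∈ D.Om} ∈ 𝓝 l0 :=
    (hOo.preimage (f := fun l : ℂ × ℂ => (γ 1, l)) (by fun_prop)).mem_nhds h1
  have n3 : V ∈ 𝓝 l0 := hV.mem_nhds (hlV rfl)
  obtain ⟨ε, hε, hb⟩ := Metric.mem_nhds_iff.mp (inter_mem (inter_mem n1 n2) n3)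
  filter_upwards [Metric.ball_mem_nhds l0 hε] with l hl
  have hseg : ∀ t ∈ Icc (0:ℝ) 1, l0 + t • (l - l0) ∈ Metric.ball l0 ε := fun t ht =>
    (convex_ball l0 ε).add_smul_sub_mem (Metric.mem_ball_self hε) hl ht
  refine ⟨⟨hγ.cont, fun s hs => hUV ⟨hKU ⟨s, hs, rfl⟩, (hb hl).2⟩⟩, ?_⟩
  have key := h.sq (fun s t => (γ s, l0 + t • (l - l0))) ⟨?_, fun s hs t ht =>
    hUV ⟨hKU ⟨s, hs, rfl⟩, (hb (hseg t ht)).2⟩⟩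
  · rw [hOm (fun t => (γ 1, l0 + t • (l - l0))) ⟨by fun_prop, fun t ht => (hb (hseg t ht)).1.2⟩,
      hOm (fun t => (γ 0, l0 + t • (l - l0))) ⟨by fun_prop, fun t ht => (hb (hseg t ht)).1.1⟩] at key
    simpa using key.symm
  · refine ContinuousOn.prodMk (hγ.cont.comp continuousOn_fst fun p hp => hp.1) ?_
    fun_prop

omit hOm in
lemma mem_Om {N : ℝ} {l : ℂ × ℂ} : ((N : ℂ), l) ∈ D.Om ↔ D.c * (‖l.1‖ + ‖l.2‖) < N := by
  simp [Om]

/-- transport a fibre loop to another base point -/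
noncomputable def conjN (N N' : ℝ) (γ : ℝ → ℂ) : ℝ → ℂ :=
  jn (fun s => ((N' + s * (N - N') : ℝ) : ℂ)) (jn γ (fun s => ((N + s * (N' - N) : ℝ) : ℂ)))

omit hOm in
lemma segN {l : ℂ × ℂ} {N N' : ℝ} (hN : D.c * (‖l.1‖ + ‖l.2‖) < N)
    (hN' : D.c * (‖l.1‖ + ‖l.2‖) < N') :
    IsP D.Om (fun s => (((N + s * (N' - N) : ℝ) : ℂ), l)) := by
  refine ⟨by fun_prop, fun s hs => ?_⟩
  simp only [Om, mem_setOf_eq, Complex.ofReal_re]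
  nlinarith [hs.1, hs.2, mul_nonneg hs.1 (sub_nonneg.mpr hN'.le),
    mul_nonneg (sub_nonneg.mpr hs.2) (sub_nonneg.mpr hN.le)]

omit hOm in
lemma segN' {l : ℂ × ℂ} {N N' : ℝ} (hN : D.c * (‖l.1‖ + ‖l.2‖) < N)
    (hN' : D.c * (‖l.1‖ + ‖l.2‖) < N') :
    IsP (D.Fb l) (fun s => ((N + s * (N' - N) : ℝ) : ℂ)) :=
  ⟨by fun_prop, fun s hs => D.Om_sub ((segN hN hN').mem s hs)⟩

omit hOm in
lemma conjN_isP {γ : ℝ → ℂ} {l : ℂ × ℂ} {N N' : ℝ} (hγ : IsP (D.Fb l) γ) (h0 : γ 0 = N)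
    (h1 : γ 1 = N) (hN : D.c * (‖l.1‖ + ‖l.2‖) < N) (hN' : D.c * (‖l.1‖ + ‖l.2‖) < N') :
    IsP (D.Fb l) (conjN N N' γ) :=
  (segN' hN' hN).jn (hγ.jn (segN' hN hN') (by simp [h1])) (by simp [jn_zero, h0])

lemma conjN_h {γ : ℝ → ℂ} {l : ℂ × ℂ} {N N' : ℝ} (hγ : IsP (D.Fb l) γ) (h0 : γ 0 = N)
    (h1 : γ 1 = N) (hN : D.c * (‖l.1‖ + ‖l.2‖) < N) (hN' : D.c * (‖l.1‖ + ‖l.2‖) < N') :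
    h.h (fun s => (conjN N N' γ s, l)) = h.h (fun s => (γ s, l)) := by
  unfold conjN
  rw [jn_map (fun x => (x, l)), jn_map (fun x => (x, l)), h.jn (IsP_fib (segN' hN' hN)) ?_ ?_,
    h.jn (IsP_fib hγ) (IsP_fib (segN' hN hN')) (by simp [h1]), hOm _ (segN hN hN'),
    hOm _ (segN hN' hN)]
  · simp
  · exact (IsP_fib hγ).jn (IsP_fib (segN' hN hN')) (by simp [h1])
  · simp [jn_zero, h0]

/-- comparison of fibre loops over two points with the same value of the reduced product -/
lemma fib_compare (hcrit : D.Crit) {w : ℂ} (hw : w ≠ 0) {y1 y2 : ℂ} {N : ℝ}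
    (hN1 : D.c * (‖y1‖ + ‖w‖) < N) (hN2 : D.c * (‖y2‖ + ‖w‖) < N)
    (h1 : vp D.β D.μ y1 w ≠ 0) (h12 : vp D.β D.μ y1 w = vp D.β D.μ y2 w)
    (hs : Simple (GP D.α D.e w - Polynomial.C (gp D.β D.μ y1 w)))
    (hm : 0 < Finset.univ.gcd D.μ)
    {γ : ℝ → ℂ} (hγ : IsP (D.Fb (y1, w)) γ) (hγ0 : γ 0 = N) (hγ1 : γ 1 = N) :
    h.h (fun s => (γ s, y1, w)) = h.h (fun s => (γ s, y2, w)) := by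
  obtain ⟨η, τ, hη, hτ, hexp, e0, e1, hdiff⟩ := Ac_main D.β D.hβ D.μ hm hw h1 h12
  simp only at hexp
  have hfc : Continuous fun y => gp D.β D.μ y w := by unfold gp; fun_prop
  obtain ⟨T0, hT0⟩ := (isCompact_Icc (a := (0:ℝ)) (b := 1)).exists_bound_of_continuousOn
    (hfc.comp_continuousOn hη)
  set T := max T0 0 + 1 with hTd
  have hT1 : 1 ≤ T := by rw [hTd]; linarith [le_max_right T0 0]
  have hA := D.A_nonneg
  have hc := D.c_ge
  have hwn := norm_nonneg w
  set N' : ℝ := D.c * (D.A * ‖w‖ + T + ‖w‖) + D.A * ‖w‖ + T + |N| + 1 with hN'd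
  have hAw : 0 ≤ D.A * ‖w‖ := by positivity
  have hbig : 0 ≤ D.c * (D.A * ‖w‖ + T + ‖w‖) := by positivity
  have hNN' : N < N' := by linarith [le_abs_self N]
  have hy : ∀ y, ‖gp D.β D.μ y w‖ < T → D.c * (‖y‖ + ‖w‖) < N' := by
    intro y hy
    have : ‖y‖ ≤ D.A * ‖w‖ + T := by
      by_contra hcon
      push Not at hcon
      have l1 := gp_lower D.β D.μ D.hAβ y w (by linarith)
      rw [D.hdf] at l1
      have l2 : T ≤ (‖y‖ - D.A * ‖w‖) ^ D.d := by
        have : (‖y‖ - D.A * ‖w‖) ≤ (‖y‖ - D.A * ‖w‖) ^ D.d := le_self_pow₀ (by linarith) D.hd.ne'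
        linarith
      linarith
    have : D.c * (‖y‖ + ‖w‖) ≤ D.c * (D.A * ‖w‖ + T + ‖w‖) := by gcongr
    linarith [abs_nonneg N]
  have hmap : MapsTo (fun p : ℂ × ℂ => (p.1, p.2, w)) (S2 (GP D.β D.μ w) (GP D.α D.e w)) D.S := by
    rintro ⟨x, y⟩ hp
    simp only [S2, mem_setOf_eq, GP_eval] at hp
    exact hp
  have hag := star (f := GP D.β D.μ w) (g := GP D.α D.e w)
    (by rw [GP_natDegree, D.hdf]; exact D.hd) (GP_monic _ _ _)
    (by rw [GP_natDegree, D.hdg]; exact D.hd)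
    (h.comap (fun p : ℂ × ℂ => (p.1, p.2, w)) (by fun_prop) hmap) N' T
    (by
      rw [GP_eval]
      have hN'0 : ‖(N' : ℂ)‖ = N' := by
        rw [Complex.norm_real, Real.norm_of_nonneg]; linarith [abs_nonneg N]
      refine le_trans ?_ (gp_lower D.α D.e D.hAα _ w (by rw [hN'0]; linarith [abs_nonneg N]))
      rw [D.hdg, hN'0]
      refine le_trans ?_ (le_self_pow₀ ?_ D.hd.ne')
      · linarith [abs_nonneg N]
      · linarith [abs_nonneg N])
    (by
      intro ζ hζ
      refine hOm (fun s => ((N' : ℂ), ζ s, w)) ⟨?_, fun s hs => ?_⟩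
      · exact continuousOn_const.prodMk (hζ.cont.prodMk continuousOn_const)
      · have := hζ.mem s hs
        simp only [mem_setOf_eq, GP_eval] at this
        simpa [Om] using hy _ this)
    (by
      intro x y hxy hx' hy'
      rw [GP_eval, GP_eval] at hxy
      rw [GP_eval, ← hxy]
      exact hcrit x y w hw hxy hx' hy')
    η τ hη hτ (fun s hs => by rw [GP_eval]; exact hexp s hs)
    (fun s hs => by
      rw [GP_eval]
      have := hT0 s hs
      simp only [Function.comp] at this
      linarith [le_max_left T0 0])
    (sub_eq_zero.mp hdiff).symm (by rw [GP_eval, e0]; exact hs)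
  rw [e0, e1] at hag
  have hN1' : D.c * (‖y1‖ + ‖w‖) < N' := hN1.trans hNN'
  have hN2' : D.c * (‖y2‖ + ‖w‖) < N' := hN2.trans hNN'
  have hF : D.Fb (y1, w) = D.Fb (y2, w) := by
    unfold Fb S; simp only [mem_setOf_eq]
    rw [vp_pow D.β D.μ y1, vp_pow D.β D.μ y2, h12]
  have hγ' : IsP (D.Fb (y2, w)) γ := hF ▸ hγ
  have := hag (conjN N N' γ) (by simp [conjN, jn_zero]) (by simp [conjN, jn_one])
    (by
      have := conjN_isP (N' := N') hγ hγ0 hγ1 hN1 hN1'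
      refine ⟨this.cont, fun s hs => ?_⟩
      have := this.mem s hs
      simpa [Fb, S] using this)
  rw [← conjN_h h hOm hγ hγ0 hγ1 hN1 hN1', ← conjN_h h hOm hγ' hγ0 hγ1 hN2 hN2']
  exact this

end Dat
end JC

namespace JC
open Set Topology Filter
namespace Dat
variable (D : Dat) {H : Type*} [Group H] (h : Hol D.S H)

lemma Qx_mem {N θ' η : ℝ} (hN : 1 < N) 
    (hθ : Complex.exp ((D.d * (θ' + η) : ℝ) * Complex.I) ≠ 1) :
    IsP (D.Fb (cis η, 0)) (Qx N θ') := by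
  refine ⟨(Qx_cont N θ').continuousOn, fun s hs => ?_⟩
  refine D.mem_S_inf.mpr ?_
  have hm0 : 0 ≤ min 1 (4 / 3 * (1 - s)) := le_min zero_le_one (by linarith [hs.2])
  have := polar_ne D.hd (ρ₁ := N * min 1 (4 / 3 * (1 - s))) (ρ₂ := 1) (φ₁ := -θ' * min 1 (4 * s))
    (φ₂ := η) (by positivity) zero_le_one ?_
  · simpa [Qx, cis] using this
  · rcases le_total s (1/4) with h4 | h4
    · left
      rw [min_eq_left (by linarith : (1:ℝ) ≤ 4 / 3 * (1 - s))]
      linarith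
    · right
      refine ⟨one_pos, ?_⟩
      rw [min_eq_left (by linarith : (1:ℝ) ≤ 4 * s)]
      convert hθ using 4; ring

/-- the standard fibre loop -/
noncomputable def Lp (N : ℝ) (j : ℤ) : ℝ → ℂ :=
  jn (Qx N (D.th (j-1))) (fun s => Qx N (D.th j) (1 - s))

lemma Lp_zero (N : ℝ) (j : ℤ) : D.Lp N j 0 = N := by simp [Lp, jn_zero, Qx_zero]
lemma Lp_one (N : ℝ) (j : ℤ) : D.Lp N j 1 = N := by simp [Lp, jn_one, Qx_zero]

lemma th_add (j k : ℤ) : D.th j + 2 * Real.pi * k / D.d = D.th (j + k) := by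
  unfold th; push_cast; ring

lemma Lp_isP {N : ℝ} (hN : 1 < N) (j k : ℤ) : IsP (D.Fb (cis (2 * Real.pi * k / D.d), 0)) (D.Lp N j) := by
  have g : ∀ j, Complex.exp ((D.d * (D.th j + 2 * Real.pi * k / D.d) : ℝ) * Complex.I) ≠ 1 := fun j => by
    rw [th_add]; exact D.th_good _
  exact (D.Qx_mem hN (g _)).jn (D.Qx_mem hN (g _)).rev (by simp [Qx_one])

lemma Lp_h (hOm : ∀ γ, IsP D.Om γ → h.h γ = 1) {N : ℝ} (hN : D.c < N) (j k : ℤ) :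
    h.h (fun s => (D.Lp N j s, cis (2 * Real.pi * k / D.d), 0)) =
      h.h (P (D.th (j + k - 1))) * (h.h (P (D.th (j + k))))⁻¹ := by
  have hN1 : 1 < N := lt_of_le_of_lt D.c_ge hN
  have g : ∀ j, Complex.exp ((D.d * (D.th j + 2 * Real.pi * k / D.d) : ℝ) * Complex.I) ≠ 1 := fun j => by
    rw [th_add]; exact D.th_good _
  have e1 := D.HQ h hOm hN _ _ (g (j-1))
  have e2 := D.HQ h hOm hN _ _ (g j)
  have i1 := IsP_fib (D.Qx_mem hN1 (g (j-1)))
  have i2 := IsP_fib (D.Qx_mem hN1 (g j))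
  unfold Lp
  rw [jn_map (fun x => (x, cis (2 * Real.pi * k / D.d), (0:ℂ))), h.jn i1 i2.rev (by simp [Qx_one]), h.rev i2,
    ← e1, ← e2, th_add, th_add]
  rw [show j - 1 + k = j + k - 1 by ring]
  group

lemma gcd_pos : 0 < Finset.univ.gcd D.μ := by
  rw [Nat.pos_iff_ne_zero]
  intro h0
  rw [Finset.gcd_eq_zero_iff] at h0
  have : D.d = 0 := by rw [← D.hdf]; exact Finset.sum_eq_zero fun i hi => h0 i hi
  exact D.hd.ne' this

lemma gcd_dvd_d : Finset.univ.gcd D.μ ∣ D.d := by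
  rw [← D.hdf]; exact Finset.dvd_sum fun i hi => Finset.gcd_dvd hi

lemma simple_inf : Simple (GP D.α D.e 0 - Polynomial.C 1) := by
  intro x hx hx'
  have e : GP D.α D.e 0 = Polynomial.X ^ D.d := by
    unfold GP; simp [Finset.prod_pow_eq_pow_sum, D.hdg]
  rw [e, Polynomial.eval_sub, Polynomial.eval_pow, Polynomial.eval_X, Polynomial.eval_C,
    sub_eq_zero] at hx
  rw [e, Polynomial.derivative_sub, Polynomial.derivative_C, sub_zero,
    Polynomial.derivative_X_pow, Polynomial.eval_mul, Polynomial.eval_C, Polynomial.eval_pow,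
    Polynomial.eval_X, mul_eq_zero] at hx'
  rcases hx' with h0 | h0
  · exact D.hd.ne' (by exact_mod_cast h0)
  · have : x = 0 := eq_zero_of_pow_eq_zero h0
    rw [this, zero_pow D.hd.ne'] at hx
    exact zero_ne_one hx

lemma simple_near : ∀ᶠ w in 𝓝 (0:ℂ), Simple (GP D.α D.e w - Polynomial.C 1) := by
  have hdeg : ∀ w, (Polynomial.C (1:ℂ)).degree < (GP D.α D.e w).degree := fun w => by
    rw [Polynomial.degree_eq_natDegree (GP_monic _ _ w).ne_zero, GP_natDegree, D.hdg]
    refine lt_of_le_of_lt Polynomial.degree_C_le ?_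
    exact_mod_cast D.hd
  obtain ⟨U, hU, h0, Θ, Φ, -, hh⟩ := local_iso (fun w => GP D.α D.e w - Polynomial.C 1) D.hd
    (fun w => (GP_monic _ _ w).sub_of_left (hdeg w))
    (fun w => by
      rw [Polynomial.natDegree_sub_C, GP_natDegree, D.hdg])
    (fun x => by simp only [Polynomial.eval_sub, GP_eval, Polynomial.eval_C]; unfold gp; fun_prop)
    0 D.simple_inf 0 (by
      simp [gp_zero, D.hdg, D.hd.ne'])
  filter_upwards [hU.mem_nhds h0] with w hw
  exact (hh w hw).2.2.2.2.2

lemma root_vp (y0 : ℂ) (hy0 : y0 ^ (D.d / Finset.univ.gcd D.μ) = 1) {ε : ℝ} (hε : 0 < ε) :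
    ∀ᶠ w in 𝓝 (0:ℂ), ∃ y, ‖y0 - y‖ < ε ∧ vp D.β D.μ y w = 1 := by
  set m := Finset.univ.gcd D.μ
  have hsum : ∑ j, D.μ j / m = D.d / m := by
    rw [← D.hdf]
    refine (Nat.div_eq_of_eq_mul_left D.gcd_pos ?_).symm
    rw [Finset.sum_mul]
    exact Finset.sum_congr rfl fun j hj => (Nat.div_mul_cancel (Finset.gcd_dvd hj)).symm
  have hpos : 0 < D.d / m := Nat.div_pos (Nat.le_of_dvd D.hd D.gcd_dvd_d) D.gcd_pos
  have hc : Continuous fun w => vp D.β D.μ y0 w - 1 := by unfold vp gp; fun_prop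
  have h0 : vp D.β D.μ y0 0 - 1 = 0 := by
    unfold vp; rw [gp_zero, hsum, hy0, sub_self]
  have : ∀ᶠ w in 𝓝 (0:ℂ), ‖vp D.β D.μ y0 w - 1‖ < ε ^ (D.d / m) := by
    have := hc.norm.tendsto 0
    rw [h0, norm_zero] at this
    exact this.eventually (gt_mem_nhds (by positivity))
  filter_upwards [this] with w hw
  have hdeg : (Polynomial.C (1:ℂ)).degree < (GP D.β (fun j => D.μ j / m) w).degree := by
    rw [Polynomial.degree_eq_natDegree (GP_monic _ _ w).ne_zero, GP_natDegree, hsum]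
    refine lt_of_le_of_lt Polynomial.degree_C_le ?_
    exact_mod_cast hpos
  obtain ⟨y, hy, hy'⟩ := root_near (q := GP D.β (fun j => D.μ j / m) w - Polynomial.C 1)
    ((GP_monic _ _ w).sub_of_left hdeg) (by rw [Polynomial.natDegree_sub_C, GP_natDegree, hsum])
    hε (x := y0) (by
      rw [Polynomial.eval_sub, GP_eval, Polynomial.eval_C]; exact hw)
  refine ⟨y, hy', ?_⟩
  rw [Polynomial.eval_sub, GP_eval, Polynomial.eval_C, sub_eq_zero] at hy
  exact hy

theorem thmA0 (hcrit : D.Crit) (hOm : ∀ γ, IsP D.Om γ → h.h γ = 1) (j : ℤ) :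
    h.h (P (D.th (j - 1))) * (h.h (P (D.th j)))⁻¹ =
    h.h (P (D.th (j + Finset.univ.gcd D.μ - 1))) * (h.h (P (D.th (j + Finset.univ.gcd D.μ))))⁻¹ := by
  set m := Finset.univ.gcd D.μ with hm
  set N : ℝ := D.c + 1
  have hc := D.c_ge
  have hN : D.c < N := by simp [N]
  have hN1 : 1 < N := lt_of_le_of_lt hc hN
  have hd0 : (D.d : ℂ) ≠ 0 := by exact_mod_cast D.hd.ne'
  have e1 := D.Lp_h h hOm hN j 0
  have e2 := D.Lp_h h hOm hN j m
  have i1 := D.Lp_isP hN1 j 0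
  have i2 := D.Lp_isP hN1 j m
  set η1 := cis (2 * Real.pi * ((0:ℤ):ℝ) / D.d) with hη1
  set η2 := cis (2 * Real.pi * ((m:ℤ):ℝ) / D.d) with hη2
  have n1 : ‖η1‖ = 1 := by rw [hη1, cis, Complex.norm_exp_ofReal_mul_I]
  have n2 : ‖η2‖ = 1 := by rw [hη2, cis, Complex.norm_exp_ofReal_mul_I]
  have om : ∀ y : ℂ, ‖y‖ = 1 → ∀ k, k = 0 ∨ k = 1 → (D.Lp N j k, y, (0:ℂ)) ∈ D.Om := by
    rintro y hy k (rfl | rfl)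
    · rw [Lp_zero]; exact mem_Om.mpr (by simpa [hy] using hN)
    · rw [Lp_one]; exact mem_Om.mpr (by simpa [hy] using hN)
  have om2 : ∀ y : ℂ, ‖y‖ = 1 → ∀ᶠ l in 𝓝 ((y, 0) : ℂ × ℂ), D.c * (‖l.1‖ + ‖l.2‖) < N := fun y hy => by
    have : Continuous fun l : ℂ × ℂ => D.c * (‖l.1‖ + ‖l.2‖) := by fun_prop
    exact (this.tendsto (y, 0)).eventually (gt_mem_nhds (by simpa [hy] using hN))
  have p1 := (persist h hOm i1 (om _ n1 0 (Or.inl rfl)) (om _ n1 1 (Or.inr rfl))).and (om2 _ n1)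
  have p2 := (persist h hOm i2 (om _ n2 0 (Or.inl rfl)) (om _ n2 1 (Or.inr rfl))).and (om2 _ n2)
  obtain ⟨ε1, hε1, b1⟩ := Metric.eventually_nhds_iff.mp p1
  obtain ⟨ε2, hε2, b2⟩ := Metric.eventually_nhds_iff.mp p2
  have r1 := D.root_vp η1 (by simp [hη1, cis]) hε1
  have r2 := D.root_vp η2 (by
    rw [hη2, cis, ← Complex.exp_nat_mul, Complex.exp_eq_one_iff]
    refine ⟨1, ?_⟩
    have : ((D.d / m : ℕ) : ℂ) * m = D.d := by exact_mod_cast Nat.div_mul_cancel D.gcd_dvd_d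
    push_cast
    rw [← hm]
    calc ((D.d / m : ℕ) : ℂ) * (2 * Real.pi * m / D.d * Complex.I)
        = (((D.d / m : ℕ) : ℂ) * m) / D.d * (2 * Real.pi * Complex.I) := by ring
      _ = 1 * (2 * Real.pi * Complex.I) := by rw [this, div_self hd0]) hε2
  have hball : ∀ᶠ w in 𝓝 (0:ℂ), ‖w‖ < min ε1 ε2 := by
    have := (continuous_norm (E := ℂ)).tendsto 0
    rw [norm_zero] at this
    exact this.eventually (gt_mem_nhds (lt_min hε1 hε2))
  have hne : ∃ᶠ w in 𝓝 (0:ℂ), w ≠ 0 := by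
    have : ∃ᶠ w in 𝓝[≠] (0:ℂ), w ≠ 0 := by
      have : ∀ᶠ w in 𝓝[≠] (0:ℂ), w ∈ ({0}ᶜ : Set ℂ) := self_mem_nhdsWithin
      exact this.frequently.mono fun w hw => hw
    exact this.filter_mono nhdsWithin_le_nhds
  obtain ⟨w, hw, ⟨⟨y1, hy1, hv1⟩, ⟨y2, hy2, hv2⟩⟩, hwε, hws⟩ :=
    (hne.and_eventually ((r1.and r2).and (hball.and D.simple_near))).exists
  have q1 := b1 (y := (y1, w)) (by
    rw [Prod.dist_eq]; refine max_lt ?_ ?_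
    · rw [dist_comm, dist_eq_norm]; exact hy1
    · simp only [dist_zero_right]; exact hwε.trans_le (min_le_left _ _))
  have q2 := b2 (y := (y2, w)) (by
    rw [Prod.dist_eq]; refine max_lt ?_ ?_
    · rw [dist_comm, dist_eq_norm]; exact hy2
    · simp only [dist_zero_right]; exact hwε.trans_le (min_le_right _ _))
  have := fib_compare h hOm hcrit hw q1.2 q2.2 (by rw [hv1]; exact one_ne_zero) (by rw [hv1, hv2])
    (by rw [vp_pow, hv1, one_pow]; exact hws) D.gcd_pos q1.1.1 (D.Lp_zero N j) (D.Lp_one N j)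
  rw [q1.1.2, q2.1.2, e1, e2] at this
  simpa using this

lemma P_zero (θ : ℝ) : P θ 0 = (1, 0, 0) := by simp [P]
lemma P_one (θ : ℝ) : P θ 1 = (0, 1, 0) := by simp [P]

/-- holonomy of the standard path -/
noncomputable def pj (j : ℤ) : H := h.h (P (D.th j))

/-- holonomy of the standard loop -/
noncomputable def bj (j : ℤ) : H := D.pj h (j - 1) * (D.pj h j)⁻¹

lemma exists_gauge' : ∃ u : ℂ × ℂ × ℂ → H, (∀ γ, IsP D.Om γ → (h.gauge u).h γ = 1) ∧
    u (1, 0, 0) = 1 ∧ (∀ γ, IsP D.Om γ → (h.gauge u).h γ = 1) ∧ ∀ θ, (h.gauge u).h (P θ) = h.h (P θ) := by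
  obtain ⟨u, h1, h2, h3⟩ := h.exists_gauge D.Om_convex D.Om_sub D.star_mem_Om
  refine ⟨u, h3, h1, h3, fun θ => ?_⟩
  have : u (0, 1, 0) = 1 := h2 _ (by
    have := D.c_ge
    simp only [Om, mem_setOf_eq]; simp; linarith)
  simp [Hol.gauge, P_zero, P_one, h1, this]

theorem thmA (hcrit : D.Crit) (j : ℤ) : D.bj h j = D.bj h (j + Finset.univ.gcd D.μ) := by
  obtain ⟨u, hu, -, -, hP⟩ := D.exists_gauge' h
  have := D.thmA0 _ hcrit hu j
  rw [hP, hP, hP, hP] at this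
  exact this

lemma swap_P (θ a : ℝ) : P θ a = (fun z : ℂ × ℂ × ℂ => (z.2.1, z.1, z.2.2)) (P (-θ) (1 - a)) := by
  simp [P]

theorem thmA' (hcrit : D.Crit) (j : ℤ) :
    (D.pj h j)⁻¹ * D.pj h (j - 1) =
    (D.pj h (j + Finset.univ.gcd D.e))⁻¹ * D.pj h (j + Finset.univ.gcd D.e - 1) := by
  let h' : Hol D.swap.S H := h.comap (fun z : ℂ × ℂ × ℂ => (z.2.1, z.1, z.2.2)) (by fun_prop)
    (fun z hz => Ne.symm hz)
  have e : ∀ k, D.swap.pj h' k = (D.pj h (-k - 1))⁻¹ := fun k => by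
    unfold pj
    rw [← h.rev (D.P_isP (D.th_good _))]
    show h.h _ = h.h _
    congr 1; funext a
    rw [swap_P]
    simp only [sub_sub_cancel]
    have : D.swap.th k = -D.th (-k - 1) := by
      unfold th; simp [swap]; ring
    rw [this, neg_neg]
  have := D.swap.thmA h' hcrit.swap (-j - Finset.univ.gcd D.e)
  unfold bj at this
  rw [e, e, e, e] at this
  rw [inv_inv, inv_inv] at this
  have hg : ((Finset.univ.gcd D.swap.μ : ℕ) : ℤ) = (Finset.univ.gcd D.e : ℕ) := rfl
  rw [hg] at this
  generalize ((Finset.univ.gcd D.e : ℕ) : ℤ) = n at *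
  rw [show -(-j - n - 1) - 1 = j + n by ring, show -(-j - n) - 1 = j + n - 1 by ring,
    show -(-j - n + n - 1) - 1 = j by ring, show -(-j - n + n) - 1 = j - 1 by ring] at this
  exact this.symm

end Dat
end JC

namespace JC
open Set Topology Filter

/-- A locally equivariant function is equivariant along all paths. -/
lemma Hol.section_global {E : Type*} [TopologicalSpace E] {S : Set E} {H : Type*} [Group H]
    (h : Hol S H) {Q : Type*} [MulAction H Q] (κ : E → Q)
    (hloc : ∀ z ∈ S, ∃ W ∈ 𝓝 z, ∀ γ, IsP (W ∩ S) γ → κ (γ 0) = h.h γ • κ (γ 1))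
    {γ : ℝ → E} (hγ : IsP S γ) : κ (γ 0) = h.h γ • κ (γ 1) := by
  have key : κ (γ 0) = h.h (fun s => γ (0 + s * (1 - 0))) • κ (γ 1) := by
    refine (isPreconnected_Icc (a := (0:ℝ)) (b := 1)).induction₂
      (fun a b => κ (γ a) = h.h (fun s => γ (a + s * (b - a))) • κ (γ b)) ?_ ?_ ?_
      zero_mem_I one_mem_I
    · intro a ha
      obtain ⟨W, hW, hh⟩ := hloc _ (hγ.mem a ha)
      have := hγ.cont a ha hW
      rw [mem_map, Metric.mem_nhdsWithin_iff] at this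
      obtain ⟨ε, hε, hb⟩ := this
      filter_upwards [self_mem_nhdsWithin, mem_nhdsWithin_of_mem_nhds (Metric.ball_mem_nhds a hε)]
        with b hb1 hb2
      have hconv : Convex ℝ (Metric.ball a ε ∩ Icc 0 1) := (convex_ball a ε).inter convex_I
      have hp := IsP.sub (S := W ∩ S) hconv (hγ.cont.mono inter_subset_right)
        (fun s hs => ⟨hb hs, hγ.mem s hs.2⟩) ⟨Metric.mem_ball_self hε, ha⟩ ⟨hb2, hb1⟩
      have := hh _ hp
      simpa using this
    · intro x y z hx hy hz h1 h2
      rw [h1, h2, smul_smul, h.sub convex_I hγ.cont hγ.mem hx hy hz]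
    · intro x y hx hy h1
      have := h.sub convex_I hγ.cont hγ.mem hy hx hy
      have e : (fun s : ℝ => γ (y + s * (y - y))) = fun _ => γ y := by funext s; simp
      rw [e, h.const _ (hγ.mem y hy)] at this
      rw [h1, smul_smul, this, one_smul]
  simpa using key

section roots
variable {H : Type*} [Group H] {d : ℕ} (hd : 0 < d)

/-- complement of roots of unity -/
def Ru (d : ℕ) : Set ℂ := {x | x ^ d ≠ 1}

/-- slit plane type star-shaped domain -/
def U0 (d : ℕ) : Set ℂ := {x | ¬ ((x ^ d).im = 0 ∧ 1 ≤ (x ^ d).re)}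

lemma U0_open : IsOpen (U0 d) := by
  have : IsClosed {x : ℂ | (x ^ d).im = 0 ∧ 1 ≤ (x ^ d).re} := by
    have c1 : IsClosed {x : ℂ | (x ^ d).im = 0} :=
      isClosed_eq (Complex.continuous_im.comp (by fun_prop)) continuous_const
    have c2 : IsClosed {x : ℂ | 1 ≤ (x ^ d).re} :=
      isClosed_le continuous_const (Complex.continuous_re.comp (by fun_prop))
    exact c1.inter c2
  exact this.isOpen_compl

include hd in
lemma U0_smul {x : ℂ} (hx : x ∈ U0 d) {t : ℝ} (ht : t ∈ Icc (0:ℝ) 1) : (t : ℂ) * x ∈ Ru d := by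
  intro h0
  apply hx
  rw [mul_pow, ← Complex.ofReal_pow] at h0
  have ht0 : t ^ d ≠ 0 := by
    intro h; rw [h] at h0; simp at h0
  have htp : 0 < t ^ d := lt_of_le_of_ne (by have := ht.1; positivity) (Ne.symm ht0)
  have ht1 : t ^ d ≤ 1 := pow_le_one₀ ht.1 ht.2
  have e : x ^ d = ((t ^ d)⁻¹ : ℝ) := by
    have hc : ((t ^ d : ℝ) : ℂ) ≠ 0 := by exact_mod_cast ht0
    rw [Complex.ofReal_inv]; exact eq_inv_of_mul_eq_one_right h0
  rw [e]
  refine ⟨Complex.ofReal_im _, ?_⟩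
  rw [Complex.ofReal_re]; exact (one_le_inv₀ htp).mpr ht1

include hd in
lemma Ru_cases {x : ℂ} (hx : x ∈ Ru d) : 1 < ‖x‖ ∨ x ∈ U0 d := by
  by_cases h : x ∈ U0 d
  · exact Or.inr h
  · left
    simp only [U0, mem_setOf_eq, not_not] at h
    by_contra hle
    push Not at hle
    have e : x ^ d = ((x ^ d).re : ℝ) := Complex.ext (by simp) (by simp [h.1])
    have h1 : ‖x ^ d‖ ≤ 1 := by rw [norm_pow]; exact pow_le_one₀ (norm_nonneg _) hle
    have h2 := (Complex.re_le_norm (x ^ d)).trans h1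
    have h3 : (x ^ d).re = 1 := le_antisymm h2 h.2
    rw [h3] at e
    exact hx (by simpa using e)

include hd in
lemma big_Ru {x : ℂ} (hx : 1 < ‖x‖) : x ∈ Ru d := by
  intro h0
  have := congrArg norm h0
  rw [norm_pow, norm_one] at this
  have h2 := one_lt_pow₀ hx hd.ne'
  linarith

def HP : Set ℂ := {z | 0 < z.re}
lemma HP_convex : Convex ℝ HP := by
  exact convex_halfSpace_gt (f := Complex.re) ⟨Complex.add_re, fun c x => by simp⟩ 0

variable (h : Hol (Ru d) H) {a : ℝ} (ha : 0 < a)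

include hd in
lemma exp_HP {z : ℂ} (hz : z ∈ HP) : Complex.exp z ∈ Ru d :=
  big_Ru hd (by rw [Complex.norm_exp]; exact Real.one_lt_exp_iff.mpr hz)

/-- holonomy of the logarithmic path -/
noncomputable def Tz (a : ℝ) (z : ℂ) : H := h.h (fun s => Complex.exp (a + s • (z - a)))

include hd ha

lemma Tz_path {γ : ℝ → ℂ} (hγ : IsP HP γ) :
    Tz h a (γ 0) * h.h (fun s => Complex.exp (γ s)) = Tz h a (γ 1) := by
  have := (h.comap (S' := HP) Complex.exp (by fun_prop) fun z hz => exp_HP hd hz).cone (a:ℂ) hγ.cont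
    (fun s hs t ht => HP_convex.add_smul_sub_mem (by simpa [HP] using ha) (hγ.mem s hs) ht)
  exact this

lemma Tz_per (z : ℂ) (hz : z ∈ HP) :
    Tz h a (z + 2 * Real.pi * Complex.I) = Tz h a (a + 2 * Real.pi * Complex.I) * Tz h a z := by
  have h0 : IsP HP (fun s : ℝ => (a : ℂ) + 2 * Real.pi * Complex.I + s • (z - a)) := by
    refine ⟨by fun_prop, fun s hs => ?_⟩
    have := HP_convex.add_smul_sub_mem (x := (a:ℂ)) (by simpa [HP] using ha) hz hs
    simp only [HP, mem_setOf_eq, Complex.add_re] at this ⊢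
    simpa using this
  have := Tz_path hd h ha h0
  simp only [zero_smul, add_zero, one_smul] at this
  rw [show (a : ℂ) + 2 * Real.pi * Complex.I + (z - a) = z + 2 * Real.pi * Complex.I by ring] at this
  rw [← this]
  congr 1
  unfold Tz
  congr 1; funext s
  rw [show (a : ℂ) + 2 * Real.pi * Complex.I + s • (z - a) =
    (a + s • (z - a)) + 2 * Real.pi * Complex.I by ring, Complex.exp_add, Complex.exp_two_pi_mul_I,
    mul_one]

/-- straight path to the origin -/
noncomputable def Rd (z : ℂ) : H := h.h (fun s : ℝ => ((1 - s : ℝ) : ℂ) * Complex.exp z)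

lemma Tz_Rd {z z' : ℂ} (hz : z ∈ HP) (hz' : z' ∈ HP) (j : ℤ)
    (hzj : d * z.im ∈ Ioo (2 * Real.pi * j) (2 * Real.pi * (j + 1)))
    (hzj' : d * z'.im ∈ Ioo (2 * Real.pi * j) (2 * Real.pi * (j + 1))) :
    Tz h a z * Rd h z = Tz h a z' * Rd h z' := by
  have hmem : ∀ s ∈ Icc (0:ℝ) 1, ∀ t ∈ Icc (0:ℝ) 1,
      ((1 - s : ℝ) : ℂ) * Complex.exp (z + t • (z' - z)) ∈ Ru d := by
    intro s hs t ht
    have him : d * (z + t • (z' - z)).im ∈ Ioo (2 * Real.pi * j) (2 * Real.pi * (j + 1)) := by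
      have := (convex_Ioo (2 * Real.pi * (j:ℝ)) (2 * Real.pi * (j + 1))).add_smul_sub_mem hzj hzj' ht
      convert this using 1
      simp; ring
    have hU : Complex.exp (z + t • (z' - z)) ∈ U0 d := by
      generalize z + t • (z' - z) = ζ at him
      rintro ⟨h1, h2⟩
      rw [← Complex.exp_nat_mul] at h1 h2
      rw [Complex.exp_im] at h1
      rw [Complex.exp_re] at h2
      have e1 : ((d:ℂ) * ζ).im = d * ζ.im := by simp
      rw [e1] at h1 h2
      have hs0 : Real.sin (d * ζ.im) = 0 := by
        rcases mul_eq_zero.mp h1 with h | h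
        · exact absurd h (Real.exp_pos _).ne'
        · exact h
      have hc0 : 0 < Real.cos (d * ζ.im) := by
        by_contra hle
        push Not at hle
        have := mul_nonpos_of_nonneg_of_nonpos (Real.exp_pos (((d:ℂ) * ζ).re)).le hle
        linarith
      have hc1 : Real.cos (d * ζ.im) = 1 := by
        have := Real.sin_sq_add_cos_sq (d * ζ.im)
        rw [hs0] at this
        nlinarith
      obtain ⟨n, hn⟩ := (Real.cos_eq_one_iff _).mp hc1
      rw [← hn] at him
      have hpi := Real.two_pi_pos
      have a1 : (j:ℝ) < n := by nlinarith [him.1]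
      have a2 : (n:ℝ) < j + 1 := by nlinarith [him.2]
      have b1 : j < n := by exact_mod_cast a1
      have b2 : n < j + 1 := by exact_mod_cast a2
      omega
    exact U0_smul hd hU ⟨by linarith [hs.2], by linarith [hs.1]⟩
  have key := h.sq (fun s t => ((1 - s : ℝ) : ℂ) * Complex.exp (z + t • (z' - z)))
    (IsSq.mk' (by fun_prop) hmem)
  simp only [sub_self, Complex.ofReal_zero, zero_mul, sub_zero, Complex.ofReal_one, one_mul,
    zero_smul, add_zero, one_smul, add_sub_cancel] at key
  rw [h.const 0 (by have := hmem 1 one_mem_I 0 zero_mem_I; simpa using this), mul_one] at key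
  have h2 := Tz_path hd h ha (γ := fun t : ℝ => z + t • (z' - z)) ⟨by fun_prop, fun s hs =>
    HP_convex.add_smul_sub_mem hz hz' hs⟩
  simp only [zero_smul, add_zero, one_smul, add_sub_cancel] at h2
  unfold Rd
  rw [key, ← h2, mul_assoc]

/-- Generation of the fundamental group of the plane minus roots of unity. -/
theorem roots_gen (K : Subgroup H) (hQ : Tz h a (a + 2 * Real.pi * Complex.I) ∈ K)
    (q0 : H) (hj : ∀ j : ℤ, ∀ z ∈ HP, d * z.im = (2 * j + 1) * Real.pi →
      Tz h a z * Rd h z * q0 ∈ K)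
    {γ : ℝ → ℂ} (hγ : IsP (Ru d) γ) (h0 : γ 0 = Complex.exp a) (h1 : γ 1 = Complex.exp a) :
    h.h γ ∈ K := by
  classical
  let κ : ℂ → H ⧸ K := fun x => if 1 < ‖x‖ then (((Tz h a (Complex.log x))⁻¹ : H) : H ⧸ K)
    else (((h.h (fun t : ℝ => (0:ℂ) + t • (x - 0)))⁻¹ * q0 : H) : H ⧸ K)
  have k1 : ∀ z ∈ HP, κ (Complex.exp z) = (((Tz h a z)⁻¹ : H) : H ⧸ K) := by
    intro z hz
    have hn : 1 < ‖Complex.exp z‖ := by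
      rw [Complex.norm_exp]; exact Real.one_lt_exp_iff.mpr hz
    simp only [κ, hn, if_true]
    obtain ⟨n, hn'⟩ := Complex.exp_eq_exp_iff_exists_int.mp (Complex.exp_log (Complex.exp_ne_zero z))
    have per : ∀ n : ℤ, ∀ z ∈ HP, (((Tz h a (z + n * (2 * Real.pi * Complex.I)))⁻¹ : H) : H ⧸ K) =
        (((Tz h a z)⁻¹ : H) : H ⧸ K) := by
      have one : ∀ z ∈ HP, (((Tz h a (z + 2 * Real.pi * Complex.I))⁻¹ : H) : H ⧸ K) =
        (((Tz h a z)⁻¹ : H) : H ⧸ K) := by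
        intro z hz
        rw [Tz_per hd h ha z hz, QuotientGroup.eq]
        rw [inv_inv, mul_assoc, mul_inv_cancel, mul_one]; exact hQ
      have hre : ∀ n : ℤ, ∀ z ∈ HP, z + n * (2 * Real.pi * Complex.I) ∈ HP := by
        intro n z hz
        simpa [HP] using hz
      intro n
      induction n using Int.induction_on with
      | zero => intro z hz; simp
      | succ i ih =>
        intro z hz
        rw [← ih z hz, ← one _ (hre i z hz)]
        push_cast; ring_nf
      | pred i ih =>
        intro z hz
        rw [← ih z hz, ← one _ (hre _ z hz)]
        push_cast; ring_nf
    rw [hn', per n z hz]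
  have k2 : ∀ x ∈ U0 d, κ x = (((h.h (fun t : ℝ => (0:ℂ) + t • (x - 0)))⁻¹ * q0 : H) : H ⧸ K) := by
    intro x hx
    by_cases hn : 1 < ‖x‖
    · have hx0 : x ≠ 0 := by rintro rfl; simp at hn; linarith
      have hzHP : Complex.log x ∈ HP := by
        simp only [HP, mem_setOf_eq, Complex.log_re]; exact Real.log_pos hn
      have := k1 _ hzHP
      rw [Complex.exp_log hx0] at this
      rw [this]
      set z := Complex.log x with hz
      -- chamber
      set j := ⌊d * z.im / (2 * Real.pi)⌋ with hjd
      have hpi := Real.two_pi_pos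
      have l1 : 2 * Real.pi * j ≤ d * z.im := by
        have := Int.floor_le (d * z.im / (2 * Real.pi))
        rw [le_div_iff₀ hpi] at this; linarith
      have l2 : d * z.im < 2 * Real.pi * (j + 1) := by
        have := Int.lt_floor_add_one (d * z.im / (2 * Real.pi))
        rw [div_lt_iff₀ hpi] at this; linarith
      have l3 : 2 * Real.pi * j ≠ d * z.im := by
        intro he
        apply hx
        rw [← Complex.exp_log hx0, ← Complex.exp_nat_mul, Complex.exp_im, Complex.exp_re]
        have e1 : ((d:ℂ) * z).im = 2 * Real.pi * j := by rw [he]; simp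
        rw [e1]
        have e2 : Real.sin (2 * Real.pi * j) = 0 := by
          rw [show 2 * Real.pi * (j:ℝ) = ((2 * j : ℤ) : ℝ) * Real.pi by push_cast; ring,
            Real.sin_int_mul_pi]
        have e3 : Real.cos (2 * Real.pi * j) = 1 := by
          rw [Real.cos_eq_one_iff]; exact ⟨j, by ring⟩
        rw [e2, e3]
        refine ⟨by simp, ?_⟩
        have : 0 ≤ ((d:ℂ) * z).re := by
          have hzp : 0 < z.re := hzHP
          simp; positivity
        simpa using Real.one_le_exp this
      have hzj : d * z.im ∈ Ioo (2 * Real.pi * j) (2 * Real.pi * (j + 1)) :=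
        ⟨lt_of_le_of_ne l1 l3, l2⟩
      have hd0 : (d:ℝ) ≠ 0 := by exact_mod_cast hd.ne'
      set z' : ℂ := ⟨1, (2 * j + 1) * Real.pi / d⟩ with hz'
      have hz'im : d * z'.im = (2 * j + 1) * Real.pi := by simp [hz']; field_simp
      have hz'HP : z' ∈ HP := by simp [HP, hz']
      have hzj' : d * z'.im ∈ Ioo (2 * Real.pi * j) (2 * Real.pi * (j + 1)) := by
        rw [hz'im]; constructor <;> nlinarith [Real.pi_pos]
      have hcmp := Tz_Rd hd h ha hzHP hz'HP j hzj hzj'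
      have hK := hj j z' hz'HP hz'im
      rw [← hcmp] at hK
      have hR : Rd h z = (h.h (fun t : ℝ => (0:ℂ) + t • (x - 0)))⁻¹ := by
        unfold Rd
        rw [Complex.exp_log hx0, ← h.rev]
        · congr 1; funext s; simp
        · refine ⟨by fun_prop, fun s hs => ?_⟩
          have := U0_smul hd hx hs
          simpa using this
      rw [hR] at hK
      rw [QuotientGroup.eq]
      simpa [mul_assoc] using hK
    · simp only [κ, hn, if_false]
  have glob := h.section_global κ ?_ hγ
  · rw [h0, h1, k1 a (by simpa [HP] using ha)] at glob
    have hT : Tz h a a = 1 := by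
      unfold Tz; simp only [sub_self, smul_zero, add_zero]
      exact h.const _ (exp_HP hd (by simpa [HP] using ha))
    rw [hT, MulAction.Quotient.smul_coe, QuotientGroup.eq] at glob
    simpa using glob
  · intro x hx
    rcases Ru_cases hd hx with hb | hU
    · have hx0 : x ≠ 0 := by rintro rfl; simp at hb; linarith
      refine ⟨{y | 1 < ‖y‖ ∧ y / x ∈ Complex.slitPlane}, ?_, ?_⟩
      · refine IsOpen.mem_nhds ?_ ⟨hb, by rw [div_self hx0]; exact Complex.one_mem_slitPlane⟩
        have c1 : IsOpen {y : ℂ | 1 < ‖y‖} := isOpen_lt continuous_const continuous_norm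
        exact c1.inter (Complex.isOpen_slitPlane.preimage (f := fun y => y / x) (by fun_prop))
      · intro δ hδ
        let L : ℝ → ℂ := fun s => Complex.log x + Complex.log (δ s / x)
        have hL : ∀ s ∈ Icc (0:ℝ) 1, Complex.exp (L s) = δ s := fun s hs => by
          have := hδ.mem s hs
          simp only [L]
          rw [Complex.exp_add, Complex.exp_log hx0, Complex.exp_log
            (Complex.slitPlane_ne_zero this.1.2), mul_div_cancel₀ _ hx0]
        have hLP : IsP HP L := by
          refine ⟨?_, fun s hs => ?_⟩
          · refine continuousOn_const.add (ContinuousOn.clog (hδ.cont.div_const _) ?_)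
            exact fun s hs => (hδ.mem s hs).1.2
          · have h1 := (hδ.mem s hs).1.1
            rw [← hL s hs, Complex.norm_exp, Real.one_lt_exp_iff] at h1
            exact h1
        have e1 := Tz_path hd h ha hLP
        have e2 : h.h (fun s => Complex.exp (L s)) = h.h δ :=
          (h.congr (hδ.mono inter_subset_right) fun s hs => (hL s hs).symm).symm
        rw [e2] at e1
        rw [← hL 0 zero_mem_I, ← hL 1 one_mem_I, k1 _ (hLP.mem 0 zero_mem_I),
          k1 _ (hLP.mem 1 one_mem_I), MulAction.Quotient.smul_coe, ← e1]
        congr 1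
        simp
    · refine ⟨U0 d, U0_open.mem_nhds hU, fun δ hδ => ?_⟩
      have e1 := h.cone (0:ℂ) hδ.cont (fun s hs t ht => by
        have := U0_smul hd (hδ.mem s hs).1 ht
        simpa using this)
      rw [k2 _ (hδ.mem 0 zero_mem_I).1, k2 _ (hδ.mem 1 one_mem_I).1, MulAction.Quotient.smul_coe,
        ← e1]
      congr 1
      simp [mul_assoc]
end roots
end JC

namespace JC
open Set Topology Filter
namespace Dat
variable {D : Dat} {H : Type*} [Group H] (h : Hol D.S H) (K : Subgroup H)

lemma pj_mem (hb : ∀ j, D.bj h j ∈ K) (i : ℤ) (j : ℤ) : D.pj h i * (D.pj h j)⁻¹ ∈ K := by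
  have step : ∀ j, D.pj h j * (D.pj h 0)⁻¹ ∈ K := by
    intro j
    induction j using Int.induction_on with
    | zero => simp
    | succ n ih =>
      have := K.mul_mem (K.inv_mem (hb (n+1))) ih
      simp only [bj] at this
      rw [add_sub_cancel_right] at this
      convert this using 1; group
    | pred n ih =>
      have := K.mul_mem (hb (-n)) ih
      simp only [bj] at this
      convert this using 1; group
  have := K.mul_mem (step i) (K.inv_mem (step j))
  convert this using 1; group

/-- all fibre loops over `l` have holonomy in `K` -/
def Good (l : ℂ × ℂ) : Prop := ∀ N : ℝ, ((N : ℂ), l) ∈ D.Om → ∀ γ, IsP (D.Fb l) γ → γ 0 = N →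
  γ 1 = N → h.h (fun s => (γ s, l)) ∈ K

variable (hOm : ∀ γ, IsP D.Om γ → h.h γ = 1)
include hOm

lemma Good.of_N {l : ℂ × ℂ} {N : ℝ} (hN : ((N : ℂ), l) ∈ D.Om)
    (hh : ∀ γ, IsP (D.Fb l) γ → γ 0 = N → γ 1 = N → h.h (fun s => (γ s, l)) ∈ K) : Good h K l := by
  intro N' hN' γ hγ h0 h1
  rw [mem_Om] at hN hN'
  rw [← conjN_h h hOm hγ h0 h1 hN' hN]
  exact hh _ (conjN_isP hγ h0 h1 hN' hN) (by simp [conjN, jn_zero]) (by simp [conjN, jn_one])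

lemma good_one (hb : ∀ j, D.bj h j ∈ K) : Good h K (1, 0) := by
  set N : ℝ := D.c + 1 with hNd
  have hc := D.c_ge
  have hN : D.c < N := by simp [N]
  have hN1 : 1 < N := lt_of_le_of_lt hc hN
  have hF : D.Fb (1, 0) = Ru D.d := by
    ext x; simp only [Fb, mem_setOf_eq, D.mem_S_inf, Ru, one_pow]
  have hcis : cis 0 = 1 := by simp [cis]
  let h1 : Hol (Ru D.d) H := h.comap (fun x : ℂ => (x, (1:ℂ), (0:ℂ))) (by fun_prop)
    (fun x hx => by rw [← hF] at hx; exact hx)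
  set a := Real.log N with ha
  have ha0 : 0 < a := Real.log_pos hN1
  have hea : Complex.exp a = N := by
    rw [← Complex.ofReal_exp, Real.exp_log (by linarith)]
  have hd := D.hd
  have hd0 : (D.d : ℝ) ≠ 0 := by exact_mod_cast hd.ne'
  have hex : ∀ θ : ℝ, Complex.exp ((a:ℂ) + ((-θ : ℝ):ℂ) * Complex.I) =
      N * Complex.exp (((-θ : ℝ):ℂ) * Complex.I) := fun θ => by rw [Complex.exp_add, hea]
  have hp : ∀ j, D.pj h j = Tz h1 a ((a:ℂ) + ((-D.th j : ℝ):ℂ) * Complex.I) *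
      Rd h1 ((a:ℂ) + ((-D.th j : ℝ):ℂ) * Complex.I) := by
    intro j
    have hg := D.th_good j
    rw [← add_zero (D.th j)] at hg
    have e1 := D.HQ h hOm hN _ _ hg
    have hQ := D.Qx_mem hN1 hg
    simp only [mul_zero, add_zero, hcis] at e1 hQ
    rw [h.const (0, 1, 0) (D.mem_S_inf.mpr (by simp [hd.ne'])), mul_one] at e1
    unfold pj
    rw [e1]
    rw [hF] at hQ
    have q14 : (1/4 : ℝ) ∈ Icc (0:ℝ) 1 := by norm_num
    have e2 := h1.sub convex_I hQ.cont hQ.mem zero_mem_I q14 one_mem_I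
    have e3 : h1.h (fun s => Qx N (D.th j) (0 + s * (1 - 0))) = h.h (fun s => (Qx N (D.th j) s, 1, 0)) := by
      show h.h _ = h.h _
      simp
    rw [← e3, ← e2]
    congr 1
    · refine (h1.congr (IsP.sub convex_I hQ.cont hQ.mem zero_mem_I q14) fun s hs => ?_)
      simp only [Qx]
      rw [min_eq_left (by linarith [hs.2]), min_eq_right (by linarith [hs.2])]
      rw [show (a:ℂ) + s • ((a:ℂ) + ((-D.th j : ℝ):ℂ) * Complex.I - a) =
        a + ((-(s * D.th j) : ℝ) : ℂ) * Complex.I by simp; ring, hex]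
      congr 3
      · simp
      · push_cast; ring
    · unfold Rd
      refine (h1.congr (IsP.sub convex_I hQ.cont hQ.mem q14 one_mem_I) fun s hs => ?_)
      simp only [Qx]
      rw [min_eq_right (by linarith [hs.1]), min_eq_left (by linarith [hs.1]), hex]
      push_cast; ring_nf
  refine Good.of_N h K hOm (N := N) (mem_Om.mpr (by simpa using hN)) ?_
  intro γ hγ h0 h1'
  rw [hF] at hγ
  rw [← hea] at h0 h1'
  have haHP : ∀ t : ℝ, (a:ℂ) + (t:ℂ) * Complex.I ∈ HP := fun t => by simpa [HP] using ha0
  refine roots_gen hd h1 ha0 K ?_ (D.pj h 0)⁻¹ ?_ hγ h0 h1'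
  · have e1 := hp 0
    have e2 := hp (-D.d)
    have hth : ((a:ℂ) + ((-D.th (-D.d) : ℝ):ℂ) * Complex.I) =
        ((a:ℂ) + ((-D.th 0 : ℝ):ℂ) * Complex.I) + 2 * Real.pi * Complex.I := by
      have : -D.th (-D.d) = -D.th 0 + 2 * Real.pi := by
        unfold th; push_cast; field_simp; ring
      rw [this]; push_cast; ring
    rw [hth, Tz_per hd h1 ha0 _ (haHP _)] at e2
    have e3 : ∀ z, Rd h1 (z + 2 * Real.pi * Complex.I) = Rd h1 z := fun z => by
      unfold Rd; rw [Complex.exp_add, Complex.exp_two_pi_mul_I, mul_one]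
    rw [e3, mul_assoc, ← e1] at e2
    have := pj_mem h K hb (-D.d) 0
    rw [e2] at this
    simpa [mul_assoc] using this
  · intro j z hz hzj
    have e1 := hp (-j - 1)
    have hpi := Real.pi_pos
    have hth : -D.th (-j - 1) = (2 * j + 1) * Real.pi / D.d := by
      unfold th; push_cast; ring
    rw [Tz_Rd hd h1 ha0 hz (haHP (-D.th (-j-1))) j, ← e1]
    · exact pj_mem h K hb _ _
    · rw [hzj]; constructor <;> nlinarith
    · have : D.d * ((a:ℂ) + ((-D.th (-j-1) : ℝ):ℂ) * Complex.I).im = (2 * j + 1) * Real.pi := by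
        rw [hth]; simp; field_simp
      rw [this]; constructor <;> nlinarith

omit hOm in
/-- scaling invariance -/
lemma smul_mem_S {x y w : ℂ} (hz : (x, y, w) ∈ D.S) {t : ℂ} (ht : t ≠ 0) :
    (t * x, t * y, t * w) ∈ D.S := by
  intro h0
  apply hz
  simp only at h0 ⊢
  rw [gp_smul, gp_smul, D.hdg, D.hdf] at h0
  exact mul_left_cancel₀ (pow_ne_zero _ ht) h0

lemma good_scale {y w : ℂ} {t : ℝ} (ht : 0 < t) (hg : Good h K (t * y, t * w)) : Good h K (y, w) := by
  intro N hN γ hγ h0 h1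
  have hpos : ∀ u ∈ Icc (0:ℝ) 1, 0 < 1 + u * (t - 1) := fun u hu => by
    rcases hu.1.eq_or_lt with h0 | h0
    · rw [← h0]; norm_num
    · nlinarith [mul_pos h0 ht, hu.2]
  have hside : IsP D.Om (fun u : ℝ => (((1 + u * (t - 1) : ℝ) : ℂ) * N, ((1 + u * (t - 1) : ℝ) : ℂ) * y,
      ((1 + u * (t - 1) : ℝ) : ℂ) * w)) := by
    refine ⟨by fun_prop, fun u hu => ?_⟩
    have hp := hpos u hu
    have hN' := mem_Om.mp hN
    rw [← Complex.ofReal_mul]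
    rw [mem_Om]
    simp only [norm_mul, Complex.norm_real, Real.norm_of_nonneg hp.le]
    simp only at hN'
    nlinarith
  have key := h.sq (fun s u => (((1 + u * (t - 1) : ℝ) : ℂ) * γ s, ((1 + u * (t - 1) : ℝ) : ℂ) * y,
      ((1 + u * (t - 1) : ℝ) : ℂ) * w)) ⟨?_, ?_⟩
  · simp only [h0, h1] at key
    rw [hOm _ hside] at key
    have := hg (t * N) (by
      have := hside.mem 1 one_mem_I; simpa using this) (fun s => t * γ s) ⟨?_, ?_⟩ (by simp [h0]) (by simp [h1])
    · simp at key
      rw [key]; exact this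
    · exact continuousOn_const.mul hγ.cont
    · intro s hs
      exact smul_mem_S (hγ.mem s hs) (by exact_mod_cast ht.ne')
  · have : ContinuousOn (fun p : ℝ × ℝ => γ p.1) (Icc 0 1 ×ˢ Icc 0 1) :=
      hγ.cont.comp continuousOn_fst fun p hp => hp.1
    refine ContinuousOn.prodMk (ContinuousOn.mul (by fun_prop) this) (by fun_prop)
  · intro s hs u hu
    exact smul_mem_S (hγ.mem s hs) (by exact_mod_cast (hpos u hu).ne')

/-- the fibre polynomial -/
noncomputable def qf (D : Dat) (l : ℂ × ℂ) : Polynomial ℂ :=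
  GP D.α D.e l.2 - Polynomial.C (gp D.β D.μ l.1 l.2)

omit hOm in
lemma qf_eval (l : ℂ × ℂ) (x : ℂ) : (qf D l).eval x = gp D.α D.e x l.2 - gp D.β D.μ l.1 l.2 := by
  simp [qf]

omit hOm in
lemma mem_Fb_qf {l : ℂ × ℂ} {x : ℂ} : x ∈ D.Fb l ↔ (qf D l).eval x ≠ 0 := by
  rw [qf_eval, sub_ne_zero]; rfl

omit hOm in
lemma qf_monic (l : ℂ × ℂ) : (qf D l).Monic := by
  refine (GP_monic _ _ _).sub_of_left ?_
  rw [Polynomial.degree_eq_natDegree (GP_monic _ _ _).ne_zero, GP_natDegree, D.hdg]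
  refine lt_of_le_of_lt Polynomial.degree_C_le ?_
  exact_mod_cast D.hd

omit hOm in
lemma qf_natDegree (l : ℂ × ℂ) : (qf D l).natDegree = D.d := by
  rw [qf, Polynomial.natDegree_sub_C, GP_natDegree, D.hdg]

omit hOm in
lemma Om_open : IsOpen D.Om := by
  unfold Om
  exact isOpen_lt (by fun_prop) (Complex.continuous_re.comp continuous_fst)

lemma good_lc (l0 : ℂ × ℂ) (hs : Simple (qf D l0)) :
    ∀ᶠ l in 𝓝 l0, Simple (qf D l) ∧ (Good h K l0 ↔ Good h K l) := by
  set N : ℝ := D.c * (‖l0.1‖ + ‖l0.2‖) + 1 with hN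
  have hN0 : ((N:ℂ), l0) ∈ D.Om := mem_Om.mpr (by linarith)
  obtain ⟨U, hU, hlU, Θ, Φ, hΘ, hh⟩ := local_iso (fun l => qf D l) D.hd (fun l => qf_monic l)
    (fun l => qf_natDegree l)
    (fun x => by
      simp only [qf_eval]
      unfold gp; fun_prop) l0 hs N (mem_Fb_qf.mp (D.Om_sub hN0))
  have n1 : {l | ((N:ℂ), l) ∈ D.Om} ∈ 𝓝 l0 :=
    (Om_open.preimage (f := fun l : ℂ × ℂ => ((N:ℂ), l)) (by fun_prop)).mem_nhds hN0
  obtain ⟨ε, hε, hb⟩ := Metric.mem_nhds_iff.mp (inter_mem n1 (hU.mem_nhds hlU))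
  have cΘ : ∀ l ∈ U, Continuous (Θ l) := fun l hl => by
    rw [← continuousOn_univ]
    exact hΘ.comp (f := fun x => (l, x)) (by fun_prop) fun x _ => ⟨hl, trivial⟩
  have fN : ∀ l ∈ U, Φ l N = N := fun l hl => by
    have := (hh l hl).2.2.1 N
    rwa [(hh l hl).2.2.2.1] at this
  have tr : ∀ l ∈ Metric.ball l0 ε, ∀ δ, IsP (D.Fb l0) δ → δ 0 = N → δ 1 = N →
      IsP (D.Fb l) (fun s => Θ l (Φ l0 (δ s))) ∧
      h.h (fun s => (Θ l (Φ l0 (δ s)), l)) = h.h (fun s => (δ s, l0)) := by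
    intro l hl δ hδ h0 h1
    have hseg : ∀ t ∈ Icc (0:ℝ) 1, l0 + t • (l - l0) ∈ Metric.ball l0 ε := fun t ht =>
      (convex_ball l0 ε).add_smul_sub_mem (Metric.mem_ball_self hε) hl ht
    have mem : ∀ l ∈ U, ∀ x ∈ D.Fb l0, Θ l (Φ l0 x) ∈ D.Fb l := by
      intro l hl x hx
      rw [mem_Fb_qf] at hx ⊢
      intro hc
      rw [(hh l hl).2.2.2.2.1, ← (hh l0 hlU).2.2.2.2.1, (hh l0 hlU).2.1] at hc
      exact hx hc
    have cδ : ContinuousOn (fun s => Φ l0 (δ s)) (Icc 0 1) := (hh l0 hlU).1.comp_continuousOn hδ.cont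
    refine ⟨⟨(cΘ l (hb hl).2).comp_continuousOn cδ, fun s hs => mem l (hb hl).2 _ (hδ.mem s hs)⟩, ?_⟩
    have key := h.sq (fun s t => (Θ (l0 + t • (l - l0)) (Φ l0 (δ s)), l0 + t • (l - l0))) ⟨?_, ?_⟩
    · have side : ∀ t ∈ Icc (0:ℝ) 1, Θ (l0 + t • (l - l0)) (Φ l0 N) = N := fun t ht => by
        rw [fN _ hlU]; exact (hh _ (hb (hseg t ht)).2).2.2.2.1
      have s1 : h.h (fun t : ℝ => (Θ (l0 + t • (l - l0)) (Φ l0 N), l0 + t • (l - l0))) = 1 := by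
        refine hOm _ (IsP.congr (γ := fun t : ℝ => ((N:ℂ), l0 + t • (l - l0)))
          ⟨by fun_prop, fun t ht => (hb (hseg t ht)).1⟩ fun t ht => ?_)
        rw [side t ht]
      simp only [h0, h1] at key
      rw [s1] at key
      simp only [mul_one, one_mul, zero_smul, add_zero, one_smul, add_sub_cancel,
        (hh l0 hlU).2.1] at key
      exact key.symm
    · refine ContinuousOn.prodMk ?_ (by fun_prop)
      refine hΘ.comp (f := fun p : ℝ × ℝ => (l0 + p.2 • (l - l0), Φ l0 (δ p.1))) ?_ ?_
      · refine ContinuousOn.prodMk (by fun_prop) ?_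
        exact cδ.comp continuousOn_fst fun p hp => hp.1
      · exact fun p hp => ⟨(hb (hseg _ hp.2)).2, trivial⟩
    · exact fun s hs t ht => mem _ (hb (hseg t ht)).2 _ (hδ.mem s hs)
  filter_upwards [Metric.ball_mem_nhds l0 hε] with l hl
  have hlU' := (hb hl).2
  refine ⟨(hh l hlU').2.2.2.2.2, fun hg => ?_, fun hg => ?_⟩
  · refine Good.of_N h K hOm (hb hl).1 fun γ hγ h0 h1 => ?_
    have hδ : IsP (D.Fb l0) (fun s => Θ l0 (Φ l (γ s))) := by
      refine ⟨(cΘ l0 hlU).comp_continuousOn ((hh l hlU').1.comp_continuousOn hγ.cont), fun s hs => ?_⟩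
      have := hγ.mem s hs
      rw [mem_Fb_qf] at this ⊢
      intro hc
      rw [(hh l0 hlU).2.2.2.2.1, ← (hh l hlU').2.2.2.2.1, (hh l hlU').2.1] at hc
      exact this hc
    have e0 : Θ l0 (Φ l N) = N := by rw [fN l hlU', (hh l0 hlU).2.2.2.1]
    have := tr l hl _ hδ (by simp only [h0, e0]) (by simp only [h1, e0])
    have e2 : (fun s => (Θ l (Φ l0 (Θ l0 (Φ l (γ s)))), l)) = fun s => (γ s, l) := by
      funext s; rw [(hh l0 hlU).2.2.1, (hh l hlU').2.1]
    rw [e2] at this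
    rw [this.2]
    exact hg N hN0 _ hδ (by simp only [h0, e0]) (by simp only [h1, e0])
  · refine Good.of_N h K hOm hN0 fun δ hδ h0 h1 => ?_
    have := tr l hl δ hδ h0 h1
    have e0 : Θ l (Φ l0 N) = N := by rw [fN l0 hlU, (hh l hlU').2.2.2.1]
    rw [← this.2]
    exact hg N (hb hl).1 _ this.1 (by simp only [h0, e0]) (by simp only [h1, e0])

omit hOm in
lemma generic_cofin (w : ℂ) : {y | ¬ Simple (qf D (y, w))}.Finite := by
  have h1 := finite_nonsimple (g := GP D.α D.e w) (by rw [GP_natDegree, D.hdg]; exact D.hd)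
  have h2 : ∀ t ∈ {t | ¬ Simple (GP D.α D.e w - Polynomial.C t)},
      ({y | gp D.β D.μ y w = t} : Set ℂ).Finite := by
    intro t _
    have hne : GP D.β D.μ w - Polynomial.C t ≠ 0 := by
      refine Polynomial.ne_zero_of_natDegree_gt (n := 0) ?_
      rw [Polynomial.natDegree_sub_C, GP_natDegree, D.hdf]; exact D.hd
    refine ((GP D.β D.μ w - Polynomial.C t).roots.toFinset.finite_toSet).subset fun y hy => ?_
    simp only [Finset.mem_coe, Multiset.mem_toFinset]
    rw [Polynomial.mem_roots hne, Polynomial.IsRoot]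
    simpa [sub_eq_zero] using hy
  refine (h1.biUnion h2).subset fun y hy => ?_
  simp only [mem_iUnion]
  exact ⟨gp D.β D.μ y w, hy, rfl⟩

theorem good_all (hb : ∀ j, D.bj h j ∈ K) (l : ℂ × ℂ) : Good h K l := by
  have hs1 : Simple (qf D (1, 0)) := by
    have := D.simple_inf
    unfold qf
    rwa [gp_zero, one_pow]
  have g1 := good_one h K hOm hb
  have ev := good_lc h K hOm (1, 0) hs1
  obtain ⟨ε, hε, hball⟩ := Metric.eventually_nhds_iff.mp ev
  have gen : ∀ w : ℂ, ‖w‖ < ε → ∀ y, Simple (qf D (y, w)) → Good h K (y, w) := by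
    intro w hw y hy
    have hc : IsPreconnected {y | Simple (qf D (y, w))} := by
      have := ((generic_cofin (D := D) w).countable.isPathConnected_compl_of_one_lt_rank
        (by simp)).isConnected.isPreconnected
      convert this using 1
      ext y; simp
    have h1w := hball (y := (1, w)) (by rw [Prod.dist_eq]; simpa using hw)
    have := hc.induction₂ (fun y y' => (Good h K (y, w) ↔ Good h K (y', w))) (fun y hy => by
        have := good_lc h K hOm (y, w) hy
        have ct : Tendsto (fun y' : ℂ => (y', w)) (𝓝 y) (𝓝 (y, w)) := by
          exact (Continuous.tendsto (by fun_prop) y)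
        exact mem_nhdsWithin_of_mem_nhds ((ct.eventually this).mono fun y' h => h.2))
      (fun _ _ _ _ _ _ => Iff.trans) (fun _ _ _ _ => Iff.symm) h1w.1 hy
    exact this.mp (h1w.2.mp g1)
  have all : ∀ w : ℂ, ‖w‖ < ε → ∀ y, Good h K (y, w) := by
    intro w hw y N hN γ hγ h0 h1
    have p := persist h hOm hγ (by rw [h0]; exact hN) (by rw [h1]; exact hN)
    have ct : Tendsto (fun y' : ℂ => (y', w)) (𝓝 y) (𝓝 (y, w)) := by
      exact (Continuous.tendsto (by fun_prop) y)
    have n1 : {l : ℂ × ℂ | ((N:ℂ), l) ∈ D.Om} ∈ 𝓝 (y, w) :=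
      (Om_open.preimage (f := fun l : ℂ × ℂ => ((N:ℂ), l)) (by fun_prop)).mem_nhds hN
    have p2 := ct.eventually (p.and n1)
    have hfin := (generic_cofin (D := D) w)
    have : ∃ᶠ y' in 𝓝 y, Simple (qf D (y', w)) := by
      have hd := hfin.countable.dense_compl ℝ
      have := mem_closure_iff_frequently.mp (hd y)
      exact this.mono fun y' hy' => by simpa using hy'
    obtain ⟨y', hs', hp', hN'⟩ := (this.and_eventually p2).exists
    rw [← hp'.2]
    exact gen w hw y' hs' N hN' γ hp'.1 h0 h1
  obtain ⟨y, w⟩ := l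
  have ht : ∃ t : ℝ, 0 < t ∧ t * ‖w‖ < ε := by
    refine ⟨ε / (‖w‖ + 1), by positivity, ?_⟩
    rw [div_mul_eq_mul_div, div_lt_iff₀ (by positivity)]
    nlinarith [norm_nonneg w]
  obtain ⟨t, ht, htw⟩ := ht
  refine good_scale h K hOm ht (all _ ?_ _)
  rw [norm_mul, Complex.norm_real, Real.norm_of_nonneg ht.le]; exact htw

end Dat
end JC

namespace JC
open Set Topology Filter
namespace Dat
variable {D : Dat} {H : Type*} [Group H] (h : Hol D.S H) (K : Subgroup H)

lemma Fb_pc (l : ℂ × ℂ) : IsPathConnected (D.Fb l) := by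
  have hfin : {x | (qf D l).eval x = 0}.Finite := by
    refine ((qf D l).roots.toFinset.finite_toSet).subset fun x hx => ?_
    simp only [Finset.mem_coe, Multiset.mem_toFinset]
    rw [Polynomial.mem_roots (qf_monic l).ne_zero]
    exact hx
  have := hfin.countable.isPathConnected_compl_of_one_lt_rank (by simp)
  convert this using 1
  ext x; simp [mem_Fb_qf]

/-- radius base -/
noncomputable def Nl (D : Dat) (l : ℂ × ℂ) : ℝ := D.c * (‖l.1‖ + ‖l.2‖) + 1

lemma Nl_mem (l : ℂ × ℂ) : (((Nl D l : ℝ) : ℂ), l) ∈ D.Om := mem_Om.mpr (by unfold Nl; linarith)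

lemma exists_isP {E : Type*} [TopologicalSpace E] {A : Set E} (hA : IsPathConnected A) {x y : E}
    (hx : x ∈ A) (hy : y ∈ A) : ∃ γ, IsP A γ ∧ γ 0 = x ∧ γ 1 = y := by
  obtain ⟨p, hp⟩ := hA.joinedIn x hx y hy
  refine ⟨p.extend, ⟨p.continuous_extend.continuousOn, fun s hs => ?_⟩, by simp, by simp⟩
  rw [p.extend_apply hs]; exact hp _

lemma exists_fib (l : ℂ × ℂ) {x : ℂ} (hx : x ∈ D.Fb l) {N : ℝ} (hN : ((N:ℂ), l) ∈ D.Om) :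
    ∃ γ, IsP (D.Fb l) γ ∧ γ 0 = N ∧ γ 1 = x :=
  exists_isP (Fb_pc l) (D.Om_sub hN) hx

variable (hOm : ∀ γ, IsP D.Om γ → h.h γ = 1)
include hOm

lemma thmB_aux (hb : ∀ j, D.bj h j ∈ K) {γ : ℝ → ℂ × ℂ × ℂ} (hγ : IsP D.S γ)
    (h0 : γ 0 = (1, 0, 0)) (h1 : γ 1 = (1, 0, 0)) : h.h γ ∈ K := by
  classical
  have ex : ∀ z : ℂ × ℂ × ℂ, ∃ c : ℝ → ℂ, z ∈ D.S → IsP (D.Fb z.2) c ∧ c 0 = Nl D z.2 ∧ c 1 = z.1 := by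
    intro z
    by_cases hz : z ∈ D.S
    · obtain ⟨c, hc⟩ := exists_fib z.2 (x := z.1) hz (Nl_mem z.2)
      exact ⟨c, fun _ => hc⟩
    · exact ⟨fun _ => 0, fun h => absurd h hz⟩
  choose c hc using ex
  let κ : ℂ × ℂ × ℂ → H ⧸ K := fun z => (((h.h (fun s => (c z s, z.2)))⁻¹ : H) : H ⧸ K)
  have wd : ∀ z ∈ D.S, ∀ N : ℝ, ((N:ℂ), z.2) ∈ D.Om → ∀ c', IsP (D.Fb z.2) c' → c' 0 = N → c' 1 = z.1 →
      κ z = (((h.h (fun s => (c' s, z.2)))⁻¹ : H) : H ⧸ K) := by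
    intro z hz N hN c' hc' c0 c1
    obtain ⟨i1, i2, i3⟩ := hc z hz
    have hN1 := mem_Om.mp hN
    have hN2 := mem_Om.mp (Nl_mem (D := D) z.2)
    have hr : IsP (D.Fb z.2) (fun s => c' (1 - s)) := hc'.rev
    have hsg := segN' (D := D) hN1 hN2
    have j1 : IsP (D.Fb z.2) (jn (fun s => c' (1 - s)) (fun s => ((N + s * (Nl D z.2 - N) : ℝ) : ℂ))) :=
      hr.jn hsg (by simp [c0])
    have g := good_all h K hOm hb z.2 _ (Nl_mem z.2) _ (i1.jn j1 (by simp [jn_zero, i3, c1]))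
      (by simp [jn_zero, i2]) (by simp [jn_one])
    rw [jn_map (fun x => (x, z.2)), jn_map (fun x => (x, z.2)), h.jn (IsP_fib i1),
      h.jn (IsP_fib hr) (IsP_fib hsg) (by simp [c0]), hOm _ (segN hN1 hN2),
      h.rev (γ := fun s => (c' s, z.2)) (IsP_fib hc'), mul_one] at g
    · simp only [κ]; rw [QuotientGroup.eq, inv_inv]; exact g
    · exact (IsP_fib hr).jn (IsP_fib hsg) (by simp [c0])
    · simp [jn_zero, i3, c1]
  have glob := h.section_global κ ?_ hγ
  · have e : κ (1, 0, 0) = ((1 : H) : H ⧸ K) := by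
      have hst := D.star_mem_Om
      rw [wd (1, 0, 0) (D.Om_sub hst) 1 (by simpa using hst) (fun _ => 1)
        (IsP.const (D.Om_sub hst)) (by simp) rfl]
      rw [h.const _ (D.Om_sub hst), inv_one]
    rw [h0, h1, e, MulAction.Quotient.smul_coe, QuotientGroup.eq] at glob
    simpa using glob
  · rintro ⟨x0, l0⟩ hz
    obtain ⟨i1, i2, i3⟩ := hc _ hz
    generalize c (x0, l0) = c0 at i1 i2 i3
    have hN0 : (((Nl D l0 : ℝ) : ℂ), l0) ∈ D.Om := Nl_mem l0
    simp only at i1 i2 i3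
    generalize Nl D l0 = N at i2 hN0
    have hK : IsCompact (c0 '' Icc 0 1) := isCompact_Icc.image_of_continuousOn i1.cont
    obtain ⟨U, V, hU, hV, hKU, hlV, hUV⟩ := generalized_tube_lemma hK (isCompact_singleton (x := l0))
      D.S_open (by
        rintro ⟨x, l⟩ ⟨⟨s, hs, rfl⟩, hl⟩
        rw [mem_singleton_iff] at hl; subst hl
        exact i1.mem s hs)
    have n1 : {l | ((N:ℂ), l) ∈ D.Om} ∈ 𝓝 l0 :=
      (Om_open.preimage (f := fun l : ℂ × ℂ => ((N:ℂ), l)) (by fun_prop)).mem_nhds hN0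
    have hx0 : x0 ∈ U := hKU ⟨1, one_mem_I, i3⟩
    obtain ⟨ε, hε, hbl⟩ := Metric.mem_nhds_iff.mp (inter_mem n1 (hV.mem_nhds (hlV rfl)))
    obtain ⟨δ, hδ, hbx⟩ := Metric.mem_nhds_iff.mp (hU.mem_nhds hx0)
    set W := Metric.ball x0 δ ×ˢ Metric.ball l0 ε with hW
    have hWc : Convex ℝ W := (convex_ball _ _).prod (convex_ball _ _)
    have hz0W : (x0, l0) ∈ W := ⟨Metric.mem_ball_self hδ, Metric.mem_ball_self hε⟩
    have hWS : W ⊆ D.S := fun z hz => hUV ⟨hbx hz.1, (hbl hz.2).2⟩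
    have T : ∀ z ∈ W, κ z = (((h.h (fun s => (c0 s, l0)) *
        h.h (fun t : ℝ => (x0, l0) + t • (z - (x0, l0))))⁻¹ : H) : H ⧸ K) := by
      rintro ⟨x, l⟩ hz
      have hl : l ∈ Metric.ball l0 ε := hz.2
      have hseg : ∀ t ∈ Icc (0:ℝ) 1, l0 + t • (l - l0) ∈ Metric.ball l0 ε := fun t ht =>
        (convex_ball l0 ε).add_smul_sub_mem (Metric.mem_ball_self hε) hl ht
      have hxs : ∀ t ∈ Icc (0:ℝ) 1, x0 + t • (x - x0) ∈ Metric.ball x0 δ := fun t ht =>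
        (convex_ball x0 δ).add_smul_sub_mem (Metric.mem_ball_self hδ) hz.1 ht
      have p1 : IsP (D.Fb l) c0 := ⟨i1.cont, fun s hs => hUV ⟨hKU ⟨s, hs, rfl⟩, (hbl hl).2⟩⟩
      have p2 : IsP (D.Fb l) (fun t : ℝ => x0 + t • (x - x0)) :=
        ⟨by fun_prop, fun s hs => hUV ⟨hbx (hxs s hs), (hbl hl).2⟩⟩
      rw [wd (x, l) (hWS hz) N (hbl hl).1 (jn c0 (fun t : ℝ => x0 + t • (x - x0)))
        (p1.jn p2 (by simp [i3])) (by simp [jn_zero, i2]) (by simp [jn_one])]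
      rw [jn_map (fun x => (x, l)), h.jn (IsP_fib p1) (IsP_fib p2) (by simp [i3])]
      have key := h.sq (fun s t => (c0 s, l0 + t • (l - l0))) ⟨?_, fun s hs t ht =>
        hUV ⟨hKU ⟨s, hs, rfl⟩, (hbl (hseg t ht)).2⟩⟩
      · simp only [i2, i3] at key
        rw [hOm (fun t => ((N:ℂ), l0 + t • (l - l0))) ⟨by fun_prop, fun t ht => (hbl (hseg t ht)).1⟩] at key
        have cone := h.cone (x0, l0) (γ := fun t : ℝ => (x0 + t • (x - x0), l)) (by fun_prop)
          (fun s hs t ht => hWS (hWc.add_smul_sub_mem hz0W ⟨hxs s hs, hl⟩ ht))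
        simp only [zero_smul, add_zero, one_smul, add_sub_cancel, one_mul] at key cone
        rw [← key, mul_assoc, ← cone]
        congr 5
        funext t; simp
      · exact ContinuousOn.prodMk (i1.cont.comp continuousOn_fst fun p hp => hp.1) (by fun_prop)
    refine ⟨W, prod_mem_nhds (Metric.ball_mem_nhds _ hδ) (Metric.ball_mem_nhds _ hε), fun η hη => ?_⟩
    have cone := h.cone (x0, l0) (γ := η) hη.cont
      (fun s hs t ht => hWS (hWc.add_smul_sub_mem hz0W (hη.mem s hs).1 ht))
    rw [T _ (hη.mem 0 zero_mem_I).1, T _ (hη.mem 1 one_mem_I).1, MulAction.Quotient.smul_coe, ← cone]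
    congr 1
    simp [mul_assoc]

omit hOm in
theorem thmB (hb : ∀ j, D.bj h j ∈ K) {γ : ℝ → ℂ × ℂ × ℂ} (hγ : IsP D.S γ)
    (h0 : γ 0 = (1, 0, 0)) (h1 : γ 1 = (1, 0, 0)) : h.h γ ∈ K := by
  obtain ⟨u, hu, hu1, -, hP⟩ := D.exists_gauge' h
  have := thmB_aux (h.gauge u) K hu (fun j => by
    have := hb j
    simp only [bj, pj] at this ⊢
    rw [hP, hP]; exact this) hγ h0 h1
  simpa [Hol.gauge, h0, h1, hu1] using this

omit hOm in
theorem S_pc : IsPathConnected D.S := by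
  have hO : IsPathConnected D.Om := D.Om_convex.isPathConnected ⟨_, D.star_mem_Om⟩
  refine ⟨(1, 0, 0), D.Om_sub D.star_mem_Om, ?_⟩
  rintro ⟨x, l⟩ hz
  have j1 := (hO.joinedIn _ D.star_mem_Om _ (Nl_mem l)).mono D.Om_sub
  have j2 := (Fb_pc l).joinedIn _ (D.Om_sub (Nl_mem l)) x hz
  refine j1.trans ?_
  obtain ⟨p, hp⟩ := j2
  exact ⟨p.map (f := fun x => (x, l)) (by fun_prop), fun t => hp t⟩

end Dat
end JC

namespace JC
open Set Topology Filter

/-- clamp to the unit interval -/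
noncomputable def cl (s : ℝ) : ℝ := max 0 (min s 1)
lemma cl_cont : Continuous cl := by unfold cl; fun_prop
lemma cl_mem (s : ℝ) : cl s ∈ Icc (0:ℝ) 1 := by
  unfold cl; exact ⟨le_max_left _ _, max_le zero_le_one (min_le_right _ _)⟩
lemma cl_eq {s : ℝ} (hs : s ∈ Icc (0:ℝ) 1) : cl s = s := by
  unfold cl; rw [min_eq_left hs.2, max_eq_right hs.1]

section bundle
variable {X : Type*} [TopologicalSpace X] {Γ : Type*} [Group Γ] {ι : Type*}

theorem bundleHol (U : ι → Set X) (hU : ∀ i, IsOpen (U i)) (hcov : ∀ x, ∃ i, x ∈ U i)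
    (φ : ι → X → Γ) (hφ : ∀ i j, ∀ x ∈ U i ∩ U j, ∀ᶠ y in 𝓝 x,
      φ j y * (φ i y)⁻¹ = φ j x * (φ i x)⁻¹) :
    ∃ h : Hol (univ : Set X) Γ, ∀ γ, IsP univ γ → ∀ f : ℝ → Γ,
      (∀ s ∈ Icc (0:ℝ) 1, ∃ i, γ s ∈ U i ∧ ∀ᶠ t in 𝓝[Icc 0 1] s,
        f t * (φ i (γ t))⁻¹ = f s * (φ i (γ s))⁻¹) → h.h γ = (f 0)⁻¹ * f 1 := by
  classical
  letI : TopologicalSpace Γ := ⊥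
  haveI : DiscreteTopology Γ := ⟨rfl⟩
  choose ix hix using hcov
  let Z : FiberBundleCore ι X Γ :=
    { baseSet := U
      isOpen_baseSet := hU
      indexAt := ix
      mem_baseSet_at := hix
      coordChange := fun i j x v => φ j x * (φ i x)⁻¹ * v
      coordChange_self := fun i x hx v => by simp
      continuousOn_coordChange := fun i j => by
        have c1 : ContinuousOn (fun x => φ j x * (φ i x)⁻¹) (U i ∩ U j) := fun x hx => by
          refine ContinuousAt.continuousWithinAt ?_
          refine tendsto_nhds_of_eventually_eq ?_
          exact hφ i j x hx
        exact ContinuousOn.mul (c1.comp continuousOn_fst fun p hp => hp.1) continuousOn_snd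
      coordChange_comp := fun i j k x hx v => by group }
  have cov : IsCoveringMap (Z.proj) := FiberBundle.isCoveringMap (F := Γ) (E := Z.Fiber)
  let cc : Z.TotalSpace → Γ := fun p => (φ (ix p.1) p.1)⁻¹ * (show Γ from p.2)
  have hcc : ∀ p i, φ i p.1 * cc p = (Z.localTriv i p).2 := fun p i => by
    exact (mul_assoc _ _ _).symm
  -- coordinates of lifts are locally constant
  have lc : ∀ {A : Type} [TopologicalSpace A] (Λ : A → Z.TotalSpace), Continuous Λ → ∀ a i,
      (Λ a).1 ∈ U i → ∀ᶠ b in 𝓝 a, φ i (Λ b).1 * cc (Λ b) = φ i (Λ a).1 * cc (Λ a) := by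
    intro A _ Λ hΛ a i ha
    have h1 : ContinuousAt (fun b => (Z.localTriv i (Λ b)).2) a := by
      refine continuousAt_snd.comp (ContinuousAt.comp (f := Λ) (g := Z.localTriv i) ?_ hΛ.continuousAt)
      exact (Z.localTriv i).continuousAt ((Z.mem_localTriv_source i _).mpr ha)
    have h2 := h1.eventually (p := fun y => y = (Z.localTriv i (Λ a)).2)
      (by exact (isOpen_discrete {(Z.localTriv i (Λ a)).2}).mem_nhds rfl)
    filter_upwards [h2] with b hb
    rw [hcc, hcc, hb]
  have exl : ∀ γ : ℝ → X, ∃ Λ : ℝ → Z.TotalSpace, ContinuousOn γ (Icc 0 1) → Continuous Λ ∧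
      ∀ s, (Λ s).1 = γ (cl s) := by
    intro γ
    by_cases hγ : ContinuousOn γ (Icc 0 1)
    swap
    · exact ⟨fun _ => (⟨γ 0, (1 : Γ)⟩ : Z.TotalSpace), fun h => absurd h hγ⟩
    let g : C(ℝ, X) := ⟨fun s => γ (cl s), hγ.comp_continuous cl_cont cl_mem⟩
    obtain ⟨F, hF, -⟩ := cov.existsUnique_continuousMap_lifts g 0 (⟨γ (cl 0), (1 : Γ)⟩ : Z.TotalSpace) rfl
    exact ⟨F, fun _ => ⟨F.continuous, fun s => congrFun hF.2 s⟩⟩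
  choose Λ hΛ using exl
  -- comparison
  have cmp : ∀ (Λ' : ℝ → Z.TotalSpace), Continuous Λ' → ∀ γ : ℝ → X, (∀ s ∈ Icc (0:ℝ) 1, (Λ' s).1 = γ s) →
      ∀ f : ℝ → Γ, (∀ s ∈ Icc (0:ℝ) 1, ∃ i, γ s ∈ U i ∧ ∀ᶠ t in 𝓝[Icc 0 1] s,
        f t * (φ i (γ t))⁻¹ = f s * (φ i (γ s))⁻¹) → cc (Λ' 0) * (cc (Λ' 1))⁻¹ = (f 0)⁻¹ * f 1 := by
    intro Λ' hΛ' γ hp f hf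
    have : f 0 * cc (Λ' 0) = f 1 * cc (Λ' 1) := by
      refine (isPreconnected_Icc (a := (0:ℝ)) (b := 1)).induction₂
        (fun a b => f a * cc (Λ' a) = f b * cc (Λ' b)) ?_ ?_ ?_ zero_mem_I one_mem_I
      · intro a ha
        obtain ⟨i, hi, he⟩ := hf a ha
        filter_upwards [he, mem_nhdsWithin_of_mem_nhds (lc Λ' hΛ' a i (by rw [hp a ha]; exact hi)),
          self_mem_nhdsWithin] with b h1 h2 hb
        rw [hp a ha, hp b hb] at h2
        calc f a * cc (Λ' a) = (f a * (φ i (γ a))⁻¹) * (φ i (γ a) * cc (Λ' a)) := by group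
          _ = (f b * (φ i (γ b))⁻¹) * (φ i (γ b) * cc (Λ' b)) := by rw [h1, h2]
          _ = _ := by group
      · intro x y z _ _ _ h1 h2; exact h1.trans h2
      · intro x y _ _ h1; exact h1.symm
    have e : cc (Λ' 0) = (f 0)⁻¹ * (f 1 * cc (Λ' 1)) := by rw [← this]; group
    rw [e]; group
  have uq : ∀ (Λ' Λ'' : ℝ → Z.TotalSpace), Continuous Λ' → Continuous Λ'' →
      (∀ s ∈ Icc (0:ℝ) 1, (Λ' s).1 = (Λ'' s).1) →
      cc (Λ' 0) * (cc (Λ' 1))⁻¹ = cc (Λ'' 0) * (cc (Λ'' 1))⁻¹ := by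
    intro Λ' Λ'' h1 h2 he
    have := cmp Λ' h1 (fun s => (Λ'' s).1) he (fun s => (cc (Λ'' s))⁻¹) (fun s hs => by
      refine ⟨_, hix _, ?_⟩
      filter_upwards [mem_nhdsWithin_of_mem_nhds (lc Λ'' h2 s _ (hix _))] with t ht
      rw [← mul_inv_rev, ht, mul_inv_rev])
    rw [this, inv_inv]
  refine ⟨{ h := fun γ => cc (Λ γ 0) * (cc (Λ γ 1))⁻¹, const := ?_, sq := ?_ }, ?_⟩
  · intro x _
    have c1 : ContinuousOn (fun _ : ℝ => x) (Icc 0 1) := continuousOn_const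
    have := cmp _ (hΛ _ c1).1 (fun _ => x) (fun s _ => (hΛ _ c1).2 s) (fun _ => 1)
      (fun s hs => ⟨ix x, hix x, by simp⟩)
    simpa using this
  · intro K hK
    let g : C(ℝ × ℝ, X) := ⟨fun p => K (cl p.1) (cl p.2), hK.cont.comp_continuous
      (f := fun p : ℝ × ℝ => (cl p.1, cl p.2))
      ((cl_cont.comp continuous_fst).prodMk (cl_cont.comp continuous_snd))
      fun p => ⟨cl_mem _, cl_mem _⟩⟩
    obtain ⟨F, hF, -⟩ := cov.existsUnique_continuousMap_lifts g (0, 0)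
      (⟨g (0, 0), (1 : Γ)⟩ : Z.TotalSpace) rfl
    have hp : ∀ s ∈ Icc (0:ℝ) 1, ∀ t ∈ Icc (0:ℝ) 1, (F (s, t)).1 = K s t := fun s hs t ht => by
      have := congrFun hF.2 (s, t)
      simp only [Function.comp, g, ContinuousMap.coe_mk, cl_eq hs, cl_eq ht] at this
      exact this
    have hv : ∀ γ, IsP univ γ → ∀ Λ' : ℝ → Z.TotalSpace, Continuous Λ' →
        (∀ s ∈ Icc (0:ℝ) 1, (Λ' s).1 = γ s) →
        cc (Λ γ 0) * (cc (Λ γ 1))⁻¹ = cc (Λ' 0) * (cc (Λ' 1))⁻¹ := fun γ hγ Λ' h1 h2 =>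
      uq _ _ (hΛ γ hγ.cont).1 h1 fun s hs => by rw [(hΛ γ hγ.cont).2, cl_eq hs, h2 s hs]
    have Fc := F.continuous
    rw [hv _ (hK.bot zero_mem_I) (fun s => F (s, 0)) (by fun_prop) (fun s hs => hp s hs 0 zero_mem_I),
      hv _ (hK.bot one_mem_I) (fun s => F (s, 1)) (by fun_prop) (fun s hs => hp s hs 1 one_mem_I),
      hv _ (hK.left zero_mem_I) (fun s => F (0, s)) (by fun_prop) (fun s hs => hp 0 zero_mem_I s hs),
      hv _ (hK.left one_mem_I) (fun s => F (1, s)) (by fun_prop) (fun s hs => hp 1 one_mem_I s hs)]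
    group
  · intro γ hγ f hf
    exact cmp _ (hΛ _ hγ.cont).1 γ (fun s hs => by rw [(hΛ _ hγ.cont).2, cl_eq hs]) f hf
end bundle
end JC

namespace JC
open Set Topology Filter

noncomputable def qq (z : ℂ) : ℤ := ⌊z.im / (2 * Real.pi) + 1 / 2⌋
noncomputable def kk (z : ℂ) : ℤ := ⌊z.im / (2 * Real.pi)⌋

lemma qq_add (z : ℂ) (q : ℤ) : qq (z + q * (2 * Real.pi * Complex.I)) = qq z + q := by
  unfold qq
  rw [← Int.floor_add_intCast]
  congr 1
  have := Real.pi_pos.ne'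
  simp; field_simp; ring

lemma kk_add (z : ℂ) (q : ℤ) : kk (z + q * (2 * Real.pi * Complex.I)) = kk z + q := by
  unfold kk
  rw [← Int.floor_add_intCast]
  congr 1
  have := Real.pi_pos.ne'
  simp; field_simp

lemma qq_zero : qq 0 = 0 := by
  unfold qq; rw [Int.floor_eq_iff]; norm_num

lemma ev_const {A : Type*} {l : Filter A} {f : A → ℂ} {c : ℂ} (hf : Tendsto f l (𝓝 c))
    (h1 : ∀ᶠ t in l, Complex.exp (f t) = 1) (hc : Complex.exp c = 1) : ∀ᶠ t in l, f t = c := by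
  have hd : ∀ᶠ t in l, dist (f t) c < 2 * Real.pi := hf.eventually (Metric.ball_mem_nhds c Real.two_pi_pos)
  filter_upwards [h1, hd] with t ht hd
  rw [← hc] at ht
  obtain ⟨q, hq⟩ := Complex.exp_eq_exp_iff_exists_int.mp ht
  rw [hq, dist_eq_norm, add_sub_cancel_left] at hd
  have : ‖(q:ℂ) * (2 * Real.pi * Complex.I)‖ = |(q:ℝ)| * (2 * Real.pi) := by
    simp [abs_of_pos Real.pi_pos]
  rw [this] at hd
  have h2 : |(q:ℝ)| < 1 := by
    by_contra hcon
    push Not at hcon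
    nlinarith [Real.pi_pos]
  have h3 : q = 0 := by
    rw [← Int.cast_abs] at h2
    have : |q| < 1 := by exact_mod_cast h2
    exact Int.abs_lt_one_iff.mp this
  rw [hq, h3]; simp

lemma ev_kk {A : Type*} {l : Filter A} {f : A → ℂ} {c : ℂ} (hf : Tendsto f l (𝓝 c))
    (hc : ∀ k : ℤ, c.im ≠ k * (2 * Real.pi)) : ∀ᶠ t in l, kk (f t) = kk c := by
  have hpi := Real.two_pi_pos
  have h1 : Tendsto (fun t => (f t).im / (2 * Real.pi)) l (𝓝 (c.im / (2 * Real.pi))) :=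
    ((Complex.continuous_im.tendsto c).comp hf).div_const _
  have h2 : (kk c : ℝ) < c.im / (2 * Real.pi) := by
    refine lt_of_le_of_ne (Int.floor_le _) fun he => hc (kk c) ?_
    rw [he]; field_simp
  have h3 : c.im / (2 * Real.pi) < (kk c : ℝ) + 1 := Int.lt_floor_add_one _
  filter_upwards [h1.eventually (lt_mem_nhds h2), h1.eventually (gt_mem_nhds h3)] with t a b
  exact Int.floor_eq_iff.mpr ⟨a.le, b⟩

/-- branch of the logarithm -/
noncomputable def lg (a z : ℂ) : ℂ := a + Complex.log (z * Complex.exp (-a))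

lemma exp_lg {a z : ℂ} (hz : z ≠ 0) : Complex.exp (lg a z) = z := by
  unfold lg
  rw [Complex.exp_add, Complex.exp_log (mul_ne_zero hz (Complex.exp_ne_zero _)), mul_comm z,
    ← mul_assoc, ← Complex.exp_add, add_neg_cancel, Complex.exp_zero, one_mul]

lemma lg_cont {a z : ℂ} (hz : z * Complex.exp (-a) ∈ Complex.slitPlane) : ContinuousAt (lg a) z := by
  unfold lg
  exact continuousAt_const.add ((continuousAt_id.mul continuousAt_const).clog hz)

section coc
variable {Γ : Type*} [Group Γ] (n m : ℕ) (w : ℤ → Γ) (ω Δ : Γ)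

def RR : Set (ℂ × ℂ) := {z | z.1 ≠ 0 ∧ ¬ ((z.2 ^ m / z.1 ^ n).im = 0 ∧ 1 ≤ (z.2 ^ m / z.1 ^ n).re)}
def LL : Set (ℂ × ℂ) := {z | z.2 ≠ 0 ∧ ¬ ((z.1 ^ n / z.2 ^ m).im = 0 ∧ 1 ≤ (z.1 ^ n / z.2 ^ m).re)}

lemma slit_open : IsOpen {x : ℂ | ¬ (x.im = 0 ∧ 1 ≤ x.re)} := by
  have c1 : IsClosed {x : ℂ | x.im = 0} := isClosed_eq Complex.continuous_im continuous_const
  have c2 : IsClosed {x : ℂ | 1 ≤ x.re} := isClosed_le continuous_const Complex.continuous_re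
  exact (c1.inter c2).isOpen_compl

lemma RR_open : IsOpen (RR n m) := by
  have c : ContinuousOn (fun z : ℂ × ℂ => z.2 ^ m / z.1 ^ n) {z | z.1 ≠ 0} :=
    ContinuousOn.div (by fun_prop) (by fun_prop) fun z hz => pow_ne_zero _ hz
  exact c.isOpen_inter_preimage (isOpen_ne_fun continuous_fst continuous_const) slit_open

lemma LL_open : IsOpen (LL n m) := by
  have c : ContinuousOn (fun z : ℂ × ℂ => z.1 ^ n / z.2 ^ m) {z | z.2 ≠ 0} :=
    ContinuousOn.div (by fun_prop) (by fun_prop) fun z hz => pow_ne_zero _ hz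
  exact c.isOpen_inter_preimage (isOpen_ne_fun continuous_snd continuous_const) slit_open

variable {n m}
lemma RL_cov (hn : 0 < n) (hm : 0 < m) {z : ℂ × ℂ} (hz : z.1 ^ n ≠ z.2 ^ m) : z ∈ RR n m ∨ z ∈ LL n m := by
  by_cases h1 : z.1 = 0
  · right
    have h2 : z.2 ≠ 0 := by
      intro h2; apply hz; rw [h1, h2, zero_pow hn.ne', zero_pow hm.ne']
    refine ⟨h2, ?_⟩
    rw [h1, zero_pow hn.ne', zero_div]; simp
  · by_cases h2 : z ∈ RR n m
    · exact Or.inl h2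
    · right
      obtain ⟨hi, hr⟩ := not_not.mp fun hc => h2 ⟨h1, hc⟩
      set t := (z.2 ^ m / z.1 ^ n).re with ht
      have e : z.2 ^ m / z.1 ^ n = (t : ℂ) := Complex.ext (by simp [ht]) (by simp [hi])
      have hz2 : z.2 ≠ 0 := by
        intro h0
        rw [h0, zero_pow hm.ne', zero_div] at e
        have : t = 0 := by exact_mod_cast e.symm
        linarith
      refine ⟨hz2, ?_⟩
      rintro ⟨-, hr'⟩
      have e' : z.1 ^ n / z.2 ^ m = ((t⁻¹ : ℝ) : ℂ) := by
        rw [Complex.ofReal_inv, ← e, inv_div]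
      rw [e', Complex.ofReal_re] at hr'
      have : t ≤ 1 := (one_le_inv₀ (by linarith)).mp hr'
      have : t = 1 := le_antisymm this hr
      rw [this, Complex.ofReal_one, div_eq_one_iff_eq (pow_ne_zero _ h1)] at e
      exact hz e.symm

lemma RL_im {z : ℂ × ℂ} (hR : z ∈ RR n m) (hL : z ∈ LL n m) {σ ρ : ℂ} (hσ : Complex.exp σ = z.1)
    (hρ : Complex.exp ρ = z.2) (k : ℤ) : (m * ρ - n * σ).im ≠ k * (2 * Real.pi) := by
  intro he
  have e1 : z.2 ^ m / z.1 ^ n = Complex.exp (m * ρ - n * σ) := by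
    rw [Complex.exp_sub, Complex.exp_nat_mul, Complex.exp_nat_mul, hσ, hρ]
  have e2 : Complex.exp (m * ρ - n * σ) = ((Real.exp (m * ρ - n * σ).re : ℝ) : ℂ) := by
    conv_lhs => rw [← Complex.re_add_im (m * ρ - n * σ), he]
    rw [Complex.exp_add, Complex.ofReal_exp]
    have : Complex.exp (((k * (2 * Real.pi) : ℝ) : ℂ) * Complex.I) = 1 := by
      rw [Complex.exp_eq_one_iff]; exact ⟨k, by push_cast; ring⟩
    rw [this, mul_one]
  have ht := Real.exp_pos (m * ρ - n * σ).re
  generalize Real.exp (m * ρ - n * σ).re = t at e2 ht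
  rw [e2] at e1
  rcases le_total 1 t with h | h
  · exact hR.2 (by rw [e1]; simpa using h)
  · apply hL.2
    have : z.1 ^ n / z.2 ^ m = ((t⁻¹ : ℝ) : ℂ) := by rw [Complex.ofReal_inv, ← e1, inv_div]
    rw [this]
    refine ⟨Complex.ofReal_im _, ?_⟩
    rw [Complex.ofReal_re]; exact (one_le_inv₀ ht).mpr h

variable (n m)
noncomputable def fR (z : ℂ × ℂ) (σ : ℂ) : Γ := ω ^ qq (σ - Complex.log z.1)
open Classical in
noncomputable def fL (z : ℂ × ℂ) (ρ : ℂ) : Γ :=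
  if z ∈ RR n m then w (kk (m * ρ - n * Complex.log z.1)) else Δ ^ qq (ρ - Complex.log z.2)
variable {n m}

lemma fR_add (z : ℂ × ℂ) (σ : ℂ) (q : ℤ) :
    fR ω z (σ + q * (2 * Real.pi * Complex.I)) = ω ^ q * fR ω z σ := by
  unfold fR
  rw [add_sub_right_comm, qq_add, add_comm, zpow_add]

lemma fR_self {z : ℂ × ℂ} {σ : ℂ} (hσ : σ = Complex.log z.1) : fR ω z σ = 1 := by
  unfold fR; rw [hσ, sub_self, qq_zero, zpow_zero]

variable {w ω Δ} (hwn : ∀ k, w (k + n) = w k * ω) (hwm : ∀ k, w (k + m) = Δ * w k)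
include hwn in
lemma w_n (k q : ℤ) : w (k + n * q) = w k * ω ^ q := by
  induction q using Int.induction_on with
  | zero => simp
  | succ i ih => rw [mul_add, mul_one, ← add_assoc, hwn, ih, mul_assoc, zpow_add_one]
  | pred i ih =>
    have := hwn (k + n * (-i - 1))
    rw [show k + n * (-i - 1) + n = k + n * (-(i:ℤ)) by ring, ih] at this
    rw [zpow_sub_one, ← mul_assoc, this]; simp

include hwm in
lemma w_m (k q : ℤ) : w (k + m * q) = Δ ^ q * w k := by
  induction q using Int.induction_on with
  | zero => simp
  | succ i ih =>
    rw [mul_add, mul_one, ← add_assoc, hwm, ih, add_comm (i:ℤ) 1, zpow_add, mul_assoc, zpow_one]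
  | pred i ih =>
    have := hwm (k + m * (-i - 1))
    rw [show k + m * (-i - 1) + m = k + m * (-(i:ℤ)) by ring, ih] at this
    rw [sub_eq_neg_add, zpow_add, mul_assoc, this, ← sub_eq_neg_add]; simp

include hwm in
lemma fL_add (z : ℂ × ℂ) (ρ : ℂ) (q : ℤ) :
    fL n m w Δ z (ρ + q * (2 * Real.pi * Complex.I)) = Δ ^ q * fL n m w Δ z ρ := by
  unfold fL
  split_ifs with hR
  · rw [← w_m hwm, show kk (m * ρ - n * Complex.log z.1) + m * q =
      kk (m * ρ - n * Complex.log z.1) + ((m * q : ℤ)) from rfl, ← kk_add]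
    congr 2
    push_cast; ring
  · rw [add_sub_right_comm, qq_add, add_comm, zpow_add]

include hwn in
lemma fL_fR {z : ℂ × ℂ} (hz : z ∈ RR n m) {σ : ℂ} (hσ : Complex.exp σ = z.1) (ρ : ℂ) :
    fL n m w Δ z ρ = w (kk (m * ρ - n * σ)) * fR ω z σ := by
  rw [← Complex.exp_log hz.1] at hσ
  obtain ⟨q, rfl⟩ := Complex.exp_eq_exp_iff_exists_int.mp hσ
  rw [fR_add, fR_self ω rfl, mul_one, ← w_n hwn]
  unfold fL
  rw [if_pos hz]
  congr 1
  rw [show kk (m * ρ - n * (Complex.log z.1 + q * (2 * Real.pi * Complex.I))) + n * q =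
    kk (m * ρ - n * (Complex.log z.1 + q * (2 * Real.pi * Complex.I))) + ((n * q : ℤ)) from rfl, ← kk_add]
  congr 1
  push_cast; ring

section lims
variable {A : Type*} {l : Filter A} {z : A → ℂ × ℂ} {z0 : ℂ × ℂ}

lemma lim_RR {σ σ' : A → ℂ} {σ0 σ0' : ℂ} (h1 : ∀ᶠ t in l, Complex.exp (σ t) = (z t).1)
    (h2 : ∀ᶠ t in l, Complex.exp (σ' t) = (z t).1) (h3 : Tendsto σ l (𝓝 σ0)) (h4 : Tendsto σ' l (𝓝 σ0'))
    (h5 : Complex.exp σ0 = z0.1) (h6 : Complex.exp σ0' = z0.1) :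
    ∀ᶠ t in l, fR ω (z t) (σ t) * (fR ω (z t) (σ' t))⁻¹ = fR ω z0 σ0 * (fR ω z0 σ0')⁻¹ := by
  obtain ⟨q, hq⟩ := Complex.exp_eq_exp_iff_exists_int.mp (h5.trans h6.symm)
  have := ev_const (h3.sub h4) (by
    filter_upwards [h1, h2] with t a b
    rw [Complex.exp_sub, a, b, div_self]
    rw [← a]; exact Complex.exp_ne_zero _) (by
      rw [Complex.exp_sub, h5, h6, div_self]; rw [← h5]; exact Complex.exp_ne_zero _)
  filter_upwards [this] with t ht
  have e : σ t = σ' t + q * (2 * Real.pi * Complex.I) := by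
    rw [hq] at ht; linear_combination ht
  rw [e, hq, fR_add, fR_add]; group

include hwm in
lemma lim_LL {σ σ' : A → ℂ} {σ0 σ0' : ℂ} (h1 : ∀ᶠ t in l, Complex.exp (σ t) = (z t).2)
    (h2 : ∀ᶠ t in l, Complex.exp (σ' t) = (z t).2) (h3 : Tendsto σ l (𝓝 σ0)) (h4 : Tendsto σ' l (𝓝 σ0'))
    (h5 : Complex.exp σ0 = z0.2) (h6 : Complex.exp σ0' = z0.2) :
    ∀ᶠ t in l, fL n m w Δ (z t) (σ t) * (fL n m w Δ (z t) (σ' t))⁻¹ =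
      fL n m w Δ z0 σ0 * (fL n m w Δ z0 σ0')⁻¹ := by
  obtain ⟨q, hq⟩ := Complex.exp_eq_exp_iff_exists_int.mp (h5.trans h6.symm)
  have := ev_const (h3.sub h4) (by
    filter_upwards [h1, h2] with t a b
    rw [Complex.exp_sub, a, b, div_self]
    rw [← a]; exact Complex.exp_ne_zero _) (by
      rw [Complex.exp_sub, h5, h6, div_self]; rw [← h5]; exact Complex.exp_ne_zero _)
  filter_upwards [this] with t ht
  have e : σ t = σ' t + q * (2 * Real.pi * Complex.I) := by
    rw [hq] at ht; linear_combination ht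
  rw [e, hq, fL_add hwm, fL_add hwm]; group

include hwn in
lemma lim_LR {σ ρ : A → ℂ} {σ0 ρ0 : ℂ} (h1 : ∀ᶠ t in l, Complex.exp (σ t) = (z t).1)
    (h3 : Tendsto σ l (𝓝 σ0)) (h4 : Tendsto ρ l (𝓝 ρ0))
    (h5 : Complex.exp σ0 = z0.1) (h6 : Complex.exp ρ0 = z0.2) (hz : ∀ᶠ t in l, z t ∈ RR n m)
    (hR : z0 ∈ RR n m) (hL : z0 ∈ LL n m) :
    ∀ᶠ t in l, fL n m w Δ (z t) (ρ t) * (fR ω (z t) (σ t))⁻¹ = fL n m w Δ z0 ρ0 * (fR ω z0 σ0)⁻¹ := by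
  have := ev_kk (f := fun t => m * ρ t - n * σ t) ((h4.const_mul _).sub (h3.const_mul _)) (RL_im hR hL h5 h6)
  filter_upwards [this, h1, hz] with t a b c
  rw [fL_fR hwn c b, fL_fR hwn hR h5, a]; group
end lims
end coc
end JC

namespace JC
open Set Topology Filter

section coc2
variable {Γ : Type*} [Group Γ] {n m : ℕ} {w : ℤ → Γ} {ω Δ : Γ}

theorem cocHol (hn : 0 < n) (hm : 0 < m) (hwn : ∀ k, w (k + n) = w k * ω)
    (hwm : ∀ k, w (k + m) = Δ * w k) :
    ∃ h : Hol {p : ℂ × ℂ | p.1 ^ n ≠ p.2 ^ m} Γ,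
      (∀ γ, IsP {p : ℂ × ℂ | p.1 ^ n ≠ p.2 ^ m} γ → (∀ s ∈ Icc (0:ℝ) 1, γ s ∈ RR n m) → ∀ σ : ℝ → ℂ,
        ContinuousOn σ (Icc 0 1) → (∀ s ∈ Icc (0:ℝ) 1, Complex.exp (σ s) = (γ s).1) →
        h.h γ = (fR ω (γ 0) (σ 0))⁻¹ * fR ω (γ 1) (σ 1)) ∧
      (∀ γ, IsP {p : ℂ × ℂ | p.1 ^ n ≠ p.2 ^ m} γ → (∀ s ∈ Icc (0:ℝ) 1, γ s ∈ LL n m) → ∀ σ : ℝ → ℂ,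
        ContinuousOn σ (Icc 0 1) → (∀ s ∈ Icc (0:ℝ) 1, Complex.exp (σ s) = (γ s).2) →
        h.h γ = (fL n m w Δ (γ 0) (σ 0))⁻¹ * fL n m w Δ (γ 1) (σ 1)) := by
  classical
  set Sx : Set (ℂ × ℂ) := {p : ℂ × ℂ | p.1 ^ n ≠ p.2 ^ m} with hSx
  let U : ℂ ⊕ ℂ → Set Sx := fun i => match i with
    | Sum.inl a => {z | z.1 ∈ RR n m ∧ z.1.1 * Complex.exp (-a) ∈ Complex.slitPlane}
    | Sum.inr a => {z | z.1 ∈ LL n m ∧ z.1.2 * Complex.exp (-a) ∈ Complex.slitPlane}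
  let φ : ℂ ⊕ ℂ → Sx → Γ := fun i z => match i with
    | Sum.inl a => fR ω z.1 (lg a z.1.1)
    | Sum.inr a => fL n m w Δ z.1 (lg a z.1.2)
  have c1 : Continuous fun z : Sx => z.1.1 := continuous_fst.comp continuous_subtype_val
  have c2 : Continuous fun z : Sx => z.1.2 := continuous_snd.comp continuous_subtype_val
  have hU : ∀ i, IsOpen (U i) := by
    rintro (a | a)
    · exact ((RR_open n m).preimage continuous_subtype_val).inter
        (Complex.isOpen_slitPlane.preimage (c1.mul continuous_const))
    · exact ((LL_open n m).preimage continuous_subtype_val).inter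
        (Complex.isOpen_slitPlane.preimage (c2.mul continuous_const))
  have slit : ∀ z : ℂ, z ≠ 0 → z * Complex.exp (-Complex.log z) ∈ Complex.slitPlane := fun z hz => by
    rw [Complex.exp_neg, Complex.exp_log hz, mul_inv_cancel₀ hz]; exact Complex.one_mem_slitPlane
  have slit' : ∀ z σ : ℂ, Complex.exp σ = z → z * Complex.exp (-σ) ∈ Complex.slitPlane := fun z σ hz => by
    rw [← hz, ← Complex.exp_add, add_neg_cancel, Complex.exp_zero]; exact Complex.one_mem_slitPlane
  have hcov : ∀ x, ∃ i, x ∈ U i := fun x => by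
    rcases RL_cov hn hm x.2 with h | h
    · exact ⟨Sum.inl (Complex.log x.1.1), h, slit _ h.1⟩
    · exact ⟨Sum.inr (Complex.log x.1.2), h, slit _ h.1⟩
  have t1 : ∀ (x : Sx) (a : ℂ), x ∈ U (Sum.inl a) → Tendsto (fun y : Sx => lg a y.1.1) (𝓝 x) (𝓝 (lg a x.1.1)) :=
    fun x a hx => (lg_cont hx.2).tendsto.comp c1.continuousAt
  have t2 : ∀ (x : Sx) (a : ℂ), x ∈ U (Sum.inr a) → Tendsto (fun y : Sx => lg a y.1.2) (𝓝 x) (𝓝 (lg a x.1.2)) :=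
    fun x a hx => (lg_cont hx.2).tendsto.comp c2.continuousAt
  have e1 : ∀ (x : Sx) (a : ℂ), x ∈ U (Sum.inl a) → ∀ᶠ y : Sx in 𝓝 x, Complex.exp (lg a y.1.1) = y.1.1 :=
    fun x a hx => by
      filter_upwards [(hU (Sum.inl a)).mem_nhds hx] with y hy
      exact exp_lg hy.1.1
  have e2 : ∀ (x : Sx) (a : ℂ), x ∈ U (Sum.inr a) → ∀ᶠ y : Sx in 𝓝 x, Complex.exp (lg a y.1.2) = y.1.2 :=
    fun x a hx => by
      filter_upwards [(hU (Sum.inr a)).mem_nhds hx] with y hy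
      exact exp_lg hy.1.1
  have lr : ∀ (x : Sx) (a b : ℂ), x ∈ U (Sum.inl a) → x ∈ U (Sum.inr b) → ∀ᶠ y : Sx in 𝓝 x,
      φ (Sum.inr b) y * (φ (Sum.inl a) y)⁻¹ = φ (Sum.inr b) x * (φ (Sum.inl a) x)⁻¹ := by
    intro x a b ha hb
    exact lim_LR (z := fun y : Sx => y.1) hwn (e1 x a ha) (t1 x a ha) (t2 x b hb) (exp_lg ha.1.1)
      (exp_lg hb.1.1) (((RR_open n m).preimage continuous_subtype_val).mem_nhds ha.1) ha.1 hb.1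
  obtain ⟨h, hh⟩ := bundleHol U hU hcov φ (by
    rintro (a | a) (b | b) x ⟨hx, hx'⟩
    · exact lim_RR (z := fun y : Sx => y.1) (e1 x b hx') (e1 x a hx) (t1 x b hx') (t1 x a hx)
        (exp_lg hx.1.1) (exp_lg hx.1.1)
    · exact lr x a b hx hx'
    · filter_upwards [lr x b a hx' hx] with y hy
      have := congrArg (·⁻¹) hy
      simpa using this
    · exact lim_LL hwm (z := fun y : Sx => y.1) (e2 x b hx') (e2 x a hx) (t2 x b hx') (t2 x a hx)
        (exp_lg hx.1.1) (exp_lg hx.1.1))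
  have p0 : ((1:ℂ), (0:ℂ)) ∈ Sx := by simp [Sx, hm.ne']
  let F : ℂ × ℂ → Sx := fun z => if hz : z ∈ Sx then ⟨z, hz⟩ else ⟨_, p0⟩
  have hF : ∀ z ∈ Sx, (F z).1 = z := fun z hz => by simp [F, hz]
  have Fc : ContinuousOn F Sx := by
    rw [continuousOn_iff_continuous_restrict]
    convert continuous_id using 1
    funext z; simp [F]
  refine ⟨h.comap F Fc (mapsTo_univ _ _), fun γ hγ hR σ hσ hσe => ?_, fun γ hγ hR σ hσ hσe => ?_⟩
  · have hp : IsP univ (fun s => F (γ s)) := ⟨Fc.comp hγ.cont hγ.mem, fun _ _ => trivial⟩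
    have := hh _ hp (fun t => fR ω (γ t) (σ t)) (fun s hs => by
      have hFs : ∀ t ∈ Icc (0:ℝ) 1, (F (γ t)).1 = γ t := fun t ht => hF _ (hγ.mem t ht)
      have hUs : F (γ s) ∈ U (Sum.inl (σ s)) := by
        refine ⟨by rw [hFs s hs]; exact hR s hs, ?_⟩
        rw [hFs s hs]; exact slit' _ _ (hσe s hs)
      refine ⟨Sum.inl (σ s), hUs, ?_⟩
      have hT : Tendsto (fun t => F (γ t)) (𝓝[Icc 0 1] s) (𝓝 (F (γ s))) := hp.cont s hs
      have := lim_RR (ω := ω) (z := γ) (z0 := γ s) (l := 𝓝[Icc 0 1] s) (σ := σ)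
        (σ' := fun t => lg (σ s) (F (γ t)).1.1) (σ0' := lg (σ s) (F (γ s)).1.1)
        (by filter_upwards [self_mem_nhdsWithin] with t ht using hσe t ht)
        (by
          filter_upwards [self_mem_nhdsWithin, hT.eventually (e1 _ _ hUs)] with t ht h1
          rw [h1, hFs t ht]) (hσ s hs) ((t1 _ _ hUs).comp hT) (hσe s hs)
        (by rw [hFs s hs]; exact exp_lg (hR s hs).1)
      filter_upwards [this, self_mem_nhdsWithin] with t ht htI
      simp only [φ]
      rw [hFs s hs, hFs t htI] at ht ⊢
      exact ht)
    exact this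
  · have hp : IsP univ (fun s => F (γ s)) := ⟨Fc.comp hγ.cont hγ.mem, fun _ _ => trivial⟩
    have := hh _ hp (fun t => fL n m w Δ (γ t) (σ t)) (fun s hs => by
      have hFs : ∀ t ∈ Icc (0:ℝ) 1, (F (γ t)).1 = γ t := fun t ht => hF _ (hγ.mem t ht)
      have hUs : F (γ s) ∈ U (Sum.inr (σ s)) := by
        refine ⟨by rw [hFs s hs]; exact hR s hs, ?_⟩
        rw [hFs s hs]; exact slit' _ _ (hσe s hs)
      refine ⟨Sum.inr (σ s), hUs, ?_⟩
      have hT : Tendsto (fun t => F (γ t)) (𝓝[Icc 0 1] s) (𝓝 (F (γ s))) := hp.cont s hs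
      have := lim_LL (n := n) hwm (z := γ) (z0 := γ s) (l := 𝓝[Icc 0 1] s) (σ := σ)
        (σ' := fun t => lg (σ s) (F (γ t)).1.2) (σ0' := lg (σ s) (F (γ s)).1.2)
        (by filter_upwards [self_mem_nhdsWithin] with t ht using hσe t ht)
        (by
          filter_upwards [self_mem_nhdsWithin, hT.eventually (e2 _ _ hUs)] with t ht h1
          rw [h1, hFs t ht]) (hσ s hs) ((t2 _ _ hUs).comp hT) (hσe s hs)
        (by rw [hFs s hs]; exact exp_lg (hR s hs).1)
      filter_upwards [this, self_mem_nhdsWithin] with t ht htI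
      simp only [φ]
      rw [hFs s hs, hFs t htI] at ht ⊢
      exact ht)
    exact this
end coc2
end JC

namespace JC
open Set Topology Filter

lemma mem_RR {n m : ℕ} {z : ℂ × ℂ} (h1 : z.1 ≠ 0) (hz : z.1 ^ n ≠ z.2 ^ m) (hle : ‖z.2 ^ m‖ ≤ ‖z.1 ^ n‖) :
    z ∈ RR n m := by
  refine ⟨h1, ?_⟩
  rintro ⟨hi, hr⟩
  have hne : z.1 ^ n ≠ 0 := pow_ne_zero _ h1
  have hno : ‖z.2 ^ m / z.1 ^ n‖ ≤ 1 := by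
    rw [norm_div]; exact div_le_one_of_le₀ hle (norm_nonneg _)
  have hre := (Complex.re_le_norm (z.2 ^ m / z.1 ^ n)).trans hno
  have : z.2 ^ m / z.1 ^ n = 1 := Complex.ext (by simpa using le_antisymm hre hr) (by simpa using hi)
  rw [div_eq_one_iff_eq hne] at this
  exact hz this.symm

lemma mem_LL {n m : ℕ} {z : ℂ × ℂ} (h1 : z.2 ≠ 0) (hz : z.1 ^ n ≠ z.2 ^ m) (hle : ‖z.1 ^ n‖ ≤ ‖z.2 ^ m‖) :
    z ∈ LL n m := by
  have := mem_RR (n := m) (m := n) (z := (z.2, z.1)) h1 hz.symm hle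
  exact this

namespace Dat
variable (D : Dat)

/-- the map to the model space -/
noncomputable def Ps (z : ℂ × ℂ × ℂ) : ℂ × ℂ := (vp D.α D.e z.1 z.2.2, vp D.β D.μ z.2.1 z.2.2)

lemma Ps_cont : Continuous D.Ps := by
  unfold Ps vp gp; fun_prop

lemma Ps_mem : MapsTo D.Ps D.S {p : ℂ × ℂ | p.1 ^ Finset.univ.gcd D.e ≠ p.2 ^ Finset.univ.gcd D.μ} := by
  intro z hz
  simp only [S, mem_setOf_eq, vp_pow] at hz
  exact hz

lemma vp_inf (x : ℂ) : vp D.α D.e x 0 = x ^ (D.d / Finset.univ.gcd D.e) := by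
  unfold vp
  rw [gp_zero]
  congr 1
  refine (Nat.div_eq_of_eq_mul_left D.swap.gcd_pos ?_).symm
  change D.d = _ * Finset.univ.gcd D.e
  rw [Finset.sum_mul, ← D.hdg]
  exact Finset.sum_congr rfl fun i hi => (Nat.div_mul_cancel (Finset.gcd_dvd hi)).symm

lemma Ps_inf (x y : ℂ) : D.Ps (x, y, 0) =
    (x ^ (D.d / Finset.univ.gcd D.e), y ^ (D.d / Finset.univ.gcd D.μ)) := by
  have := D.swap.vp_inf y
  simp only [Ps, vp_inf]
  congr 1

lemma e_mul : Finset.univ.gcd D.e * (D.d / Finset.univ.gcd D.e) = D.d :=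
  Nat.mul_div_cancel' D.swap.gcd_dvd_d
lemma m_mul : Finset.univ.gcd D.μ * (D.d / Finset.univ.gcd D.μ) = D.d :=
  Nat.mul_div_cancel' D.gcd_dvd_d

lemma Ps_pow (x y : ℂ) : (D.Ps (x, y, 0)).1 ^ Finset.univ.gcd D.e = x ^ D.d ∧
    (D.Ps (x, y, 0)).2 ^ Finset.univ.gcd D.μ = y ^ D.d := by
  rw [Ps_inf]
  simp only [← pow_mul]
  rw [mul_comm, e_mul, mul_comm, m_mul]; exact ⟨rfl, rfl⟩

lemma norm_P1 {θ a : ℝ} (ha : a ≤ 1) : ‖(P θ a).1‖ = 1 - a := by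
  simp only [P]
  rw [norm_mul, Complex.norm_exp_ofReal_mul_I, mul_one, Complex.norm_real, Real.norm_of_nonneg (by linarith)]
lemma norm_P2 {θ a : ℝ} (ha : 0 ≤ a) : ‖(P θ a).2.1‖ = a := by
  simp only [P]
  rw [norm_mul, Complex.norm_exp_ofReal_mul_I, mul_one, Complex.norm_real, Real.norm_of_nonneg ha]

lemma inf_RR {x y : ℂ} (hx : x ≠ 0) (hle : ‖y‖ ≤ ‖x‖) (hS : (x, y, 0) ∈ D.S) :
    D.Ps (x, y, 0) ∈ RR (Finset.univ.gcd D.e) (Finset.univ.gcd D.μ) := by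
  have := D.Ps_pow x y
  refine mem_RR (by rw [Ps_inf]; exact pow_ne_zero _ hx) (D.Ps_mem hS) ?_
  rw [this.1, this.2, norm_pow, norm_pow]
  exact pow_le_pow_left₀ (norm_nonneg _) hle _

lemma inf_LL {x y : ℂ} (hy : y ≠ 0) (hle : ‖x‖ ≤ ‖y‖) (hS : (x, y, 0) ∈ D.S) :
    D.Ps (x, y, 0) ∈ LL (Finset.univ.gcd D.e) (Finset.univ.gcd D.μ) := by
  have := D.Ps_pow x y
  refine mem_LL (by rw [Ps_inf]; exact pow_ne_zero _ hy) (D.Ps_mem hS) ?_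
  rw [this.1, this.2, norm_pow, norm_pow]
  exact pow_le_pow_left₀ (norm_nonneg _) hle _

theorem thmC {Γ : Type*} [Group Γ] {w : ℤ → Γ} {ω Δ : Γ}
    (hwn : ∀ k, w (k + (Finset.univ.gcd D.e : ℕ)) = w k * ω)
    (hwm : ∀ k, w (k + (Finset.univ.gcd D.μ : ℕ)) = Δ * w k) :
    ∃ ψ : Hol D.S Γ, (∀ j, ψ.h (P (D.th j)) = (w j)⁻¹) ∧
      ∀ k : ℤ, ψ.h (fun t => (Complex.exp ((t : ℂ) * (k * (2 * Real.pi * Complex.I))), 0, 0)) =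
        ω ^ (k * (D.d / Finset.univ.gcd D.e : ℕ)) := by
  have hn := D.swap.gcd_pos
  have hm := D.gcd_pos
  have en := D.e_mul
  have em := D.m_mul
  have ir := @D.inf_RR
  have il := @D.inf_LL
  have pin := D.Ps_inf
  have hmp := D.Ps_mem
  change 0 < Finset.univ.gcd D.e at hn
  obtain ⟨h, hR, hL⟩ := cocHol (Γ := Γ) hn hm hwn hwm
  generalize hN : Finset.univ.gcd D.e = n at *
  generalize hM : Finset.univ.gcd D.μ = m at *
  set q := D.d / n with hq
  set q' := D.d / m with hq'
  let ψ : Hol D.S Γ := Hol.comap h D.Ps D.Ps_cont.continuousOn hmp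
  have hψ : ∀ γ, ψ.h γ = h.h (fun s => D.Ps (γ s)) := fun γ => rfl
  refine ⟨ψ, fun j => ?_, fun k => ?_⟩
  · have hP := D.P_isP (D.th_good j)
    set θ := D.th j with hθ
    have hsub := ψ.sub convex_I hP.cont hP.mem (a := 0) (b := 1/2) (c := 1) (by norm_num) (by norm_num) (by norm_num)
    have eR : P θ = fun s : ℝ => P θ (0 + s * (1 - 0)) := by funext s; congr 1; ring
    rw [eR, ← hsub]
    have pP : ∀ a, P θ a = ((P θ a).1, (P θ a).2.1, 0) := fun a => rfl
    have i1 : ∀ s ∈ Icc (0:ℝ) 1, 0 + s * (1/2 - 0) ∈ Icc (0:ℝ) (1/2) := fun s hs =>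
      ⟨by linarith [hs.1], by linarith [hs.2]⟩
    have i2 : ∀ s ∈ Icc (0:ℝ) 1, 1/2 + s * (1 - 1/2) ∈ Icc (1/2:ℝ) 1 := fun s hs =>
      ⟨by linarith [hs.1], by linarith [hs.2]⟩
    have memR : ∀ a ∈ Icc (0:ℝ) (1/2), D.Ps (P θ a) ∈ RR n m := fun a ha => by
      have := hP.mem a ⟨ha.1, by linarith [ha.2]⟩
      rw [pP] at this ⊢
      refine ir ?_ ?_ this
      · rw [← norm_pos_iff, norm_P1 (by linarith [ha.2])]; linarith [ha.2]
      · rw [norm_P1 (by linarith [ha.2]), norm_P2 ha.1]; linarith [ha.2]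
    have memL : ∀ a ∈ Icc (1/2:ℝ) 1, D.Ps (P θ a) ∈ LL n m := fun a ha => by
      have := hP.mem a ⟨by linarith [ha.1], ha.2⟩
      rw [pP] at this ⊢
      refine il ?_ ?_ this
      · rw [← norm_pos_iff, norm_P2 (by linarith [ha.1])]; linarith [ha.1]
      · rw [norm_P1 (by linarith [ha.2]), norm_P2 (by linarith [ha.1])]; linarith [ha.1]
    let σ : ℝ → ℂ := fun a => q * ((Real.log (1 - a) : ℝ) + ((-θ * a : ℝ) : ℂ) * Complex.I)
    let ρ : ℝ → ℂ := fun a => q' * ((Real.log a : ℝ) + ((θ * (1 - a) : ℝ) : ℂ) * Complex.I)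
    have eσ : ∀ a < 1, Complex.exp (σ a) = (D.Ps (P θ a)).1 := fun a ha => by
      rw [pP, pin]
      simp only [σ, P]
      rw [Complex.exp_nat_mul, Complex.exp_add, ← Complex.ofReal_exp, Real.exp_log (by linarith)]
    have eρ : ∀ a > 0, Complex.exp (ρ a) = (D.Ps (P θ a)).2 := fun a ha => by
      rw [pP, pin]
      simp only [ρ, P]
      rw [Complex.exp_nat_mul, Complex.exp_add, ← Complex.ofReal_exp, Real.exp_log (by linarith)]
    have cσ : ContinuousOn σ (Icc 0 (1/2)) := by
      refine continuousOn_const.mul (ContinuousOn.add ?_ (by fun_prop))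
      refine Complex.continuous_ofReal.comp_continuousOn (ContinuousOn.log (by fun_prop) ?_)
      intro x hx; linarith [hx.2]
    have cρ : ContinuousOn ρ (Icc (1/2) 1) := by
      refine continuousOn_const.mul (ContinuousOn.add ?_ (by fun_prop))
      refine Complex.continuous_ofReal.comp_continuousOn (ContinuousOn.log (by fun_prop) ?_)
      intro x hx; linarith [hx.1]
    have H1 := hR (fun s => D.Ps (P θ (0 + s * (1/2 - 0))))
      ⟨D.Ps_cont.comp_continuousOn (hP.cont.comp (by fun_prop) fun s hs => ⟨(i1 s hs).1, by linarith [(i1 s hs).2]⟩),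
        fun s hs => hmp (hP.mem _ ⟨(i1 s hs).1, by linarith [(i1 s hs).2]⟩)⟩
      (fun s hs => memR _ (i1 s hs)) (fun s => σ (0 + s * (1/2 - 0))) (cσ.comp (by fun_prop) i1)
      (fun s hs => eσ _ (by linarith [(i1 s hs).2]))
    have H2 := hL (fun s => D.Ps (P θ (1/2 + s * (1 - 1/2))))
      ⟨D.Ps_cont.comp_continuousOn (hP.cont.comp (by fun_prop) fun s hs => ⟨by linarith [(i2 s hs).1], (i2 s hs).2⟩),
        fun s hs => hmp (hP.mem _ ⟨by linarith [(i2 s hs).1], (i2 s hs).2⟩)⟩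
      (fun s hs => memL _ (i2 s hs)) (fun s => ρ (1/2 + s * (1 - 1/2))) (cρ.comp (by fun_prop) i2)
      (fun s hs => eρ _ (by linarith [(i2 s hs).1]))
    have a1 : (0 + 0 * (1/2 - 0) : ℝ) = 0 := by norm_num
    have a2 : (0 + 1 * (1/2 - 0) : ℝ) = 1/2 := by norm_num
    have a3 : (1/2 + 0 * (1 - 1/2) : ℝ) = 1/2 := by norm_num
    have a4 : (1/2 + 1 * (1 - 1/2) : ℝ) = 1 := by norm_num
    rw [a1, a2] at H1
    rw [a3, a4] at H2
    rw [hψ, hψ, H1, H2]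
    have b1 : fR ω (D.Ps (P θ 0)) (σ 0) = 1 := by
      apply fR_self
      rw [P_zero, pin]; simp [σ]
    have b2 : fL n m w Δ (D.Ps (P θ 1)) (ρ 1) = 1 := by
      have hq0 : q ≠ 0 := by
        intro h0; rw [h0, mul_zero] at en; exact D.hd.ne en
      have : D.Ps (P θ 1) = (0, 1) := by rw [P_one, pin]; simp [hq0]
      rw [this]
      unfold fL
      rw [if_neg (fun hc => hc.1 rfl)]
      simp [ρ, qq_zero]
    have b3 := fL_fR (Δ := Δ) hwn (memR (1/2) (by norm_num)) (eσ (1/2) (by norm_num)) (ρ (1/2))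
    have b4 : kk (m * ρ (1/2) - n * σ (1/2)) = j := by
      have hd0 : (D.d : ℝ) ≠ 0 := by exact_mod_cast D.hd.ne'
      have c1 : (m : ℂ) * q' = D.d := by exact_mod_cast em
      have c2 : (n : ℂ) * q = D.d := by exact_mod_cast en
      have : (m * ρ (1/2) - n * σ (1/2) : ℂ) = (((2 * j + 1) * Real.pi : ℝ) : ℂ) * Complex.I := by
        simp only [ρ, σ]
        rw [← mul_assoc, ← mul_assoc, c1, c2, show (1 - 1/2 : ℝ) = 1/2 by norm_num, ← mul_sub]
        have : θ = (2 * j + 1) * Real.pi / D.d := rfl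
        have h3 : ((2 * j + 1) * Real.pi : ℝ) = D.d * θ := by rw [this]; field_simp
        rw [h3]
        push_cast; ring
      rw [this]
      unfold kk
      have hpi := Real.pi_pos
      rw [Int.floor_eq_iff, Complex.im_ofReal_mul, Complex.I_im]
      constructor
      · rw [le_div_iff₀ (by positivity)]; nlinarith
      · rw [div_lt_iff₀ (by positivity)]; nlinarith
    rw [b1, b2, b3, b4]; group
  · rw [hψ]
    have hS : ∀ t : ℝ, (Complex.exp ((t : ℂ) * (k * (2 * Real.pi * Complex.I))), (0:ℂ), (0:ℂ)) ∈ D.S := fun t => by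
      rw [D.mem_S_inf, zero_pow D.hd.ne']; exact pow_ne_zero _ (Complex.exp_ne_zero _)
    have H := hR (fun t => D.Ps (Complex.exp ((t : ℂ) * (k * (2 * Real.pi * Complex.I))), (0:ℂ), (0:ℂ)))
      ⟨(D.Ps_cont.comp (by fun_prop)).continuousOn, fun t _ => hmp (hS t)⟩
      (fun t _ => ir (Complex.exp_ne_zero _) (by simp) (hS t))
      (fun t => q * ((t : ℂ) * (k * (2 * Real.pi * Complex.I)))) (by fun_prop) (fun t _ => by
        rw [pin, Complex.exp_nat_mul])
    rw [H]
    have e0 : fR ω (D.Ps (Complex.exp (((0:ℝ) : ℂ) * (k * (2 * Real.pi * Complex.I))), (0:ℂ), (0:ℂ)))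
      (q * (((0:ℝ) : ℂ) * (k * (2 * Real.pi * Complex.I)))) = 1 := by
      apply fR_self; rw [pin]; simp
    rw [e0]
    have e1 : (q * (((1:ℝ) : ℂ) * (k * (2 * Real.pi * Complex.I))) : ℂ) = 0 + ((k * q : ℤ) : ℂ) * (2 * Real.pi * Complex.I) := by
      push_cast; ring
    rw [e1, fR_add, fR_self, inv_one, one_mul, mul_one]
    rw [pin, Complex.ofReal_one, one_mul, Complex.exp_int_mul_two_pi_mul_I]; simp

end Dat
end JC

namespace JC
open Set Topology Filter

def tv (v : Fin 3 → ℂ) : ℂ × ℂ × ℂ := (v 0, v 1, v 2)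
def vt (z : ℂ × ℂ × ℂ) : Fin 3 → ℂ := ![z.1, z.2.1, z.2.2]
lemma tv_cont : Continuous tv := by unfold tv; fun_prop
lemma vt_cont : Continuous vt := by
  unfold vt
  refine continuous_pi fun i => ?_
  fin_cases i <;> simp <;> fun_prop
lemma tv_vt (z) : tv (vt z) = z := rfl
lemma vt_tv (v) : vt (tv v) = v := by
  funext i; fin_cases i <;> rfl
/-- scaling -/
def sc (t : ℂ) (z : ℂ × ℂ × ℂ) : ℂ × ℂ × ℂ := (t * z.1, t * z.2.1, t * z.2.2)
lemma tv_smul (t : ℂ) (v) : tv (t • v) = sc t (tv v) := rfl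
lemma vt_sc (t : ℂ) (z) : vt (sc t z) = t • vt z := by
  rw [← vt_tv (t • vt z), tv_smul, tv_vt]
lemma sc_cont : Continuous fun p : ℂ × ℂ × ℂ × ℂ => sc p.1 p.2 := by unfold sc; fun_prop
lemma sc_sc (a b z) : sc a (sc b z) = sc (a * b) z := by simp [sc, mul_assoc]
lemma sc_one (z) : sc 1 z = z := by simp [sc]

namespace Dat
variable (D : Dat)

def GF (z : ℂ × ℂ × ℂ) : ℂ := gp D.α D.e z.1 z.2.2 - gp D.β D.μ z.2.1 z.2.2
lemma GF_cont : Continuous D.GF := by unfold GF gp; fun_prop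
lemma mem_S_GF {z} : z ∈ D.S ↔ D.GF z ≠ 0 := by
  unfold S GF; rw [sub_ne_zero]; rfl
lemma GF_sc (t z) : D.GF (sc t z) = t ^ D.d * D.GF z := by
  simp only [GF, sc, gp_smul, D.hdg, D.hdf]; ring
lemma sc_mem {t : ℂ} (ht : t ≠ 0) {z} : sc t z ∈ D.S ↔ z ∈ D.S := by
  rw [mem_S_GF, mem_S_GF, GF_sc]; simp [ht]
lemma S_ne {z} (hz : z ∈ D.S) : vt z ≠ 0 := by
  intro h
  rw [← tv_vt z, h] at hz
  have := D.mem_S_inf.mp hz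
  exact this rfl
def star : ℂ × ℂ × ℂ := (1, 0, 0)
lemma star_S : star ∈ D.S := D.Om_sub D.star_mem_Om
lemma GF_star : D.GF star = 1 := by
  simp [GF, star, gp_zero, D.hdg, D.hdf, D.hd.ne']

/-- complement of the projective curve -/
abbrev X := {Q : Projectivization ℂ (Fin 3 → ℂ) // tv Q.rep ∈ D.S}

lemma rep_mem {v : Fin 3 → ℂ} (hv : v ≠ 0) : tv (Projectivization.mk ℂ v hv).rep ∈ D.S ↔ tv v ∈ D.S := by
  obtain ⟨a, ha⟩ := Projectivization.exists_smul_eq_mk_rep ℂ v hv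
  rw [← ha, show a • v = (a : ℂ) • v from rfl, tv_smul]
  exact D.sc_mem a.ne_zero

noncomputable def mkX (z : ℂ × ℂ × ℂ) (hz : z ∈ D.S) : D.X :=
  ⟨Projectivization.mk ℂ (vt z) (D.S_ne hz), (D.rep_mem _).mpr hz⟩

lemma mkX_eq {z z'} (hz : z ∈ D.S) (hz' : z' ∈ D.S) : D.mkX z hz = D.mkX z' hz' ↔ ∃ t, z = sc t z' := by
  unfold mkX
  rw [Subtype.mk.injEq, Projectivization.mk_eq_mk_iff']
  constructor
  · rintro ⟨a, ha⟩
    refine ⟨a, ?_⟩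
    have := congrArg tv ha
    rw [← vt_sc, tv_vt, tv_vt] at this; exact this.symm
  · rintro ⟨a, ha⟩
    exact ⟨a, by rw [ha, vt_sc]⟩

lemma mkX_surj (Q : D.X) : ∃ z hz, D.mkX z hz = Q := by
  refine ⟨tv Q.1.rep, Q.2, ?_⟩
  apply Subtype.ext
  simp only [mkX]
  simp only [vt_tv, Projectivization.mk_rep]

lemma mkX_cont : Continuous fun z : D.S => D.mkX z.1 z.2 := by
  refine Continuous.subtype_mk ?_ _
  have h1 : Continuous fun v : {v : Fin 3 → ℂ // v ≠ 0} => Projectivization.mk ℂ v.1 v.2 :=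
    continuous_quotient_mk'
  exact h1.comp (f := fun z : D.S => (⟨vt z.1, D.S_ne z.2⟩ : {v : Fin 3 → ℂ // v ≠ 0}))
    ((vt_cont.comp continuous_subtype_val).subtype_mk _)

abbrev V := {z : ℂ × ℂ × ℂ // D.GF z = 1}
lemma V_S (z : D.V) : z.1 ∈ D.S := by rw [mem_S_GF, z.2]; exact one_ne_zero
noncomputable def pV (z : D.V) : D.X := D.mkX z.1 (D.V_S z)
lemma pV_cont : Continuous D.pV :=
  D.mkX_cont.comp (f := fun z : D.V => (⟨z.1, D.V_S z⟩ : D.S)) (continuous_subtype_val.subtype_mk _)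

lemma exists_root (c : ℂ) (hc : c ≠ 0) : ∃ t : ℂ, t ≠ 0 ∧ t ^ D.d = c :=
  ⟨Complex.exp ((1 / D.d) * Complex.log c), Complex.exp_ne_zero _, by
    rw [← Complex.exp_nat_mul, ← mul_assoc, mul_one_div_cancel (by exact_mod_cast D.hd.ne'), one_mul,
      Complex.exp_log hc]⟩

lemma pV_surj : Function.Surjective D.pV := by
  intro Q
  obtain ⟨z, hz, rfl⟩ := D.mkX_surj Q
  obtain ⟨t, ht, h⟩ := D.exists_root _ (inv_ne_zero (D.mem_S_GF.mp hz))
  refine ⟨⟨sc t z, ?_⟩, ?_⟩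
  · rw [GF_sc, h, inv_mul_cancel₀ (D.mem_S_GF.mp hz)]
  · exact (D.mkX_eq _ _).mpr ⟨t, rfl⟩

lemma pV_quot : IsQuotientMap D.pV := by
  refine ⟨⟨TopologicalSpace.ext_iff.mpr fun A => ⟨fun h => h.preimage D.pV_cont, fun hA => ?_⟩⟩, D.pV_surj⟩
  suffices h : IsOpen (Subtype.val '' A) by
    have := h.preimage (continuous_subtype_val : Continuous (Subtype.val : D.X → _))
    rwa [preimage_image_eq _ Subtype.val_injective] at this
  have hq : IsQuotientMap (fun v : {v : Fin 3 → ℂ // v ≠ 0} => Projectivization.mk ℂ v.1 v.2) :=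
    isQuotientMap_quotient_mk'
  rw [← hq.isOpen_preimage, isOpen_iff_mem_nhds]
  rintro ⟨v, hv⟩ ⟨Q, hQ, hQv⟩
  change Q.1 = Projectivization.mk ℂ v hv at hQv
  have hvS : tv v ∈ D.S := by
    rw [← D.rep_mem hv, ← hQv]; exact Q.2
  have hne := D.mem_S_GF.mp hvS
  obtain ⟨t0, ht0, h0⟩ := D.exists_root _ (inv_ne_zero hne)
  -- local normalisation
  let c : (Fin 3 → ℂ) → ℂ := fun u =>
    t0 * Complex.exp (-(1 / D.d) * Complex.log (D.GF (tv u) / D.GF (tv v)))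
  have hcn : ∀ u, c u ≠ 0 := fun u => mul_ne_zero ht0 (Complex.exp_ne_zero _)
  have hcv : c v = t0 := by simp [c, div_self hne]
  have hcc : ContinuousAt c v := by
    refine continuousAt_const.mul (Complex.continuous_exp.continuousAt.comp (continuousAt_const.mul ?_))
    refine ContinuousAt.clog ?_ ?_
    · exact ((D.GF_cont.comp tv_cont).continuousAt).div_const _
    · rw [div_self hne]; exact Complex.one_mem_slitPlane
  have hc1 : ∀ u, tv u ∈ D.S → D.GF (sc (c u) (tv u)) = 1 := fun u hu => by
    have hu := D.mem_S_GF.mp hu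
    have hd0 : (D.d : ℂ) ≠ 0 := by exact_mod_cast D.hd.ne'
    rw [GF_sc]
    simp only [c]
    rw [mul_pow, h0, ← Complex.exp_nat_mul, ← mul_assoc, mul_neg, mul_one_div_cancel hd0, neg_one_mul,
      Complex.exp_neg, Complex.exp_log (div_ne_zero hu hne)]
    field_simp
  obtain ⟨O, hO, hOA⟩ := isOpen_induced_iff.mp hA
  have hkey : ∀ u (hu : u ≠ 0) (hS : tv u ∈ D.S), sc (c u) (tv u) ∈ O ↔
      Projectivization.mk ℂ u hu ∈ Subtype.val '' A := fun u hu hS => by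
    let z : D.V := ⟨sc (c u) (tv u), hc1 u hS⟩
    have hz : D.pV z = ⟨Projectivization.mk ℂ u hu, (D.rep_mem hu).mpr hS⟩ := by
      have : D.pV z = D.mkX (tv u) hS := (D.mkX_eq _ _).mpr ⟨_, rfl⟩
      rw [this]
      apply Subtype.ext; simp only [mkX]; simp only [vt_tv]
    have : z ∈ Subtype.val ⁻¹' O ↔ z ∈ D.pV ⁻¹' A := by rw [hOA]
    rw [mem_preimage, mem_preimage, hz] at this
    rw [this]
    constructor
    · intro h; exact ⟨_, h, rfl⟩
    · rintro ⟨Q, hQ, hQ'⟩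
      have : Q = ⟨Projectivization.mk ℂ u hu, (D.rep_mem hu).mpr hS⟩ := Subtype.ext hQ'
      rwa [← this]
  have hcont : ContinuousAt (fun u => sc (c u) (tv u)) v :=
    ContinuousAt.comp (f := fun u => (c u, tv u)) (sc_cont.continuousAt) (hcc.prodMk tv_cont.continuousAt)
  have hOv : sc (c v) (tv v) ∈ O := (hkey v hv hvS).mpr ⟨Q, hQ, hQv⟩
  have e1 : ∀ᶠ u in 𝓝 v, sc (c u) (tv u) ∈ O := hcont.eventually (hO.mem_nhds hOv)
  have e2 : ∀ᶠ u in 𝓝 v, tv u ∈ D.S := tv_cont.continuousAt.eventually (D.S_open.mem_nhds hvS)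
  have e3 : ∀ᶠ u : {v : Fin 3 → ℂ // v ≠ 0} in 𝓝 ⟨v, hv⟩, sc (c u) (tv u) ∈ O ∧ tv u ∈ D.S :=
    (continuous_subtype_val.continuousAt (x := (⟨v, hv⟩ : {v : Fin 3 → ℂ // v ≠ 0}))).eventually (e1.and e2)
  filter_upwards [e3] with u hu
  exact (hkey u.1 u.2 hu.2).mp hu.1

instance : MulAction (rootsOfUnity D.d ℂ) D.V where
  smul ζ z := ⟨sc ((ζ : ℂˣ) : ℂ) z.1, by
    rw [GF_sc, z.2, mul_one]
    have := (mem_rootsOfUnity' D.d ζ.1).mp ζ.2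
    exact this⟩
  one_smul z := Subtype.ext (sc_one _)
  mul_smul a b z := Subtype.ext (sc_sc _ _ _).symm

lemma smul_val (ζ : rootsOfUnity D.d ℂ) (z : D.V) : (ζ • z).1 = sc ((ζ : ℂˣ) : ℂ) z.1 := rfl

lemma sc_cancel {a b : ℂ} {z} (hz : z ∈ D.S) (h : sc a z = sc b z) : a = b := by
  have h1 := congrArg vt h
  rw [vt_sc, vt_sc] at h1
  exact smul_left_injective ℂ (D.S_ne hz) h1

theorem pV_cov : IsCoveringMap D.pV := by
  haveI : NeZero D.d := ⟨D.hd.ne'⟩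
  haveI : ContinuousConstSMul (rootsOfUnity D.d ℂ) D.V := ⟨fun ζ =>
    (Continuous.subtype_mk (sc_cont.comp (continuous_const.prodMk continuous_subtype_val)) _)⟩
  haveI : IsCancelSMul (rootsOfUnity D.d ℂ) D.V := ⟨fun a b z h => by
    have := D.sc_cancel (D.V_S z) (congrArg Subtype.val h)
    exact Subtype.ext (Units.ext this)⟩
  have hcl : IsClosed {z : ℂ × ℂ × ℂ | D.GF z = 1} := isClosed_eq D.GF_cont continuous_const
  haveI : LocallyCompactSpace D.V := hcl.isClosedEmbedding_subtypeVal.locallyCompactSpace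
  refine (D.pV_quot.isQuotientCoveringMap_of_properlyDiscontinuousSMul (G := rootsOfUnity D.d ℂ) ?_).isCoveringMap
  intro z z'
  rw [MulAction.mem_orbit_iff]
  constructor
  · intro h
    obtain ⟨t, ht⟩ := (D.mkX_eq _ _).mp h
    have h1 := z.2
    rw [ht, GF_sc, z'.2, mul_one] at h1
    have ht0 : t ≠ 0 := by rintro rfl; rw [zero_pow D.hd.ne'] at h1; exact zero_ne_one h1
    refine ⟨⟨Units.mk0 t ht0, (mem_rootsOfUnity' _ _).mpr h1⟩, Subtype.ext ht.symm⟩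
  · rintro ⟨ζ, rfl⟩
    exact (D.mkX_eq _ _).mpr ⟨_, rfl⟩
end Dat
end JC

namespace JC
open Set Topology Filter

/-- hermitian form -/
noncomputable def hf (a b : ℂ × ℂ × ℂ) : ℂ :=
  a.1 * (starRingEnd ℂ) b.1 + a.2.1 * (starRingEnd ℂ) b.2.1 + a.2.2 * (starRingEnd ℂ) b.2.2
lemma hf_cont : Continuous fun p : (ℂ × ℂ × ℂ) × (ℂ × ℂ × ℂ) => hf p.1 p.2 := by
  unfold hf
  have := Complex.continuous_conj
  fun_prop
lemma hf_sc (t a b) : hf (sc t a) b = t * hf a b := by simp only [hf, sc]; ring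
lemma hf_ne {a : ℂ × ℂ × ℂ} (ha : vt a ≠ 0) : hf a a ≠ 0 := by
  intro h
  apply ha
  simp only [hf, Complex.mul_conj] at h
  have h' : Complex.normSq a.1 + Complex.normSq a.2.1 + Complex.normSq a.2.2 = 0 := by exact_mod_cast h
  have h1 := Complex.normSq_nonneg a.1
  have h2 := Complex.normSq_nonneg a.2.1
  have h3 := Complex.normSq_nonneg a.2.2
  have e1 : a.1 = 0 := Complex.normSq_eq_zero.mp (by linarith)
  have e2 : a.2.1 = 0 := Complex.normSq_eq_zero.mp (by linarith)
  have e3 : a.2.2 = 0 := Complex.normSq_eq_zero.mp (by linarith)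
  unfold vt
  rw [e1, e2, e3]
  funext i; fin_cases i <;> rfl

namespace Dat
variable (D : Dat)

noncomputable def xs : D.X := D.mkX star D.star_S
open Classical in
noncomputable def qX (z : ℂ × ℂ × ℂ) : D.X := if hz : z ∈ D.S then D.mkX z hz else D.xs
lemma qX_eq {z} (hz : z ∈ D.S) : D.qX z = D.mkX z hz := by simp [qX, hz]
lemma qX_cont : ContinuousOn D.qX D.S := by
  rw [continuousOn_iff_continuous_restrict]
  convert D.mkX_cont using 1
  funext z; exact D.qX_eq z.2
lemma qX_sc {t : ℂ} (ht : t ≠ 0) {z} (hz : z ∈ D.S) : D.qX (sc t z) = D.qX z := by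
  rw [D.qX_eq hz, D.qX_eq ((D.sc_mem ht).mpr hz), mkX_eq]; exact ⟨t, rfl⟩
lemma qX_V (v : D.V) : D.qX v.1 = D.pV v := D.qX_eq (D.V_S v)
lemma qX_star : D.qX star = D.xs := D.qX_eq D.star_S

def eV : D.V := ⟨star, D.GF_star⟩
lemma pV_eV : D.pV D.eV = D.xs := rfl

noncomputable def pj' (s : ℝ) : unitInterval := projIcc 0 1 zero_le_one s
lemma pj'_cont : Continuous pj' := continuous_projIcc (h := zero_le_one)
lemma pj'_eq (t : unitInterval) : pj' (t : ℝ) = t := projIcc_val _ t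
lemma pj'_zero : pj' 0 = 0 := pj'_eq 0
lemma pj'_one : pj' 1 = 1 := pj'_eq 1
lemma pj'_mem {s : ℝ} (hs : s ∈ Icc (0:ℝ) 1) : ((pj' s : unitInterval) : ℝ) = s := by
  unfold pj'; rw [projIcc_of_mem _ hs]

lemma lift_loop (p : Path D.xs D.xs) : ∃ γ, IsP D.S γ ∧ γ 0 = star ∧ γ 1 = star ∧
    ∀ t : unitInterval, D.qX (γ t) = p t := by
  obtain ⟨v, hv, hv0⟩ := D.pV_cov.exists_path_lifts p.toContinuousMap D.eV (p.source.trans D.pV_eV.symm)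
  have hvt : ∀ t, D.pV (v t) = p t := fun t => congrFun hv t
  have h1 : D.mkX (v 1).1 (D.V_S _) = D.mkX star D.star_S := (hvt 1).trans p.target
  obtain ⟨ζ, hζ⟩ := (D.mkX_eq _ _).mp h1
  have hζ0 : ζ ≠ 0 := by
    rintro rfl
    have := D.V_S (v 1)
    rw [hζ] at this
    exact D.mem_S_inf.mp (show ((0:ℂ), (0:ℂ), (0:ℂ)) ∈ D.S by simpa [sc] using this) rfl
  have hm : ∀ s : ℝ, sc (Complex.exp (-s * Complex.log ζ)) (v (pj' s)).1 ∈ D.S := fun s =>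
    (D.sc_mem (Complex.exp_ne_zero _)).mpr (D.V_S _)
  refine ⟨fun s => sc (Complex.exp (-s * Complex.log ζ)) (v (pj' s)).1, ⟨?_, fun s _ => hm s⟩, ?_, ?_, ?_⟩
  · refine (sc_cont.comp (Continuous.prodMk (by fun_prop) ?_)).continuousOn
    exact continuous_subtype_val.comp (v.continuous.comp pj'_cont)
  · simp only [pj'_zero, hv0]
    simp [sc_one, eV]
  · simp only [pj'_one, hζ, sc_sc]
    rw [Complex.ofReal_one, neg_one_mul, Complex.exp_neg, Complex.exp_log hζ0, inv_mul_cancel₀ hζ0, sc_one]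
  · intro t
    simp only [pj'_eq]
    rw [D.qX_sc (Complex.exp_ne_zero _) (D.V_S _), D.qX_V, hvt]

lemma null_loop {Γ : Type*} [Group Γ] (ψ : Hol D.S Γ)
    (hψ : ∀ k : ℤ, ψ.h (fun t => (Complex.exp ((t : ℂ) * (k * (2 * Real.pi * Complex.I))), 0, 0)) = 1)
    {γ : ℝ → ℂ × ℂ × ℂ} (hγ : IsP D.S γ) (h0 : γ 0 = star) (h1 : γ 1 = star) (p : Path D.xs D.xs)
    (hp : ∀ t : unitInterval, D.qX (γ t) = p t) (hnull : p.Homotopic (Path.refl D.xs)) : ψ.h γ = 1 := by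
  have cov := D.pV_cov
  have hs0 : p.toContinuousMap 0 = D.pV D.eV := p.source.trans D.pV_eV.symm
  set v := cov.liftPath p.toContinuousMap D.eV hs0 with hvdef
  have hv : D.pV ∘ v = p.toContinuousMap := cov.liftPath_lifts _ _ _
  have hv0 : v 0 = D.eV := cov.liftPath_zero _ _ _
  have hvt : ∀ t, D.pV (v t) = p t := fun t => congrFun hv t
  have hhom := cov.homotopicRel_liftPath (γ₀ := p.toContinuousMap) (γ₁ := (Path.refl D.xs).toContinuousMap)
    hnull D.eV hs0 (D.pV_eV.symm)
  have hcst : cov.liftPath (Path.refl D.xs).toContinuousMap D.eV D.pV_eV.symm = .const _ D.eV :=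
    cov.liftPath_const D.pV_eV.symm
  rw [hcst, ← hvdef] at hhom
  obtain ⟨F⟩ := hhom
  have F0 : ∀ a, F (0, a) = v a := fun a => F.apply_zero a
  have F1 : ∀ a, F (1, a) = D.eV := fun a => F.apply_one a
  have Fl : ∀ t, F (t, 0) = D.eV := fun t => (F.eq_fst t (by simp)).trans hv0
  have Fr : ∀ t, F (t, 1) = D.eV := fun t => (F.eq_snd t (by simp)).trans rfl
  have hv1 : v 1 = D.eV := by rw [← F0, Fr]
  have vcont : Continuous fun s : ℝ => (v (pj' s)).1 :=
    continuous_subtype_val.comp (v.continuous.comp pj'_cont)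
  have key1 := ψ.sq (fun s t => (F (pj' t, pj' s)).1) (IsSq.mk' (by
    refine continuous_subtype_val.comp (F.continuous.comp ?_)
    exact (pj'_cont.comp continuous_snd).prodMk (pj'_cont.comp continuous_fst)) (fun s _ t _ => D.V_S _))
  simp only [pj'_zero, pj'_one, F0, F1, Fl, Fr] at key1
  rw [ψ.const _ (D.V_S _), mul_one, one_mul] at key1
  -- the scaling factor
  have hrel : ∀ t : unitInterval, ∃ c, γ t = sc c (v t).1 := fun t => by
    have hm := hγ.mem t t.2
    have := hp t
    rw [D.qX_eq hm, ← hvt] at this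
    exact (D.mkX_eq _ _).mp this
  let c : unitInterval → ℂ := fun t => hf (γ t) (v t).1 / hf (v t).1 (v t).1
  have hcsc : ∀ t : unitInterval, γ t = sc (c t) (v t).1 := fun t => by
    obtain ⟨a, ha⟩ := hrel t
    have : c t = a := by
      simp only [c]
      rw [ha, hf_sc, mul_div_assoc, div_self (hf_ne (D.S_ne (D.V_S _))), mul_one]
    rw [this, ← ha]
  have hcne : ∀ t, c t ≠ 0 := fun t h => by
    have := hγ.mem t t.2
    rw [hcsc t, h] at this
    exact D.mem_S_inf.mp (show ((0:ℂ), (0:ℂ), (0:ℂ)) ∈ D.S by simpa [sc] using this) rfl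
  have γc : Continuous fun t : unitInterval => γ t := continuousOn_iff_continuous_restrict.mp hγ.cont
  have vc : Continuous fun t : unitInterval => (v t).1 := continuous_subtype_val.comp v.continuous
  have hcc : Continuous c := (hf_cont.comp (γc.prodMk vc)).div (hf_cont.comp (vc.prodMk vc))
    fun t => hf_ne (D.S_ne (D.V_S _))
  have hend : ∀ t : unitInterval, γ t = star → v t = D.eV → c t = 1 := fun t a b => by
    have := hcsc t
    rw [a, b] at this
    exact D.sc_cancel (z := star) D.star_S (by rw [sc_one]; exact this.symm)
  have hc0 : c 0 = 1 := hend 0 h0 hv0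
  have hc1 : c 1 = 1 := hend 1 h1 hv1
  obtain ⟨τ, hτ, hτ0⟩ := Complex.isCoveringMap_exp.exists_path_lifts
    (⟨fun t => ⟨c t, hcne t⟩, hcc.subtype_mk _⟩ : C(unitInterval, {z : ℂ // z ≠ 0})) 0
    (by apply Subtype.ext; simp [hc0])
  have hτe : ∀ t, Complex.exp (τ t) = c t := fun t => congrArg Subtype.val (congrFun hτ t)
  have key2 := ψ.sq (fun s t => sc (Complex.exp (t * τ (pj' s))) (v (pj' s)).1) (IsSq.mk' (by
      refine sc_cont.comp (Continuous.prodMk ?_ (vcont.comp continuous_fst))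
      have : Continuous fun p : ℝ × ℝ => τ (pj' p.1) := τ.continuous.comp (pj'_cont.comp continuous_fst)
      exact Complex.continuous_exp.comp ((Complex.continuous_ofReal.comp continuous_snd).mul this))
    (fun s _ t _ => (D.sc_mem (Complex.exp_ne_zero _)).mpr (D.V_S _)))
  simp only [pj'_zero, pj'_one, hτ0, hv0, hv1, mul_zero, Complex.exp_zero, sc_one, Complex.ofReal_zero, zero_mul,
    Complex.ofReal_one, one_mul, hτe] at key2
  rw [key1, ψ.const _ (D.V_S _), one_mul, one_mul] at key2
  have e1 : ψ.h γ = ψ.h (fun s => sc (c (pj' s)) (v (pj' s)).1) :=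
    ψ.congr hγ fun s hs => by rw [← hcsc, pj'_mem hs]
  rw [e1, ← key2]
  have h2 : Complex.exp (τ 1) = 1 := by rw [hτe, hc1]
  obtain ⟨k, hk⟩ := Complex.exp_eq_one_iff.mp h2
  rw [hk, ← hψ k]
  congr 1
  funext t
  simp [sc, eV, star]
end Dat
end JC

namespace JC
open Set Topology Filter

section alg
variable {Γ : Type*} [Group Γ]

lemma seq_exists (g : ℤ → Γ) : ∃ w : ℤ → Γ, w 0 = 1 ∧ ∀ k, w (k + 1) = w k * g (k + 1) := by
  let σ : Equiv.Perm (Γ × ℤ) :=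
    { toFun := fun p => (p.1 * g (p.2 + 1), p.2 + 1)
      invFun := fun p => (p.1 * (g p.2)⁻¹, p.2 - 1)
      left_inv := fun p => by simp
      right_inv := fun p => by simp }
  have h1 : ∀ k : ℤ, (σ ^ (k + 1)) (1, 0) = σ ((σ ^ k) (1, 0)) := fun k => by
    rw [add_comm, zpow_add, zpow_one]; rfl
  have h2 : ∀ k : ℤ, ((σ ^ k) (1, 0)).2 = k := fun k => by
    induction k using Int.induction_on with
    | zero => rfl
    | succ i ih => rw [h1]; simp only [σ, Equiv.coe_fn_mk]; rw [ih]
    | pred i ih =>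
      have := h1 (-i - 1)
      rw [sub_add_cancel] at this
      rw [this] at ih
      simp only [σ, Equiv.coe_fn_mk] at ih ⊢
      omega
  refine ⟨fun k => ((σ ^ k) (1, 0)).1, rfl, fun k => ?_⟩
  have : (σ ((σ ^ k) (1, 0))).1 = ((σ ^ k) (1, 0)).1 * g (((σ ^ k) (1, 0)).2 + 1) := rfl
  rw [h2] at this
  show ((σ ^ (k + 1)) (1, 0)).1 = _
  rw [h1, this]

lemma seq_unique {g u v : ℤ → Γ} (c : Γ) (hu : ∀ k, u (k + 1) = u k * g (k + 1))
    (hv : ∀ k, v (k + 1) = v k * g (k + 1)) (h0 : u 0 = c * v 0) (k : ℤ) : u k = c * v k := by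
  induction k using Int.induction_on with
  | zero => exact h0
  | succ i ih => rw [hu, hv, ih, mul_assoc]
  | pred i ih =>
    have a := hu (-i - 1)
    have b := hv (-i - 1)
    rw [sub_add_cancel] at a b
    rw [a, b, ← mul_assoc] at ih
    exact mul_right_cancel ih

lemma seq_list {g w : ℤ → Γ} (h0 : w 0 = 1) (hw : ∀ k, w (k + 1) = w k * g (k + 1)) (n : ℕ) :
    w n = ((List.range n).map (fun i : ℕ => g ((i : ℤ) + 1))).prod := by
  induction n with
  | zero => simpa using h0
  | succ n ih => rw [List.range_succ, List.map_append, List.prod_append, ← ih]; simp [hw]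

lemma seq_shift_m {g w : ℤ → Γ} {m : ℕ} (h0 : w 0 = 1) (hw : ∀ k, w (k + 1) = w k * g (k + 1))
    (hg : ∀ k, g (k + m) = g k) (k : ℤ) : w (k + m) = w m * w k := by
  refine seq_unique (g := g) (u := fun k => w (k + m)) (v := w) (w m) ?_ hw (by simp [h0]) k
  intro k
  show w (k + 1 + m) = w (k + m) * g (k + 1)
  rw [← hg, show k + 1 + (m : ℤ) = k + m + 1 by ring, hw]

lemma seq_shift_n {g w : ℤ → Γ} {n : ℕ} (h0 : w 0 = 1) (hw : ∀ k, w (k + 1) = w k * g (k + 1))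
    (hg : ∀ k, g k * w n = w n * g (k + n)) (k : ℤ) : w (k + n) = w k * w n := by
  have := seq_unique (g := fun k => g (k + n)) (u := fun k => w (k + n)) (v := fun k => w k * w n) 1
    ?_ ?_ (by simp [h0]) k
  · simpa using this
  · intro k
    show w (k + 1 + n) = w (k + n) * g (k + 1 + n)
    rw [show k + 1 + (n : ℤ) = k + n + 1 by ring, hw]
  · intro k
    show w (k + 1) * w n = w k * w n * g (k + 1 + n)
    rw [hw, mul_assoc, hg, mul_assoc]

lemma seq_pow_m {w : ℤ → Γ} {m : ℕ} (h0 : w 0 = 1) (h : ∀ k, w (k + m) = w m * w k) (q : ℕ) :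
    w ((m * q : ℕ) : ℤ) = w m ^ q := by
  induction q with
  | zero => simpa using h0
  | succ q ih => rw [mul_add, Nat.cast_add, mul_one, h, ih, pow_succ']

lemma seq_pow_n {w : ℤ → Γ} {n : ℕ} (h0 : w 0 = 1) (h : ∀ k, w (k + n) = w k * w n) (q : ℕ) :
    w ((n * q : ℕ) : ℤ) = w n ^ q := by
  induction q with
  | zero => simpa using h0
  | succ q ih => rw [mul_add, Nat.cast_add, mul_one, h, ih, pow_succ]

lemma per_val {A : Type*} {m : ℕ} (hm : 0 < m) {b : ℤ → A} (hb : ∀ k, b k = b (k + m)) (k : ℤ) :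
    b k = b (((k : ZMod m).val : ℕ) : ℤ) := by
  haveI : NeZero m := ⟨hm.ne'⟩
  have hp : Function.Periodic b (m : ℤ) := fun k => (hb k).symm
  rw [ZMod.val_intCast]
  conv_lhs => rw [← Int.emod_add_mul_ediv k m, mul_comm]
  exact hp.int_mul (k / m) _
end alg
end JC

namespace JC
open Set Topology Filter
namespace Dat
variable (D : Dat)

instance pcX : PathConnectedSpace D.X := by
  rw [pathConnectedSpace_iff_univ]
  have := D.S_pc.image' D.qX_cont
  convert this using 1
  symm
  rw [eq_univ_iff_forall]
  intro Q
  obtain ⟨z, hz, rfl⟩ := D.mkX_surj Q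
  exact ⟨z, hz, D.qX_eq hz⟩

/-- canonical holonomy on the cone complement -/
noncomputable def hh : Hol D.S (FundamentalGroup D.X D.xs) :=
  (canHol D.xs).comap D.qX D.qX_cont (mapsTo_univ _ _)

lemma hh_eq {γ : ℝ → ℂ × ℂ × ℂ} (p : Path D.xs D.xs) (hp : ∀ t : unitInterval, D.qX (γ t) = p t) :
    D.hh.h γ = vtx D.xs p := canHol_eq (x0 := D.xs) p (γ := fun s => D.qX (γ s)) hp

lemma exists_path {γ : ℝ → ℂ × ℂ × ℂ} (hγ : IsP D.S γ) (h0 : γ 0 = star) (h1 : γ 1 = star) :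
    ∃ p : Path D.xs D.xs, ∀ t : unitInterval, D.qX (γ t) = p t := by
  refine ⟨⟨⟨fun t => D.qX (γ t), ?_⟩, ?_, ?_⟩, fun t => rfl⟩
  · exact continuousOn_iff_continuous_restrict.mp (D.qX_cont.comp hγ.cont hγ.mem)
  · show D.qX (γ ((0 : unitInterval) : ℝ)) = _
    rw [Set.Icc.coe_zero, h0, qX_star]
  · show D.qX (γ ((1 : unitInterval) : ℝ)) = _
    rw [Set.Icc.coe_one, h1, qX_star]

lemma P_shift (j : ℤ) (a : ℝ) :
    P (D.th (j + D.d)) a = sc (Complex.exp (((-(2 * Real.pi) * a : ℝ) : ℂ) * Complex.I)) (P (D.th j) a) := by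
  have hd : (D.d : ℝ) ≠ 0 := by exact_mod_cast D.hd.ne'
  have e : D.th (j + D.d) = D.th j + 2 * Real.pi := by
    unfold th; push_cast; field_simp; ring
  rw [e]
  generalize D.th j = θ
  unfold P sc
  refine Prod.ext ?_ (Prod.ext ?_ ?_)
  · show _ * Complex.exp _ = Complex.exp _ * (_ * Complex.exp _)
    rw [mul_left_comm, ← Complex.exp_add]
    congr 2; push_cast; ring
  · show _ * Complex.exp _ = Complex.exp _ * (_ * Complex.exp _)
    rw [mul_left_comm, ← Complex.exp_add]
    congr 1
    rw [Complex.exp_eq_exp_iff_exists_int]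
    exact ⟨1, by push_cast; ring⟩
  · simp

lemma pj_shift (j : ℤ) : D.pj D.hh (j + D.d) = D.pj D.hh j := by
  unfold pj
  have h1 := D.P_isP (D.th_good j)
  show (canHol D.xs).h (fun s => D.qX (P (D.th (j + D.d)) s)) = (canHol D.xs).h (fun s => D.qX (P (D.th j) s))
  refine (canHol D.xs).congr ⟨?_, fun _ _ => mem_univ _⟩ fun s hs => ?_
  · have := D.P_isP (D.th_good (j + D.d))
    exact D.qX_cont.comp this.cont this.mem
  · rw [P_shift, D.qX_sc (Complex.exp_ne_zero _) (h1.mem s hs)]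
end Dat
end JC

namespace JC
open Set Topology Filter
namespace Dat
variable (D : Dat)

/-- relators, parametrised by the target words -/
def Rels (m n d : ℕ) : Set (FreeGroup (ZMod m)) :=
  {w : FreeGroup (ZMod m) | ∃ kk : ZMod m,
      w = (FreeGroup.of kk)⁻¹ *
          (((List.range n).map (fun i => FreeGroup.of ((i + 1 : ℕ) : ZMod m))).prod) *
          FreeGroup.of (kk + (n : ZMod m)) *
          (((List.range n).map (fun i => FreeGroup.of ((i + 1 : ℕ) : ZMod m))).prod)⁻¹}
        ∪ {(((List.range m).map (fun i => FreeGroup.of ((i + 1 : ℕ) : ZMod m))).prod) ^ (d / m)}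

section rels
variable {Γ : Type*} [Group Γ] {m n : ℕ} (g : ZMod m → Γ) {w : ℤ → Γ} (h0 : w 0 = 1)
  (hw : ∀ k, w (k + 1) = w k * g ((k + 1 : ℤ) : ZMod m))
include h0 hw

lemma lift_word (f : FreeGroup (ZMod m) →* Γ) (hf : ∀ a, f (FreeGroup.of a) = g a) (q : ℕ) :
    f (((List.range q).map (fun i => FreeGroup.of ((i + 1 : ℕ) : ZMod m))).prod) = w q := by
  rw [seq_list (g := fun k : ℤ => g (k : ZMod m)) h0 hw, map_list_prod, List.map_map]
  congr 2
  funext i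
  simp [hf]
end rels

section main
variable (hcrit : D.Crit)

include hcrit in
theorem main_iso : Nonempty (FundamentalGroup D.X D.xs ≃*
    PresentedGroup (Rels (Finset.univ.gcd D.μ) (Finset.univ.gcd D.e) D.d)) := by
  have hm := D.gcd_pos
  have hn : 0 < Finset.univ.gcd D.e := D.swap.gcd_pos
  have en := D.e_mul
  have em := D.m_mul
  have tA := D.thmA D.hh hcrit
  have tA' := D.thmA' D.hh hcrit
  obtain ⟨ψC⟩ : Nonempty (∀ (w : ℤ → PresentedGroup (Rels (Finset.univ.gcd D.μ) (Finset.univ.gcd D.e) D.d))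
    (ω Δ : PresentedGroup (Rels (Finset.univ.gcd D.μ) (Finset.univ.gcd D.e) D.d))
    (hwn : ∀ k, w (k + (Finset.univ.gcd D.e : ℕ)) = w k * ω)
    (hwm : ∀ k, w (k + (Finset.univ.gcd D.μ : ℕ)) = Δ * w k), PLift (
    ∃ ψ : Hol D.S (PresentedGroup (Rels (Finset.univ.gcd D.μ) (Finset.univ.gcd D.e) D.d)),
    (∀ j, ψ.h (P (D.th j)) = (w j)⁻¹) ∧
      ∀ k : ℤ, ψ.h (fun t => (Complex.exp ((t : ℂ) * (k * (2 * Real.pi * Complex.I))), 0, 0)) =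
        ω ^ (k * (D.d / Finset.univ.gcd D.e : ℕ)))) :=
    ⟨fun w ω Δ a b => ⟨D.thmC a b⟩⟩
  generalize hmm : Finset.univ.gcd D.μ = m at *
  generalize hnn : Finset.univ.gcd D.e = n at *
  haveI : NeZero m := ⟨hm.ne'⟩
  set Γ := PresentedGroup (Rels m n D.d)
  -- the topological side
  let pp := D.pj D.hh
  let B : ZMod m → FundamentalGroup D.X D.xs := fun a => D.bj D.hh (a.val : ℤ)
  have hB : ∀ k : ℤ, B (k : ZMod m) = D.bj D.hh k := fun k => (per_val hm tA k).symm
  have hbj : ∀ k, D.bj D.hh k = pp (k - 1) * (pp k)⁻¹ := fun k => rfl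
  let W : ℤ → FundamentalGroup D.X D.xs := fun k => pp 0 * (pp k)⁻¹
  have W0 : W 0 = 1 := mul_inv_cancel _
  have W1 : ∀ k, W (k + 1) = W k * B ((k + 1 : ℤ) : ZMod m) := fun k => by
    rw [hB, hbj, add_sub_cancel_right]; simp only [W]; group
  have Wn : ∀ k : ℤ, pp (k + n) = (W n)⁻¹ * pp k := fun k => by
    refine seq_unique (g := fun k => ((pp k)⁻¹ * pp (k - 1))⁻¹) (u := fun k => pp (k + n)) (v := pp) _ ?_ ?_ ?_ k
    · intro k
      have := tA' (k + 1)
      show pp (k+1+n) = pp (k+n) * ((pp (k+1))⁻¹ * pp (k+1-1))⁻¹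
      change (pp (k+1))⁻¹ * pp (k + 1 - 1) = (pp (k+1+n))⁻¹ * pp (k + 1 + n - 1) at this
      rw [this, show k + 1 + (n : ℤ) - 1 = k + n by ring]; group
    · intro k
      simp only [add_sub_cancel_right]; group
    · show pp (0+n) = (pp 0 * (pp n)⁻¹)⁻¹ * pp 0
      rw [zero_add]; group
  have WB : ∀ k : ℤ, D.bj D.hh k * W n = W n * D.bj D.hh (k + n) := fun k => by
    rw [hbj, hbj, show k + (n : ℤ) - 1 = k - 1 + n by ring, Wn, Wn]; group
  have Wm : W m ^ (D.d / m) = 1 := by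
    have := seq_shift_m (g := fun k : ℤ => B (k : ZMod m)) (m := m) W0 W1 (fun k => by simp)
    rw [← seq_pow_m W0 this, em]
    have h1 := D.pj_shift 0
    rw [zero_add] at h1
    show D.pj D.hh 0 * (D.pj D.hh D.d)⁻¹ = 1
    rw [h1, mul_inv_cancel]
  have hrel : ∀ x ∈ Rels m n D.d, FreeGroup.lift B x = 1 := by
    rintro x (⟨k, rfl⟩ | rfl)
    · have hl := lift_word B W0 W1 (FreeGroup.lift B) (fun a => FreeGroup.lift_apply_of) n
      simp only [map_mul, map_inv, hl, FreeGroup.lift_apply_of]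
      obtain ⟨k, rfl⟩ := ZMod.intCast_surjective k
      have h1 := WB k
      rw [← hB, ← hB] at h1
      push_cast at h1
      rw [mul_assoc, mul_assoc, ← mul_assoc (W n), ← h1]; group
    · rw [map_pow, lift_word B W0 W1 (FreeGroup.lift B) (fun a => FreeGroup.lift_apply_of) m, Wm]
  let Φ : Γ →* FundamentalGroup D.X D.xs := PresentedGroup.toGroup hrel
  have hΦ : ∀ k : ℤ, Φ (PresentedGroup.of (k : ZMod m)) = D.bj D.hh k := fun k => by
    rw [← hB]; exact PresentedGroup.toGroup.of hrel
  -- the algebraic side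
  let g : ZMod m → Γ := PresentedGroup.of
  obtain ⟨w, w0, w1⟩ := seq_exists (fun k : ℤ => g (k : ZMod m))
  have wl := lift_word g w0 w1 (PresentedGroup.mk (Rels m n D.d)) (fun a => rfl)
  have r1 : ∀ k : ℤ, g (k : ZMod m) * w n = w n * g ((k + n : ℤ) : ZMod m) := fun k => by
    have := PresentedGroup.one_of_mem (rels := Rels m n D.d) (Or.inl ⟨(k : ZMod m), rfl⟩)
    simp only [map_mul, map_inv, wl] at this
    change (g (k : ZMod m))⁻¹ * w n * g ((k : ZMod m) + n) * (w n)⁻¹ = 1 at this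
    push_cast
    rw [mul_inv_eq_one, mul_assoc, inv_mul_eq_iff_eq_mul] at this
    exact this.symm
  have r2 : w m ^ (D.d / m) = 1 := by
    have := PresentedGroup.one_of_mem (rels := Rels m n D.d) (Or.inr rfl)
    rwa [map_pow, wl] at this
  have swn := seq_shift_n (g := fun k : ℤ => g (k : ZMod m)) (n := n) w0 w1 r1
  have swm := seq_shift_m (g := fun k : ℤ => g (k : ZMod m)) (m := m) w0 w1 (fun k => by simp)
  have hω : w n ^ (D.d / n) = 1 := by
    rw [← seq_pow_n w0 swn, en, ← r2, ← seq_pow_m w0 swm, em]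
  obtain ⟨ψ, hψ1, hψ2⟩ := (ψC w _ _ swn swm).down
  have hψ3 : ∀ k : ℤ, ψ.h (fun t => (Complex.exp ((t : ℂ) * (k * (2 * Real.pi * Complex.I))), 0, 0)) = 1 := fun k => by
    rw [hψ2, mul_comm, zpow_mul, zpow_natCast, hω, one_zpow]
  -- lifting elements to loops
  have lifts : ∀ x : Γ, ∃ γ, IsP D.S γ ∧ γ 0 = star ∧ γ 1 = star ∧ ψ.h γ = x ∧ D.hh.h γ = Φ x := by
    intro x
    have hx : x ∈ Subgroup.closure (Set.range (PresentedGroup.of (rels := Rels m n D.d))) := by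
      rw [PresentedGroup.closure_range_of]; trivial
    induction hx using Subgroup.closure_induction with
    | mem x hx =>
      obtain ⟨a, rfl⟩ := hx
      obtain ⟨k, rfl⟩ := ZMod.intCast_surjective a
      have i1 := D.P_isP (D.th_good (k - 1))
      have i2 := D.P_isP (D.th_good k)
      have e01 : P (D.th (k-1)) 1 = (fun s => P (D.th k) (1 - s)) 0 := by simp [P_one]
      refine ⟨jn (P (D.th (k-1))) (fun s => P (D.th k) (1 - s)), IsP.jn i1 i2.rev e01, ?_, ?_, ?_, ?_⟩
      · rw [jn_zero, P_zero]; rfl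
      · rw [jn_one]; simp [P_zero, star]
      · rw [Hol.jn _ i1 i2.rev e01, Hol.rev _ i2, hψ1, hψ1, inv_inv]
        have := w1 (k - 1)
        rw [sub_add_cancel] at this
        rw [this, inv_mul_cancel_left]
      · rw [Hol.jn _ i1 i2.rev e01, Hol.rev _ i2, hΦ]; rfl
    | one => exact ⟨fun _ => star, IsP.const D.star_S, rfl, rfl, ψ.const _ D.star_S,
        (D.hh.const _ D.star_S).trans (map_one Φ).symm⟩
    | mul x y _ _ hx hy =>
      obtain ⟨γ, a1, a2, a3, a4, a5⟩ := hx
      obtain ⟨δ, b1, b2, b3, b4, b5⟩ := hy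
      have e01 : γ 1 = δ 0 := by rw [a3, b2]
      exact ⟨jn γ δ, IsP.jn a1 b1 e01, by rw [jn_zero, a2], by rw [jn_one, b3],
        by rw [Hol.jn _ a1 b1 e01, a4, b4], by rw [Hol.jn _ a1 b1 e01, a5, b5, map_mul]⟩
    | inv x _ hx =>
      obtain ⟨γ, a1, a2, a3, a4, a5⟩ := hx
      exact ⟨fun s => γ (1 - s), a1.rev, by simp [a3], by simp [a2], by rw [Hol.rev _ a1, a4],
        by rw [Hol.rev _ a1, a5, map_inv]⟩
  have hinj : Function.Injective Φ := by
    rw [injective_iff_map_eq_one]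
    intro x hx
    obtain ⟨γ, a1, a2, a3, a4, a5⟩ := lifts x
    obtain ⟨p, hp⟩ := D.exists_path a1 a2 a3
    rw [← a4]
    refine D.null_loop ψ hψ3 a1 a2 a3 p hp (vtx_eq_one (x0 := D.xs) ?_)
    rw [← D.hh_eq p hp, a5, hx]
  have hsurj : Function.Surjective Φ := by
    intro y
    obtain ⟨p, rfl⟩ := vtx_surj (x0 := D.xs) y
    obtain ⟨γ, a1, a2, a3, a4⟩ := D.lift_loop p
    rw [← D.hh_eq p a4]
    have := thmB (D := D) D.hh Φ.range (fun j => ⟨_, hΦ j⟩) a1 a2 a3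
    exact this
  exact ⟨(MulEquiv.ofBijective Φ ⟨hinj, hsurj⟩).symm⟩
end main
end Dat
end JC

namespace JC
open MvPolynomial

lemma pd_aeval {R : Type*} [CommRing R] [Algebra ℂ R] (δ : Derivation ℂ R R) (φ : Fin 3 → R) (t : Fin 3)
    (hφ : ∀ i, δ (φ i) = if i = t then 1 else 0) (p : MvPolynomial (Fin 3) ℂ) :
    δ (aeval φ p) = aeval φ (pderiv t p) := by
  induction p using MvPolynomial.induction_on with
  | C a => simp
  | add p q hp hq => simp [hp, hq]
  | mul_X p i ih =>
    simp only [map_mul, aeval_X, Derivation.leibniz, ih, hφ, smul_eq_mul, map_add, pderiv_X, Pi.single_apply]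
    by_cases h : i = t
    · subst h; simp
    · simp [h, Ne.symm h]

lemma eval_G {r : ℕ} (α : Fin r → ℂ) (e : Fin r → ℕ) (k : Fin 3) (v : Fin 3 → ℂ) :
    eval v (∏ i, (X k - C (α i) * X 2) ^ e i) = gp α e (v k) (v 2) := by
  simp [gp, eval_prod]

lemma aeval_G {r : ℕ} (α : Fin r → ℂ) (e : Fin r → ℕ) (k : Fin 3) (φ : Fin 3 → Polynomial ℂ) (w : ℂ)
    (h0 : φ k = Polynomial.X) (h2 : φ 2 = Polynomial.C w) :
    aeval φ (∏ i, (X k - C (α i) * X 2) ^ e i) = GP α e w := by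
  simp only [GP, map_prod, map_pow, map_sub, map_mul, aeval_X, h0, h2, aeval_C]
  rfl

lemma aeval_G' {r : ℕ} (α : Fin r → ℂ) (e : Fin r → ℕ) (k : Fin 3) (φ : Fin 3 → Polynomial ℂ) (x w : ℂ)
    (h0 : φ k = Polynomial.C x) (h2 : φ 2 = Polynomial.C w) :
    aeval φ (∏ i, (X k - C (α i) * X 2) ^ e i) = Polynomial.C (gp α e x w) := by
  simp only [gp, map_prod, map_pow, map_sub, map_mul, aeval_X, h0, h2, aeval_C]
  rfl

lemma eval_aeval (φ : Fin 3 → Polynomial ℂ) (x : ℂ) (p : MvPolynomial (Fin 3) ℂ) :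
    (aeval φ p).eval x = eval (fun i => (φ i).eval x) p := by
  induction p using MvPolynomial.induction_on with
  | C a => simp
  | add p q hp hq => simp [hp, hq]
  | mul_X p i ih => simp [ih]

lemma homog_G {r : ℕ} (α : Fin r → ℂ) (e : Fin r → ℕ) (k : Fin 3) :
    (∏ i, (X k - C (α i) * X 2 : MvPolynomial (Fin 3) ℂ) ^ e i).IsHomogeneous (∑ i, e i) := by
  refine IsHomogeneous.prod _ _ _ fun i _ => ?_
  have : (X k - C (α i) * X 2 : MvPolynomial (Fin 3) ℂ).IsHomogeneous 1 := by
    refine (isHomogeneous_X _ _).sub ?_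
    simpa using (isHomogeneous_C (Fin 3) (α i)).mul (isHomogeneous_X ℂ 2)
  simpa using this.pow (e i)

lemma crit_of (D : Dat) (G F : MvPolynomial (Fin 3) ℂ)
    (hG : G = ∏ i, (X 0 - C (D.α i) * X 2) ^ D.e i)
    (hF : F = ∏ j, (X 1 - C (D.β j) * X 2) ^ D.μ j)
    (hsing : ∀ v : Fin 3 → ℂ, v ≠ 0 →
      eval v (G - F) = 0 → (∀ t : Fin 3, eval v (pderiv t (G - F)) = 0) →
      eval v G = 0) : D.Crit := by
  intro x y w hw h1 h2 h3
  have eG : ∀ v, eval v G = gp D.α D.e (v 0) (v 2) := fun v => by rw [hG, eval_G]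
  have eF : ∀ v, eval v F = gp D.β D.μ (v 1) (v 2) := fun v => by rw [hF, eval_G]
  have hv := hsing ![x, y, w] (fun h => hw (by simpa using congrFun h 2))
  rw [eG] at hv
  have ez : eval ![x, y, w] (G - F) = 0 := by rw [map_sub, eG, eF]; simp [h1]
  have d0 : eval ![x, y, w] (pderiv 0 (G - F)) = 0 := by
    have := pd_aeval Polynomial.derivative' ![Polynomial.X, Polynomial.C y, Polynomial.C w] 0
      (fun i => by fin_cases i <;> simp) (G - F)
    have := congrArg (Polynomial.eval x) this
    rw [eval_aeval, map_sub, hG, hF, aeval_G (w := w) (h0 := rfl) (h2 := rfl),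
      aeval_G' (x := y) (w := w) (h0 := rfl) (h2 := rfl), ← hG, ← hF] at this
    have e2 : (fun i => Polynomial.eval x (![Polynomial.X, Polynomial.C y, Polynomial.C w] i)) = ![x, y, w] := by
      funext i; fin_cases i <;> simp
    rw [e2] at this
    rw [← this]; simp [h2]
  have d1 : eval ![x, y, w] (pderiv 1 (G - F)) = 0 := by
    have := pd_aeval Polynomial.derivative' ![Polynomial.C x, Polynomial.X, Polynomial.C w] 1
      (fun i => by fin_cases i <;> simp) (G - F)
    have := congrArg (Polynomial.eval y) this
    rw [eval_aeval, map_sub, hG, hF, aeval_G (α := D.β) (w := w) (h0 := rfl) (h2 := rfl),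
      aeval_G' (x := x) (w := w) (h0 := rfl) (h2 := rfl), ← hG, ← hF] at this
    have e2 : (fun i => Polynomial.eval y (![Polynomial.C x, Polynomial.X, Polynomial.C w] i)) = ![x, y, w] := by
      funext i; fin_cases i <;> simp
    rw [e2] at this
    rw [← this]; simp [h3]
  have hh : (G - F).IsHomogeneous D.d := by
    rw [hG, hF]
    have a := homog_G D.α D.e 0
    have b := homog_G D.β D.μ 1
    rw [D.hdg] at a
    rw [D.hdf] at b
    exact a.sub b
  have d2 : eval ![x, y, w] (pderiv 2 (G - F)) = 0 := by
    have := congrArg (eval ![x, y, w]) hh.sum_X_mul_pderiv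
    rw [Fin.sum_univ_three] at this
    simp only [map_add, map_mul, eval_X, d0, d1, nsmul_eq_mul, ez] at this
    simpa [hw] using this
  refine hv ez fun t => ?_
  fin_cases t
  exacts [d0, d1, d2]

lemma final_aux (D : Dat) (hcrit : D.Crit) (pr : Projectivization ℂ (Fin 3 → ℂ) → Prop)
    (hpr : ∀ Q, pr Q ↔ tv Q.rep ∈ D.S) (p : {Q : Projectivization ℂ (Fin 3 → ℂ) // pr Q}) :
    Nonempty (FundamentalGroup {Q : Projectivization ℂ (Fin 3 → ℂ) // pr Q} p ≃*
      PresentedGroup (Dat.Rels (Finset.univ.gcd D.μ) (Finset.univ.gcd D.e) D.d)) := by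
  obtain rfl : pr = fun Q => tv Q.rep ∈ D.S := funext fun Q => propext (hpr Q)
  obtain ⟨φ⟩ := D.main_iso hcrit
  exact ⟨(FundamentalGroup.fundamentalGroupMulEquivOfPathConnected (X := D.X) p D.xs).trans φ⟩
end JC

open MvPolynomial

/-- Let `ḡ(x,w) = ∏ (x−αᵢw)^{nᵢ}` and `f̄(y,w) = ∏ (y−βⱼw)^{mⱼ}` be homogeneous
of the same degree `d`, with the `αᵢ` (resp. `βⱼ`) pairwise distinct, let
`B̄ ⊂ ℙ²(ℂ)` be the curve `ḡ = f̄` (homogeneous coordinates `[x:y:w]` given by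
the variables `X 0, X 1, X 2`), and suppose every singular point of `B̄` lies
on `{ḡ = 0}`.  With `n = gcd(nᵢ)` and `m = gcd(mⱼ)`, the fundamental group of
`ℙ²(ℂ) ∖ B̄` is isomorphic to the quotient of `G_{m,n}` (generators indexed
cyclically by `ZMod m`, relators `gₖ⁻¹·(g₁⋯g_n)·g_{k+n}·(g₁⋯g_n)⁻¹`) by the
extra relator `(g₁⋯g_m)^(d/m)`. -/
theorem stmt_9 (r s d : ℕ) (hd : 0 < d)
    (α : Fin r → ℂ) (β : Fin s → ℂ)
    (hα : Function.Injective α) (hβ : Function.Injective β)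
    (e : Fin r → ℕ) (μ : Fin s → ℕ) (he : ∀ i, 0 < e i) (hμ : ∀ j, 0 < μ j)
    (hdg : ∑ i, e i = d) (hdf : ∑ j, μ j = d)
    (G F : MvPolynomial (Fin 3) ℂ)
    (hG : G = ∏ i, (X 0 - C (α i) * X 2) ^ e i)
    (hF : F = ∏ j, (X 1 - C (β j) * X 2) ^ μ j)
    (hsing : ∀ v : Fin 3 → ℂ, v ≠ 0 →
      eval v (G - F) = 0 → (∀ t : Fin 3, eval v (pderiv t (G - F)) = 0) →
      eval v G = 0)
    (n m : ℕ) (hn : n = Finset.univ.gcd e) (hm : m = Finset.univ.gcd μ)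
    (rels : Set (FreeGroup (ZMod m)))
    (hrels : rels = {w : FreeGroup (ZMod m) | ∃ kk : ZMod m,
      w = (FreeGroup.of kk)⁻¹ *
          (((List.range n).map (fun i => FreeGroup.of ((i + 1 : ℕ) : ZMod m))).prod) *
          FreeGroup.of (kk + (n : ZMod m)) *
          (((List.range n).map (fun i => FreeGroup.of ((i + 1 : ℕ) : ZMod m))).prod)⁻¹}
        ∪ {(((List.range m).map (fun i => FreeGroup.of ((i + 1 : ℕ) : ZMod m))).prod) ^ (d / m)})
    (p : {Q : Projectivization ℂ (Fin 3 → ℂ) // eval Q.rep (G - F) ≠ 0}) :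
    Nonempty (FundamentalGroup
        {Q : Projectivization ℂ (Fin 3 → ℂ) // eval Q.rep (G - F) ≠ 0} p
      ≃* PresentedGroup rels) := by
  subst hn hm hrels
  let D : JC.Dat := ⟨r, s, d, hd, α, β, hα, hβ, e, μ, he, hμ, hdg, hdf⟩
  have hcrit : D.Crit := JC.crit_of D G F hG hF hsing
  refine JC.final_aux D hcrit (fun Q => eval Q.rep (G - F) ≠ 0) (fun Q => ?_) p
  show eval Q.rep (G - F) ≠ 0 ↔ JC.gp α e (Q.rep 0) (Q.rep 2) ≠ JC.gp β μ (Q.rep 1) (Q.rep 2)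
  rw [map_sub, hG, hF, JC.eval_G, JC.eval_G, sub_ne_zero]
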